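/- arXiv:1602.08362 — 5 statements merged into one kernel-verified Lean document; each statement's English description precedes it below -/
import Mathlib

section
/- Strong converse for the product-state capacity of a quantum channel with ergodic Markovian memory: Let λ ∈ (0,1). For every ε > 0 there exists n₀ ∈ ℕ such that for all n ≥ n₀ and every (n,λ) product-state code with N codewords, log₂ N ≤ n(χ* + ε). -/
open scoped BigOperators ComplexOrder Matrix

/-- A density matrix: positive semidefinite with unit trace. -/
def IsDensity {D : Type*} [Fintype D] (ρ : Matrix D D ℂ) : Prop :=
  ρ.PosSemidef ∧ ρ.trace = 1

/-- The von Neumann entropy (base 2) of a Hermitian matrix, via its eigenvalues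
(junk value `0` on non-Hermitian matrices); note `Real.logb 2 0 = 0`. -/
noncomputable def vnEntropy {D : Type*} [Fintype D] [DecidableEq D] (ρ : Matrix D D ℂ) : ℝ :=
  if h : ρ.IsHermitian then -∑ p, h.eigenvalues p * Real.logb 2 (h.eigenvalues p) else 0

/-- The tensor product `A₁ ⊗ ⋯ ⊗ A_m` of `d × d` matrices, as a matrix on
`(ℂ^d)^{⊗m} ≃ ℂ^(Fin m → Fin d)`. -/
noncomputable def matTensor {m d : ℕ} (A : Fin m → Matrix (Fin d) (Fin d) ℂ) :
    Matrix (Fin m → Fin d) (Fin m → Fin d) ℂ :=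
  Matrix.of fun x y => ∏ k, A k (x k) (y k)

/-- The quantum channel with Kraus operators `A s`: `ρ ↦ ∑ s, A s ρ (A s)ᴴ`. -/
noncomputable def krausChannel {dH dK S : ℕ} (A : Fin S → Matrix (Fin dK) (Fin dH) ℂ)
    (ρ : Matrix (Fin dH) (Fin dH) ℂ) : Matrix (Fin dK) (Fin dK) ℂ :=
  ∑ s, A s * ρ * (A s)ᴴ

/-- The Markov path weight `γ_{i₁} q_{i₁,i₂} ⋯ q_{i_{n−1},i_n}`. -/
noncomputable def markovWeight {I : Type*} (γ : I → ℝ) (q : I → I → ℝ) {n : ℕ}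
    (i : Fin n → I) : ℝ :=
  ∏ k : Fin n,
    if (k : ℕ) = 0 then γ (i k)
    else q (i ⟨(k : ℕ) - 1, lt_of_le_of_lt (Nat.sub_le _ _) k.isLt⟩) (i k)

/-- The `n`-block Markov-correlated channel
`Φ^{(n)}(ρ₁ ⊗ ⋯ ⊗ ρₙ) = ∑_{i₁,…,iₙ} γ_{i₁} q_{i₁,i₂} ⋯ q_{i_{n−1},iₙ}
Φ_{i₁}(ρ₁) ⊗ ⋯ ⊗ Φ_{iₙ}(ρₙ)` applied to a product state `ρ₁ ⊗ ⋯ ⊗ ρₙ`. -/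
noncomputable def channelOut {I : Type*} [Fintype I] {dH dK S : ℕ}
    (γ : I → ℝ) (q : I → I → ℝ) (A : I → Fin S → Matrix (Fin dK) (Fin dH) ℂ)
    {n : ℕ} (ρ : Fin n → Matrix (Fin dH) (Fin dH) ℂ) :
    Matrix (Fin n → Fin dK) (Fin n → Fin dK) ℂ :=
  ∑ i : Fin n → I,
    ((markovWeight γ q i : ℝ) : ℂ) • matTensor fun k => krausChannel (A (i k)) (ρ k)

/-- The set of Holevo quantities `S(∑ⱼ pⱼ Φ^{(n)}(ρⱼ)) − ∑ⱼ pⱼ S(Φ^{(n)}(ρⱼ))` of finite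
ensembles of product states on `H^{⊗n}`; its supremum is the product-state Holevo
quantity `χ^{(n)}`. -/
noncomputable def prodHolevoSet {I : Type*} [Fintype I] {dH dK S : ℕ}
    (γ : I → ℝ) (q : I → I → ℝ) (A : I → Fin S → Matrix (Fin dK) (Fin dH) ℂ) (n : ℕ) :
    Set ℝ :=
  { x | ∃ (J : ℕ) (prob : Fin J → ℝ) (ρ : Fin J → Fin n → Matrix (Fin dH) (Fin dH) ℂ),
      (∀ j, 0 ≤ prob j) ∧ ∑ j, prob j = 1 ∧ (∀ j k, IsDensity (ρ j k)) ∧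
      x = vnEntropy (∑ j, ((prob j : ℝ) : ℂ) • channelOut γ q A (ρ j)) -
        ∑ j, prob j * vnEntropy (channelOut γ q A (ρ j)) }

set_option linter.unusedSectionVars false
section ChainLemmas

variable {I : Type*} [Fintype I]

lemma sum_snoc' {n : ℕ} {β : Type*} [AddCommMonoid β] (G : (Fin (n+1) → I) → β) :
    ∑ i : Fin (n+1) → I, G i = ∑ i : Fin n → I, ∑ a, G (Fin.snoc i a) := by
  rw [← (Fin.snocEquiv (fun _ : Fin (n+1) => I)).sum_comp, Fintype.sum_prod_type, Finset.sum_comm]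
  rfl

lemma mw_snoc (γ : I → ℝ) (q : I → I → ℝ) {n : ℕ} (i : Fin (n+1) → I) (a : I) :
    markovWeight γ q (Fin.snoc i a : Fin (n+2) → I) =
      markovWeight γ q i * q (i (Fin.last n)) a := by
  unfold markovWeight
  rw [Fin.prod_univ_castSucc]
  congr 1
  · apply Finset.prod_congr rfl
    intro k _
    have h1 : (Fin.snoc i a : Fin (n+2) → I) k.castSucc = i k := by simp
    have h2 : (Fin.snoc i a : Fin (n+2) → I) ⟨(k : ℕ) - 1, by omega⟩ = i ⟨(k : ℕ) - 1, by omega⟩ := by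
      have : (⟨(k : ℕ) - 1, by omega⟩ : Fin (n+2)) = Fin.castSucc ⟨(k : ℕ) - 1, by omega⟩ := rfl
      rw [this, Fin.snoc_castSucc]
    simp only [Fin.val_castSucc]
    rw [h1, h2]
  · have : (⟨((Fin.last (n+1) : Fin (n+2)) : ℕ) - 1, by simp⟩ : Fin (n+2)) = Fin.castSucc (Fin.last n) := by
      ext; simp
    rw [this]
    simp

lemma mw_one (γ : I → ℝ) (q : I → I → ℝ) (i : Fin 1 → I) : markovWeight γ q i = γ (i 0) := by
  simp [markovWeight]

lemma mw_zero (γ : I → ℝ) (q : I → I → ℝ) (i : Fin 0 → I) : markovWeight γ q i = 1 := by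
  simp [markovWeight]

lemma mw_nonneg {γ : I → ℝ} {q : I → I → ℝ} (hγ : ∀ i, 0 ≤ γ i) (hq : ∀ i j, 0 ≤ q i j)
    {n : ℕ} (i : Fin n → I) : 0 ≤ markovWeight γ q i := by
  unfold markovWeight
  apply Finset.prod_nonneg
  intro k _
  split_ifs
  · exact hγ _
  · exact hq _ _

lemma mw_succ_snoc (γ : I → ℝ) (q : I → I → ℝ) {n : ℕ} (i : Fin n → I) (a : I) :
    markovWeight γ q (Fin.snoc i a : Fin (n+1) → I) =
      markovWeight γ q i * (if h : n = 0 then γ a else q (i ⟨n - 1, by omega⟩) a) := by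
  cases n with
  | zero => simp [mw_one, mw_zero, Fin.snoc]
  | succ n => rw [mw_snoc]; simp; left; rfl

lemma mw_marg (γ : I → ℝ) (q : I → I → ℝ) (hγ1 : ∑ i, γ i = 1) (hrow : ∀ i, ∑ i', q i i' = 1)
    {n : ℕ} (G : (Fin n → I) → ℝ) :
    ∑ i : Fin (n+1) → I, markovWeight γ q i * G (Fin.init i) = ∑ i : Fin n → I, markovWeight γ q i * G i := by
  rw [sum_snoc']
  apply Finset.sum_congr rfl
  intro i _
  simp only [Fin.init_snoc, mw_succ_snoc]
  rw [← Finset.sum_mul, ← Finset.mul_sum]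
  have : (∑ a, if h : n = 0 then γ a else q (i ⟨n - 1, by omega⟩) a) = 1 := by
    by_cases h : n = 0
    · simp [h, hγ1]
    · simp [h, hrow]
  rw [this, mul_one]

variable [DecidableEq I]

lemma mw_last (γ : I → ℝ) (q : I → I → ℝ) (n : ℕ) (h : I → ℝ) :
    ∑ i : Fin (n+1) → I, markovWeight γ q i * h (i (Fin.last n)) =
      ∑ u, γ u * ((Matrix.of q ^ n).mulVec h) u := by
  induction n generalizing h with
  | zero =>
    rw [sum_snoc']
    simp [mw_one, Fin.snoc]
  | succ n ih =>
    rw [sum_snoc']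
    have := ih ((Matrix.of q).mulVec h)
    rw [Matrix.mulVec_mulVec, ← pow_succ] at this
    rw [← this]
    apply Finset.sum_congr rfl
    intro i _
    simp only [mw_snoc, Fin.snoc_last, Matrix.mulVec, dotProduct, Matrix.of_apply]
    rw [Finset.mul_sum]
    apply Finset.sum_congr rfl
    intro a _
    ring

lemma mwinv_pow (γ : I → ℝ) (q : I → I → ℝ) (hinv : ∀ i', ∑ i, γ i * q i i' = γ i') (n : ℕ) :
    Matrix.vecMul γ (Matrix.of q ^ n) = γ := by
  induction n with
  | zero => simp
  | succ n ih =>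
    rw [pow_succ, ← Matrix.vecMul_vecMul, ih]
    ext i'
    simpa [Matrix.vecMul, dotProduct] using hinv i'

lemma inv_pow_sum (γ : I → ℝ) (q : I → I → ℝ) (hinv : ∀ i', ∑ i, γ i * q i i' = γ i') (n : ℕ)
    (h : I → ℝ) : ∑ u, γ u * ((Matrix.of q ^ n).mulVec h) u = ∑ u, γ u * h u := by
  have := Matrix.dotProduct_mulVec γ (Matrix.of q ^ n) h
  rw [mwinv_pow γ q hinv] at this
  simpa [dotProduct] using this

lemma two_point_last (γ : I → ℝ) (q : I → I → ℝ) (hinv : ∀ i', ∑ i, γ i * q i i' = γ i') (n : ℕ)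
    (a : Fin (n+1)) (g h : I → ℝ) :
    ∑ i : Fin (n+1) → I, markovWeight γ q i * (g (i a) * h (i (Fin.last n))) =
      ∑ u, γ u * (g u * ((Matrix.of q ^ (n - a)).mulVec h) u) := by
  induction n generalizing h with
  | zero =>
    have : a = 0 := by ext; omega
    subst this
    rw [sum_snoc']
    simp [mw_one, Fin.snoc]
  | succ n ih =>
    refine Fin.lastCases ?_ (fun a' => ?_) a
    · have := mw_last γ q (n+1) (fun u => g u * h u)
      rw [inv_pow_sum γ q hinv] at this
      simpa using this
    · have := ih a' ((Matrix.of q).mulVec h)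
      rw [Matrix.mulVec_mulVec, ← pow_succ] at this
      have e : n - (a' : ℕ) + 1 = n + 1 - (a'.castSucc : ℕ) := by
        simp; omega
      rw [e] at this
      rw [← this, sum_snoc']
      apply Finset.sum_congr rfl
      intro i _
      simp only [mw_snoc, Fin.snoc_last, Fin.snoc_castSucc, Matrix.mulVec, dotProduct, Matrix.of_apply]
      rw [Finset.mul_sum, Finset.mul_sum]
      apply Finset.sum_congr rfl
      intro c _
      ring

lemma two_point (γ : I → ℝ) (q : I → I → ℝ) (hγ1 : ∑ i, γ i = 1) (hrow : ∀ i, ∑ i', q i i' = 1)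
    (hinv : ∀ i', ∑ i, γ i * q i i' = γ i') (n : ℕ)
    (a b : Fin n) (hab : a ≤ b) (g h : I → ℝ) :
    ∑ i : Fin n → I, markovWeight γ q i * (g (i a) * h (i b)) =
      ∑ u, γ u * (g u * ((Matrix.of q ^ ((b : ℕ) - a)).mulVec h) u) := by
  induction n with
  | zero => exact a.elim0
  | succ n ih =>
    induction b using Fin.lastCases with
    | last => exact two_point_last γ q hinv n a g h
    | cast b' =>
      induction a using Fin.lastCases with
      | last => exact absurd hab (by simp [Fin.le_def])
      | cast a' =>
        have h1 := ih a' b' (by simpa using hab)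
        have h2 := mw_marg γ q hγ1 hrow (fun i : Fin n → I => g (i a') * h (i b'))
        simp only [Fin.val_castSucc]
        rw [← h1, ← h2]
        rfl

lemma one_point (γ : I → ℝ) (q : I → I → ℝ) (hγ1 : ∑ i, γ i = 1) (hrow : ∀ i, ∑ i', q i i' = 1)
    (hinv : ∀ i', ∑ i, γ i * q i i' = γ i') (n : ℕ) (a : Fin n) (g : I → ℝ) :
    ∑ i : Fin n → I, markovWeight γ q i * g (i a) = ∑ u, γ u * g u := by
  have := two_point γ q hγ1 hrow hinv n a a le_rfl g (fun _ => 1)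
  simpa using this

lemma mw_sum (γ : I → ℝ) (q : I → I → ℝ) (hγ1 : ∑ i, γ i = 1) (hrow : ∀ i, ∑ i', q i i' = 1)
    (n : ℕ) : ∑ i : Fin n → I, markovWeight γ q i = 1 := by
  induction n with
  | zero => simp [mw_zero]
  | succ n ih =>
    have := mw_marg γ q hγ1 hrow (n := n) (fun _ => 1)
    simpa [ih] using this

/-- the weight of a path is dominated by its endpoint mass -/
lemma mw_le_point (γ : I → ℝ) (q : I → I → ℝ) (hγ0 : ∀ i, 0 ≤ γ i) (hq0 : ∀ i j, 0 ≤ q i j)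
    (hγ1 : ∑ i, γ i = 1) (hrow : ∀ i, ∑ i', q i i' = 1)
    (hinv : ∀ i', ∑ i, γ i * q i i' = γ i') (n : ℕ) (a : Fin n) (i : Fin n → I) :
    markovWeight γ q i ≤ γ (i a) := by
  have := one_point γ q hγ1 hrow hinv n a (fun u => if u = i a then 1 else 0)
  simp only [mul_ite, mul_one, mul_zero, Finset.sum_ite_eq', Finset.mem_univ, if_true] at this
  rw [← this]
  have h2 := Finset.single_le_sum (f := fun j : Fin n → I => if j a = i a then markovWeight γ q j else 0)
    (s := Finset.univ) (fun j _ => by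
      split_ifs
      · exact mw_nonneg hγ0 hq0 j
      · exact le_rfl) (Finset.mem_univ i)
  simpa using h2

lemma mw_le_prod (γ : I → ℝ) (q : I → I → ℝ) (hγ0 : ∀ i, 0 ≤ γ i) (hq0 : ∀ i j, 0 ≤ q i j)
    (hγ1 : ∑ i, γ i = 1) (hrow : ∀ i, ∑ i', q i i' = 1)
    (hinv : ∀ i', ∑ i, γ i * q i i' = γ i') (c : ℝ) (hc : 1 ≤ c)
    (hqc : ∀ a b, 0 < γ a → q a b ≤ c * γ b) (n : ℕ) (i : Fin n → I) :
    markovWeight γ q i ≤ c ^ n * ∏ j, γ (i j) := by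
  have hc0 : 0 ≤ c := by linarith
  induction n with
  | zero => simp [mw_zero]
  | succ n ih =>
    obtain ⟨i', a, rfl⟩ : ∃ (i' : Fin n → I) (a : I), i = Fin.snoc i' a :=
      ⟨Fin.init i, i (Fin.last n), (Fin.snoc_init_self i).symm⟩
    rw [Fin.prod_univ_castSucc]
    simp only [Fin.snoc_castSucc, Fin.snoc_last]
    have hP : 0 ≤ ∏ j, γ (i' j) := Finset.prod_nonneg (fun _ _ => hγ0 _)
    cases n with
    | zero =>
      simp only [mw_one]
      simp [Fin.snoc]
      exact le_mul_of_one_le_left (hγ0 _) hc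
    | succ n =>
      rw [mw_snoc]
      have h0 := mw_nonneg hγ0 hq0 i'
      rcases h0.eq_or_lt with h0 | h0
      · rw [← h0, zero_mul]
        have := hγ0 a
        positivity
      · have hpos : 0 < γ (i' (Fin.last n)) :=
          lt_of_lt_of_le h0 (mw_le_point γ q hγ0 hq0 hγ1 hrow hinv _ _ _)
        calc markovWeight γ q i' * q (i' (Fin.last n)) a
            ≤ (c ^ (n+1) * ∏ j, γ (i' j)) * (c * γ a) :=
              mul_le_mul (ih i') (hqc _ _ hpos) (hq0 _ _) (by positivity)
          _ = _ := by ring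

end ChainLemmas

set_option linter.unusedSectionVars false
section LLN

variable {J D : Type*} [Fintype J] [DecidableEq J] [Fintype D] [DecidableEq D]

lemma pm_prod {k : ℕ} (p w : Fin k → D → ℝ) :
    ∑ x : Fin k → D, (∏ j, p j (x j)) * ∏ j, w j (x j) = ∏ j, ∑ y, p j y * w j y := by
  rw [Finset.prod_univ_sum, Fintype.piFinset_univ]
  apply Finset.sum_congr rfl
  intro x _
  rw [Finset.prod_mul_distrib]

lemma pm_two {k : ℕ} (p G : Fin k → D → ℝ) (hp : ∀ j, ∑ y, p j y = 1) (a b : Fin k) (hab : a ≠ b) :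
    ∑ x : Fin k → D, (∏ j, p j (x j)) * (G a (x a) * G b (x b)) =
      (∑ y, p a y * G a y) * (∑ y, p b y * G b y) := by
  have h := pm_prod p (fun j y => (if j = a then G a y else 1) * (if j = b then G b y else 1))
  have e1 : ∀ x : Fin k → D, (∏ j, ((if j = a then G a (x j) else 1) * (if j = b then G b (x j) else 1)))
      = G a (x a) * G b (x b) := by
    intro x
    rw [Finset.prod_mul_distrib]
    simp
  simp only [e1] at h
  rw [h]
  have e2 : ∀ j, (∑ y, p j y * ((if j = a then G a y else 1) * (if j = b then G b y else 1)))
      = (if j = a then (∑ y, p a y * G a y) else 1) * (if j = b then (∑ y, p b y * G b y) else 1) := by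
    intro j
    by_cases ha : j = a
    · subst ha
      simp [hab]
    · by_cases hb : j = b
      · subst hb
        simp [ha]
      · simp [ha, hb, hp]
  simp only [e2]
  rw [Finset.prod_mul_distrib]
  simp

lemma pm_one {k : ℕ} (p : Fin k → D → ℝ) (hp : ∀ j, ∑ y, p j y = 1) (a : Fin k) (g : D → ℝ) :
    ∑ x : Fin k → D, (∏ j, p j (x j)) * g (x a) = ∑ y, p a y * g y := by
  have h := pm_prod p (fun j y => (if j = a then g y else 1))
  have e1 : ∀ x : Fin k → D, (∏ j, ((if j = a then g (x j) else 1))) = g (x a) := by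
    intro x
    simp
  simp only [e1] at h
  rw [h]
  have e2 : ∀ j, (∑ y, p j y * (if j = a then g y else 1))
      = (if j = a then (∑ y, p a y * g y) else 1) := by
    intro j
    by_cases ha : j = a
    · subst ha
      simp
    · simp [ha, hp]
  simp only [e2]
  simp

lemma pm_sq {k : ℕ} (p G : Fin k → D → ℝ) (hp0 : ∀ j y, 0 ≤ p j y) (hp : ∀ j, ∑ y, p j y = 1)
    (M : ℝ) (hG : ∀ j y, |G j y| ≤ M) :
    ∑ x : Fin k → D, (∏ j, p j (x j)) * (∑ j, G j (x j)) ^ 2 ≤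
      (∑ j, ∑ y, p j y * G j y) ^ 2 + k * M ^ 2 := by
  have h1 : ∀ x : Fin k → D, (∏ j, p j (x j)) * (∑ j, G j (x j)) ^ 2 =
      ∑ a, ∑ b, (∏ j, p j (x j)) * (G a (x a) * G b (x b)) := by
    intro x
    rw [sq, Finset.sum_mul_sum, Finset.mul_sum]
    simp only [Finset.mul_sum]
  have h2 : ∑ x : Fin k → D, (∏ j, p j (x j)) * (∑ j, G j (x j)) ^ 2 =
      ∑ a, ∑ b, ∑ x : Fin k → D, (∏ j, p j (x j)) * (G a (x a) * G b (x b)) := by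
    simp only [h1]
    rw [Finset.sum_comm]
    apply Finset.sum_congr rfl
    intro a _
    rw [Finset.sum_comm]
  have h3 : (k : ℝ) * M ^ 2 = ∑ a : Fin k, ∑ b : Fin k, if a = b then M ^ 2 else 0 := by
    simp
  rw [h2, sq, Finset.sum_mul_sum, h3, ← Finset.sum_add_distrib]
  apply Finset.sum_le_sum
  intro a _
  rw [← Finset.sum_add_distrib]
  apply Finset.sum_le_sum
  intro b _
  by_cases hab : a = b
  · subst hab
    have := pm_one p hp a (fun y => G a y * G a y)
    simp only [this, if_true]
    have h4 : ∑ y, p a y * (G a y * G a y) ≤ ∑ y, p a y * M ^ 2 := by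
      apply Finset.sum_le_sum
      intro y _
      apply mul_le_mul_of_nonneg_left _ (hp0 a y)
      rw [← sq, ← sq_abs]
      exact pow_le_pow_left₀ (abs_nonneg _) (hG a y) 2
    rw [← Finset.sum_mul, hp, one_mul] at h4
    nlinarith [mul_self_nonneg (∑ y, p a y * G a y)]
  · rw [pm_two p G hp a b hab]
    simp [hab]

lemma near_card {k : ℕ} (m0 : ℕ) (a : Fin k) :
    ((Finset.univ.filter (fun b : Fin k => (a : ℕ) < b + m0 ∧ (b : ℕ) < a + m0)).card : ℝ) ≤ 2 * m0 := by
  have : (Finset.univ.filter (fun b : Fin k => (a : ℕ) < b + m0 ∧ (b : ℕ) < a + m0)).card ≤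
      (Finset.range (2 * m0)).card := by
    apply Finset.card_le_card_of_injOn (fun b : Fin k => (b : ℕ) + m0 - a)
    · intro b hb
      simp at hb ⊢
      omega
    · intro b hb b' hb' h
      simp at hb hb' h
      ext
      omega
  rw [Finset.card_range] at this
  exact_mod_cast this

variable (Γ : J → ℝ) (Q : J → J → ℝ)

lemma chain_sq (hΓ0 : ∀ b, 0 ≤ Γ b) (hQ0 : ∀ b b', 0 ≤ Q b b') (hΓ1 : ∑ b, Γ b = 1)
    (hrow : ∀ b, ∑ b', Q b b' = 1) (hinv : ∀ b', ∑ b, Γ b * Q b b' = Γ b')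
    (δ : ℝ) (hδ : 0 ≤ δ) (m0 : ℕ)
    (hm0 : ∀ m ≥ m0, ∀ b, ∑ b', |(Matrix.of Q ^ m) b b' - Γ b'| ≤ δ)
    {k : ℕ} (g : Fin k → J → ℝ) (M : ℝ) (hg : ∀ j b, |g j b| ≤ M) (hg0 : ∀ j, ∑ b, Γ b * g j b = 0) :
    ∑ B : Fin k → J, markovWeight Γ Q B * (∑ j, g j (B j)) ^ 2 ≤ M ^ 2 * (2 * m0 * k + δ * k ^ 2) := by
  have hpair : ∀ a b : Fin k, ∑ B : Fin k → J, markovWeight Γ Q B * (g a (B a) * g b (B b)) ≤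
      (if (a : ℕ) < b + m0 ∧ (b : ℕ) < a + m0 then M ^ 2 else 0) + δ * M ^ 2 := by
    have hfar : ∀ a b : Fin k, a ≤ b → (a : ℕ) + m0 ≤ b →
        ∑ B : Fin k → J, markovWeight Γ Q B * (g a (B a) * g b (B b)) ≤ δ * M ^ 2 := by
      intro a b hab hf
      rw [two_point Γ Q hΓ1 hrow hinv k a b hab]
      have hM : 0 ≤ M := by
        rcases isEmpty_or_nonempty J with h | h
        · simp at hΓ1
        · exact (abs_nonneg _).trans (hg a (Classical.arbitrary J))
      have h1 : ∀ u, |((Matrix.of Q ^ ((b : ℕ) - a)).mulVec (g b)) u| ≤ δ * M := by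
        intro u
        have e : ((Matrix.of Q ^ ((b : ℕ) - a)).mulVec (g b)) u =
            ∑ v, ((Matrix.of Q ^ ((b : ℕ) - a)) u v - Γ v) * g b v := by
          simp only [sub_mul, Finset.sum_sub_distrib, hg0, sub_zero]
          rfl
        rw [e]
        calc _ ≤ ∑ v, |((Matrix.of Q ^ ((b : ℕ) - a)) u v - Γ v) * g b v| := Finset.abs_sum_le_sum_abs _ _
          _ ≤ ∑ v, |((Matrix.of Q ^ ((b : ℕ) - a)) u v - Γ v)| * M := by
              apply Finset.sum_le_sum
              intro v _
              rw [abs_mul]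
              exact mul_le_mul_of_nonneg_left (hg b v) (abs_nonneg _)
          _ ≤ δ * M := by
              rw [← Finset.sum_mul]
              exact mul_le_mul_of_nonneg_right (hm0 _ (by omega) u) hM
      calc _ ≤ ∑ u, Γ u * (M * (δ * M)) := by
            apply Finset.sum_le_sum
            intro u _
            apply mul_le_mul_of_nonneg_left _ (hΓ0 u)
            apply (le_abs_self _).trans
            rw [abs_mul]
            exact mul_le_mul (hg a u) (h1 u) (abs_nonneg _) hM
        _ = δ * M ^ 2 := by rw [← Finset.sum_mul, hΓ1]; ring
    intro a b
    have hδM : 0 ≤ δ * M ^ 2 := by positivity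
    split_ifs with h
    · have : ∑ B : Fin k → J, markovWeight Γ Q B * (g a (B a) * g b (B b)) ≤ M ^ 2 := by
        calc _ ≤ ∑ B : Fin k → J, markovWeight Γ Q B * M ^ 2 := by
              apply Finset.sum_le_sum
              intro B _
              apply mul_le_mul_of_nonneg_left _ (mw_nonneg hΓ0 hQ0 B)
              apply (le_abs_self _).trans
              rw [abs_mul, sq]
              exact mul_le_mul (hg a _) (hg b _) (abs_nonneg _) ((abs_nonneg _).trans (hg a (B a)))
          _ = M ^ 2 := by rw [← Finset.sum_mul, mw_sum Γ Q hΓ1 hrow, one_mul]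
      linarith
    · rw [zero_add]
      by_cases h2 : (b : ℕ) < a + m0
      · have h3 : (b : ℕ) + m0 ≤ a := by
          by_contra h4
          exact h ⟨by omega, h2⟩
        have := hfar b a (by rw [Fin.le_def]; omega) h3
        simpa only [mul_comm (g a _)] using this
      · exact hfar a b (by rw [Fin.le_def]; omega) (by omega)
  have h1 : ∑ B : Fin k → J, markovWeight Γ Q B * (∑ j, g j (B j)) ^ 2 =
      ∑ a, ∑ b, ∑ B : Fin k → J, markovWeight Γ Q B * (g a (B a) * g b (B b)) := by
    have : ∀ B : Fin k → J, markovWeight Γ Q B * (∑ j, g j (B j)) ^ 2 =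
      ∑ a, ∑ b, markovWeight Γ Q B * (g a (B a) * g b (B b)) := by
      intro x
      rw [sq, Finset.sum_mul_sum, Finset.mul_sum]
      simp only [Finset.mul_sum]
    simp only [this]
    rw [Finset.sum_comm]
    apply Finset.sum_congr rfl
    intro a _
    rw [Finset.sum_comm]
  rw [h1]
  calc _ ≤ ∑ a : Fin k, ∑ b : Fin k, ((if (a : ℕ) < b + m0 ∧ (b : ℕ) < a + m0 then M ^ 2 else 0) + δ * M ^ 2) :=
        Finset.sum_le_sum (fun a _ => Finset.sum_le_sum (fun b _ => hpair a b))
    _ ≤ ∑ a : Fin k, (2 * m0 * M ^ 2 + k * (δ * M ^ 2)) := by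
        apply Finset.sum_le_sum
        intro a _
        rw [Finset.sum_add_distrib, ← Finset.sum_filter, Finset.sum_const, Finset.sum_const]
        simp only [nsmul_eq_mul, Finset.card_univ, Fintype.card_fin]
        have := mul_le_mul_of_nonneg_right (near_card m0 a) (sq_nonneg M)
        linarith
    _ = _ := by
        rw [Finset.sum_const]
        simp only [nsmul_eq_mul, Finset.card_univ, Fintype.card_fin]
        ring

lemma lln (hΓ0 : ∀ b, 0 ≤ Γ b) (hQ0 : ∀ b b', 0 ≤ Q b b') (hΓ1 : ∑ b, Γ b = 1)
    (hrow : ∀ b, ∑ b', Q b b' = 1) (hinv : ∀ b', ∑ b, Γ b * Q b b' = Γ b')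
    (hconv : ∀ b b', Filter.Tendsto (fun m => (Matrix.of Q ^ m) b b') Filter.atTop (nhds (Γ b')))
    (M α η : ℝ) (hM : 0 < M) (hα : 0 < α) (hη : 0 < η) :
    ∃ k0 : ℕ, ∀ k ≥ k0, ∀ (p : Fin k → J → D → ℝ) (F : Fin k → D → ℝ) (μ : Fin k → ℝ),
      (∀ j b y, 0 ≤ p j b y) → (∀ j b, ∑ y, p j b y = 1) → (∀ j y, |F j y| ≤ M) →
      (∀ j, μ j = ∑ b, Γ b * ∑ y, p j b y * F j y) →
      ∀ S : Finset (Fin k → D), (∀ x ∉ S, k * α ≤ |∑ j, (F j (x j) - μ j)|) →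
        ∑ x ∈ Sᶜ, ∑ B : Fin k → J, markovWeight Γ Q B * ∏ j, p j (B j) (x j) ≤ η := by
  set δ : ℝ := η * α ^ 2 / (8 * M ^ 2) with hδdef
  have hδ : 0 < δ := by positivity
  obtain ⟨m0, hm0⟩ : ∃ m0, ∀ m ≥ m0, ∀ b, ∑ b', |(Matrix.of Q ^ m) b b' - Γ b'| ≤ δ := by
    have h1 : ∀ b, Filter.Tendsto (fun m => ∑ b', |(Matrix.of Q ^ m) b b' - Γ b'|) Filter.atTop (nhds 0) := by
      intro b
      have : Filter.Tendsto (fun m => ∑ b', |(Matrix.of Q ^ m) b b' - Γ b'|) Filter.atTop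
          (nhds (∑ b', |Γ b' - Γ b'|)) := by
        apply tendsto_finsetSum
        intro b' _
        exact ((hconv b b').sub_const _).abs
      simpa using this
    have h2 : ∀ᶠ m in Filter.atTop, ∀ b, ∑ b', |(Matrix.of Q ^ m) b b' - Γ b'| ≤ δ := by
      rw [Filter.eventually_all]
      intro b
      exact ((h1 b).eventually (ge_mem_nhds hδ))
    exact Filter.eventually_atTop.1 h2
  obtain ⟨k1, hk1⟩ := exists_nat_gt ((4 * M ^ 2) * (2 * m0 + 1) * 2 / (η * α ^ 2))
  refine ⟨k1 + 1, ?_⟩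
  intro k hk p F μ hp0 hp1 hF hμ S hS
  have hkpos : (0 : ℝ) < k := by
    have : 0 < k := by omega
    exact_mod_cast this
  have hkk : (k1 : ℝ) ≤ k := by
    have : k1 ≤ k := by omega
    exact_mod_cast this
  set P : (Fin k → D) → ℝ := fun x => ∑ B : Fin k → J, markovWeight Γ Q B * ∏ j, p j (B j) (x j) with hP
  have hP0 : ∀ x, 0 ≤ P x := fun x => Finset.sum_nonneg (fun B _ =>
    mul_nonneg (mw_nonneg hΓ0 hQ0 B) (Finset.prod_nonneg (fun j _ => hp0 _ _ _)))
  have hμM : ∀ j, |μ j| ≤ M := by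
    intro j
    rw [hμ]
    calc _ ≤ ∑ b, |Γ b * ∑ y, p j b y * F j y| := Finset.abs_sum_le_sum_abs _ _
      _ ≤ ∑ b, Γ b * M := by
        apply Finset.sum_le_sum
        intro b _
        rw [abs_mul, abs_of_nonneg (hΓ0 b)]
        apply mul_le_mul_of_nonneg_left _ (hΓ0 b)
        calc _ ≤ ∑ y, |p j b y * F j y| := Finset.abs_sum_le_sum_abs _ _
          _ ≤ ∑ y, p j b y * M := by
            apply Finset.sum_le_sum
            intro y _
            rw [abs_mul, abs_of_nonneg (hp0 j b y)]
            exact mul_le_mul_of_nonneg_left (hF j y) (hp0 j b y)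
          _ = M := by rw [← Finset.sum_mul, hp1, one_mul]
      _ = M := by rw [← Finset.sum_mul, hΓ1, one_mul]
  have hG : ∀ j y, |F j y - μ j| ≤ 2 * M := by
    intro j y
    have := abs_sub (F j y) (μ j)
    linarith [hF j y, hμM j]
  set g : Fin k → J → ℝ := fun j b => ∑ y, p j b y * (F j y - μ j) with hgdef
  have hgM : ∀ j b, |g j b| ≤ 2 * M := by
    intro j b
    calc _ ≤ ∑ y, |p j b y * (F j y - μ j)| := Finset.abs_sum_le_sum_abs _ _
      _ ≤ ∑ y, p j b y * (2 * M) := by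
        apply Finset.sum_le_sum
        intro y _
        rw [abs_mul, abs_of_nonneg (hp0 j b y)]
        exact mul_le_mul_of_nonneg_left (hG j y) (hp0 j b y)
      _ = 2 * M := by rw [← Finset.sum_mul, hp1, one_mul]
  have hg0 : ∀ j, ∑ b, Γ b * g j b = 0 := by
    intro j
    have : ∀ b, Γ b * g j b = Γ b * (∑ y, p j b y * F j y) - Γ b * μ j := by
      intro b
      simp only [hgdef, mul_sub, Finset.sum_sub_distrib, ← Finset.sum_mul, hp1, one_mul]
    simp only [this, Finset.sum_sub_distrib, ← hμ, ← Finset.sum_mul, hΓ1, one_mul, sub_self]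
  have hsecond : ∑ x, P x * (∑ j, (F j (x j) - μ j)) ^ 2 ≤
      (2 * M) ^ 2 * (2 * m0 * k + δ * k ^ 2) + k * (2 * M) ^ 2 := by
    have e : ∑ x, P x * (∑ j, (F j (x j) - μ j)) ^ 2 =
        ∑ B : Fin k → J, markovWeight Γ Q B *
          ∑ x : Fin k → D, (∏ j, p j (B j) (x j)) * (∑ j, (F j (x j) - μ j)) ^ 2 := by
      simp only [hP, Finset.sum_mul, Finset.mul_sum]
      rw [Finset.sum_comm]
      simp only [mul_assoc]
    rw [e]
    calc _ ≤ ∑ B : Fin k → J, markovWeight Γ Q B * ((∑ j, g j (B j)) ^ 2 + k * (2 * M) ^ 2) := by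
          apply Finset.sum_le_sum
          intro B _
          apply mul_le_mul_of_nonneg_left _ (mw_nonneg hΓ0 hQ0 B)
          exact pm_sq (fun j => p j (B j)) (fun j y => F j y - μ j) (fun j y => hp0 _ _ _)
            (fun j => hp1 _ _) (2 * M) hG
      _ ≤ _ := by
          simp only [mul_add, Finset.sum_add_distrib]
          rw [← Finset.sum_mul, mw_sum Γ Q hΓ1 hrow, one_mul]
          have := chain_sq Γ Q hΓ0 hQ0 hΓ1 hrow hinv δ hδ.le m0 hm0 g (2 * M) hgM hg0
          linarith
  have hcheb : (k * α) ^ 2 * ∑ x ∈ Sᶜ, P x ≤ ∑ x, P x * (∑ j, (F j (x j) - μ j)) ^ 2 := by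
    rw [Finset.mul_sum]
    calc _ ≤ ∑ x ∈ Sᶜ, P x * (∑ j, (F j (x j) - μ j)) ^ 2 := by
          apply Finset.sum_le_sum
          intro x hx
          rw [mul_comm]
          apply mul_le_mul_of_nonneg_left _ (hP0 x)
          rw [← sq_abs (∑ j, (F j (x j) - μ j))]
          exact pow_le_pow_left₀ (by positivity) (hS x (by simpa using hx)) 2
      _ ≤ _ := Finset.sum_le_sum_of_subset_of_nonneg (Finset.subset_univ _)
          (fun x _ _ => mul_nonneg (hP0 x) (sq_nonneg _))
  have hfin : (2 * M) ^ 2 * (2 * m0 * k + δ * k ^ 2) + k * (2 * M) ^ 2 ≤ (k * α) ^ 2 * η := by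
    have h1 : (2 * M) ^ 2 * (δ * k ^ 2) = (k * α) ^ 2 * η / 2 := by
      rw [hδdef]
      field_simp
      ring
    have h2 : (4 * M ^ 2) * (2 * m0 + 1) * 2 < k * (η * α ^ 2) := by
      rw [div_lt_iff₀ (by positivity)] at hk1
      exact hk1.trans_le (mul_le_mul_of_nonneg_right hkk (by positivity))
    have h3 := mul_lt_mul_of_pos_left h2 hkpos
    nlinarith
  have := hcheb.trans (hsecond.trans hfin)
  exact le_of_mul_le_mul_left this (by positivity)

end LLN

set_option linter.unusedSectionVars false
section Quantum

variable {X : Type*} [Fintype X] [DecidableEq X]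

lemma spec_form {ρ : Matrix X X ℂ} (h : ρ.IsHermitian) :
    ∃ U : Matrix X X ℂ, Uᴴ * U = 1 ∧ U * Uᴴ = 1 ∧
      ρ = U * Matrix.diagonal (fun x => ((h.eigenvalues x : ℝ) : ℂ)) * Uᴴ := by
  refine ⟨h.eigenvectorUnitary, ?_, ?_, ?_⟩
  · exact Unitary.coe_star_mul_self h.eigenvectorUnitary
  · exact Unitary.coe_mul_star_self h.eigenvectorUnitary
  · have := h.spectral_theorem
    rw [Unitary.conjStarAlgAut_apply] at this
    exact this

lemma psd_factor {ρ : Matrix X X ℂ} (h : ρ.PosSemidef) : ∃ B : Matrix X X ℂ, ρ = Bᴴ * B := by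
  open scoped MatrixOrder in
  exact (CStarAlgebra.nonneg_iff_eq_star_mul_self (a := ρ)).1 (Matrix.nonneg_iff_posSemidef.2 h)

lemma tr_nonneg {R Y : Matrix X X ℂ} (hR : R.PosSemidef) (hY : Y.PosSemidef) :
    0 ≤ (Matrix.trace (R * Y)).re := by
  obtain ⟨B, rfl⟩ := psd_factor hY
  rw [← mul_assoc, Matrix.trace_mul_comm, ← mul_assoc]
  exact (Complex.le_def.1 (hR.mul_mul_conjTranspose_same B).trace_nonneg).1

lemma tr_mono {R Y Z : Matrix X X ℂ} (hR : R.PosSemidef) (hY : (Z - Y).PosSemidef) :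
    (Matrix.trace (R * Y)).re ≤ (Matrix.trace (R * Z)).re := by
  have := tr_nonneg hR hY
  rw [mul_sub, Matrix.trace_sub, Complex.sub_re] at this
  linarith

lemma psd_smul {R : Matrix X X ℂ} (hR : R.PosSemidef) {c : ℝ} (hc : 0 ≤ c) :
    ((c : ℂ) • R).PosSemidef :=
  hR.smul (by exact_mod_cast hc)

lemma pinch {P T : Matrix X X ℂ} (hP : Pᴴ = P) (hPP : P * P = P) (hT : T.PosSemidef)
    (hT1 : (1 - T).PosSemidef) :
    ((2 : ℂ) • (P * T * P) + (2 : ℂ) • (1 - P) - T).PosSemidef := by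
  have h1 : ((P - (1 - P)) * T * (P - (1 - P))ᴴ).PosSemidef := hT.mul_mul_conjTranspose_same _
  have h2 : ((1 - P) * (1 - T) * (1 - P)ᴴ).PosSemidef := hT1.mul_mul_conjTranspose_same _
  have h3 : ((2 : ℝ) : ℂ) • ((1 - P) * (1 - T) * (1 - P)ᴴ) + ((P - (1 - P)) * T * (P - (1 - P))ᴴ) =
      ((2 : ℂ) • (P * T * P) + (2 : ℂ) • (1 - P) - T) := by
    simp only [Matrix.conjTranspose_sub, hP, Matrix.conjTranspose_one, Complex.ofReal_ofNat]
    simp only [mul_sub, sub_mul, mul_one, one_mul, hPP, two_smul, mul_assoc]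
    abel
  rw [← h3]
  exact (psd_smul h2 (by norm_num)).add h1

/-- spectral projection onto the basis vectors in `S` of the basis given by `U`. -/
noncomputable def specP (U : Matrix X X ℂ) (S : Finset X) : Matrix X X ℂ :=
  U * Matrix.diagonal (fun x => if x ∈ S then (1 : ℂ) else 0) * Uᴴ

lemma diagconj_mul {U : Matrix X X ℂ} (hU : Uᴴ * U = 1) (s t : X → ℂ) :
    (U * Matrix.diagonal s * Uᴴ) * (U * Matrix.diagonal t * Uᴴ) =
      U * Matrix.diagonal (fun x => s x * t x) * Uᴴ := by
  rw [← Matrix.diagonal_mul_diagonal]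
  calc _ = U * Matrix.diagonal s * (Uᴴ * U) * Matrix.diagonal t * Uᴴ := by simp only [mul_assoc]
    _ = _ := by rw [hU]; simp only [mul_assoc, mul_one]

lemma diagconj_psd (U : Matrix X X ℂ) {s : X → ℝ} (hs : ∀ x, 0 ≤ s x) :
    (U * Matrix.diagonal (fun x => ((s x : ℝ) : ℂ)) * Uᴴ).PosSemidef := by
  apply Matrix.PosSemidef.mul_mul_conjTranspose_same
  apply Matrix.PosSemidef.diagonal
  intro x
  have := hs x
  simpa using this

lemma diagconj_sub (U : Matrix X X ℂ) (s t : X → ℂ) :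
    (U * Matrix.diagonal s * Uᴴ) - (U * Matrix.diagonal t * Uᴴ) =
      U * Matrix.diagonal (fun x => s x - t x) * Uᴴ := by
  rw [← sub_mul, ← mul_sub, Matrix.diagonal_sub]

lemma diagconj_one {U : Matrix X X ℂ} (hU : U * Uᴴ = 1) :
    (1 : Matrix X X ℂ) = U * Matrix.diagonal (fun _ => (1 : ℂ)) * Uᴴ := by
  rw [Matrix.diagonal_one, mul_one, hU]

lemma diagconj_smul (U : Matrix X X ℂ) (s : X → ℂ) (c : ℂ) :
    c • (U * Matrix.diagonal s * Uᴴ) = U * Matrix.diagonal (fun x => c * s x) * Uᴴ := by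
  have : (Matrix.diagonal (fun x => c * s x) : Matrix X X ℂ) = c • Matrix.diagonal s := by
    rw [← Matrix.diagonal_smul]; rfl
  rw [this]
  simp

lemma trace_mul_diagconj (R U : Matrix X X ℂ) (s : X → ℂ) :
    Matrix.trace (R * (U * Matrix.diagonal s * Uᴴ)) = ∑ x, (Uᴴ * R * U) x x * s x := by
  have : Matrix.trace (R * (U * Matrix.diagonal s * Uᴴ)) = Matrix.trace ((Uᴴ * R * U) * Matrix.diagonal s) := by
    rw [← mul_assoc, Matrix.trace_mul_comm]
    simp only [mul_assoc]
  rw [this]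
  simp [Matrix.trace, Matrix.mul_diagonal]

lemma specP_herm (U : Matrix X X ℂ) (S : Finset X) : (specP U S)ᴴ = specP U S := by
  unfold specP
  rw [Matrix.conjTranspose_mul, Matrix.conjTranspose_mul, Matrix.conjTranspose_conjTranspose,
    Matrix.diagonal_conjTranspose, mul_assoc]
  congr 3
  ext x
  simp only [Pi.star_apply]
  split_ifs <;> simp

lemma specP_idem {U : Matrix X X ℂ} (hU : Uᴴ * U = 1) (S : Finset X) :
    specP U S * specP U S = specP U S := by
  unfold specP
  rw [diagconj_mul hU]
  congr 3
  ext x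
  split_ifs <;> simp

lemma trace_compl {R U : Matrix X X ℂ} (hU' : U * Uᴴ = 1) (S : Finset X) :
    (Matrix.trace (R * (1 - specP U S))).re = ∑ x ∈ Sᶜ, ((Uᴴ * R * U) x x).re := by
  unfold specP
  rw [diagconj_one hU', diagconj_sub, trace_mul_diagconj, Complex.re_sum]
  rw [← Finset.sum_compl_add_sum S]
  have : ∑ x ∈ S, ((Uᴴ * R * U) x x * (1 - if x ∈ S then (1:ℂ) else 0)).re = 0 := by
    apply Finset.sum_eq_zero
    intro x hx
    simp [hx]
  rw [this, add_zero]
  apply Finset.sum_congr rfl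
  intro x hx
  simp at hx
  simp [hx]

lemma pinch_trace {R T U : Matrix X X ℂ} (hR : R.PosSemidef) (hT : T.PosSemidef)
    (hT1 : (1 - T).PosSemidef) (hU : Uᴴ * U = 1) (hU' : U * Uᴴ = 1) (S : Finset X) (η : ℝ)
    (hS : ∑ x ∈ Sᶜ, ((Uᴴ * R * U) x x).re ≤ η) :
    (Matrix.trace (R * T)).re ≤ 2 * (Matrix.trace (R * (specP U S * T * specP U S))).re + 2 * η := by
  have h := tr_mono hR (pinch (specP_herm U S) (specP_idem hU S) hT hT1)
  rw [← trace_compl hU'] at hS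
  rw [mul_add, Matrix.trace_add, Complex.add_re, Matrix.mul_smul, Matrix.mul_smul, Matrix.trace_smul,
    Matrix.trace_smul] at h
  simp only [smul_eq_mul, Complex.mul_re, Complex.re_ofNat, Complex.im_ofNat, zero_mul, sub_zero] at h
  linarith

lemma specP_le_one {U : Matrix X X ℂ} (hU' : U * Uᴴ = 1) (S : Finset X) :
    (1 - specP U S).PosSemidef := by
  unfold specP
  rw [diagconj_one hU', diagconj_sub]
  have := diagconj_psd U (s := fun x => 1 - if x ∈ S then 1 else 0) (fun x => by split_ifs <;> norm_num)
  convert this using 4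
  ext x
  split_ifs <;> simp

lemma sandwich_le_one {P T : Matrix X X ℂ} (hP : Pᴴ = P) (hPP : P * P = P) (hP1 : (1 - P).PosSemidef)
    (hT1 : (1 - T).PosSemidef) : (1 - P * T * P).PosSemidef := by
  have h2 : (P * (1 - T) * Pᴴ).PosSemidef := hT1.mul_mul_conjTranspose_same _
  have : 1 - P * T * P = (1 - P) + (P * (1 - T) * Pᴴ) := by
    rw [hP]
    simp only [mul_sub, sub_mul, mul_one, hPP]
    abel
  rw [this]
  exact hP1.add h2

lemma one_shot {R T U V : Matrix X X ℂ} (hR : R.PosSemidef) (hT : T.PosSemidef)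
    (hT1 : (1 - T).PosSemidef) (hU : Uᴴ * U = 1) (hU' : U * Uᴴ = 1)
    (hV : Vᴴ * V = 1) (hV' : V * Vᴴ = 1) (S1 S2 : Finset X) (η : ℝ)
    (h1 : ∑ x ∈ S1ᶜ, ((Uᴴ * R * U) x x).re ≤ η)
    (h2 : ∑ x ∈ S2ᶜ, ((Vᴴ * R * V) x x).re ≤ η)
    (s t : X → ℝ) (ht : ∀ x, 0 ≤ t x) (a b : ℝ) (ha : 0 ≤ a) (hb : 0 ≤ b)
    (hs : (U * Matrix.diagonal (fun x => ((s x : ℝ) : ℂ)) * Uᴴ - R).PosSemidef)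
    (hsa : ∀ x ∈ S1, s x ≤ a) (htb : ∀ x ∈ S2, 1 ≤ b * t x) :
    (Matrix.trace (R * T)).re ≤
      4 * (a * b) * (Matrix.trace ((V * Matrix.diagonal (fun x => ((t x : ℝ) : ℂ)) * Vᴴ) * T)).re + 6 * η := by
  set P1 := specP U S1 with hP1
  set P2 := specP V S2 with hP2
  have e1 := pinch_trace hR hT hT1 hV hV' S2 η h2
  have hT2 : (P2 * T * P2).PosSemidef := by
    have := hT.mul_mul_conjTranspose_same P2
    rwa [specP_herm] at this
  have hT21 : (1 - P2 * T * P2).PosSemidef :=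
    sandwich_le_one (specP_herm V S2) (specP_idem hV S2) (specP_le_one hV' S2) hT1
  have e2 := pinch_trace hR hT2 hT21 hU hU' S1 η h1
  have e3 : ((a : ℂ) • (1 : Matrix X X ℂ) - P1 * R * P1).PosSemidef := by
    have f1 := hs.mul_mul_conjTranspose_same P1
    rw [specP_herm, mul_sub, sub_mul] at f1
    have f2 : (((a : ℂ) • (1 : Matrix X X ℂ)) -
        P1 * (U * Matrix.diagonal (fun x => ((s x : ℝ) : ℂ)) * Uᴴ) * P1).PosSemidef := by
      rw [hP1, specP, diagconj_mul hU, diagconj_mul hU, diagconj_one hU', diagconj_smul, diagconj_sub]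
      have := diagconj_psd U (s := fun x => a - if x ∈ S1 then s x else 0) (fun x => by
        split_ifs with h
        · have := hsa x h
          linarith
        · linarith)
      convert this using 4
      ext x
      split_ifs <;> simp
    have f3 := f2.add f1
    rw [sub_add_sub_cancel] at f3
    exact f3
  have e4 : (Matrix.trace (R * (P1 * (P2 * T * P2) * P1))).re ≤ a * (Matrix.trace (P2 * T * P2)).re := by
    have f := tr_mono hT2 e3
    rw [Matrix.mul_smul, Matrix.trace_smul, mul_one] at f
    have g : Matrix.trace (R * (P1 * (P2 * T * P2) * P1)) = Matrix.trace (P2 * T * P2 * (P1 * R * P1)) := by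
      generalize P2 * T * P2 = Y
      have : R * (P1 * Y * P1) = (R * P1) * (Y * P1) := by simp only [mul_assoc]
      rw [this, Matrix.trace_mul_comm]
      simp only [mul_assoc]
    rw [g]
    simpa using f
  have e5 : (Matrix.trace (P2 * T * P2)).re ≤
      b * (Matrix.trace ((V * Matrix.diagonal (fun x => ((t x : ℝ) : ℂ)) * Vᴴ) * T)).re := by
    have g : Matrix.trace (P2 * T * P2) = Matrix.trace (T * P2) := by
      rw [Matrix.trace_mul_comm, ← mul_assoc, specP_idem hV, Matrix.trace_mul_comm]
    rw [g]
    have f : ((b : ℂ) • (V * Matrix.diagonal (fun x => ((t x : ℝ) : ℂ)) * Vᴴ) - P2).PosSemidef := by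
      rw [hP2, specP, diagconj_smul, diagconj_sub]
      have := diagconj_psd V (s := fun x => b * t x - if x ∈ S2 then 1 else 0) (fun x => by
        split_ifs with h
        · have := htb x h
          linarith
        · have := mul_nonneg hb (ht x)
          linarith)
      convert this using 4
      ext x
      split_ifs <;> simp
    have f2 := tr_mono hT f
    rw [Matrix.mul_smul, Matrix.trace_smul, Matrix.trace_mul_comm T (V * _ * _)] at f2
    simpa using f2
  have e6 := mul_le_mul_of_nonneg_left e5 ha
  linarith

end Quantum

section BigT

variable {D : Type*} [Fintype D] [DecidableEq D] {k : ℕ}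

/-- tensor product of matrices over a general index type -/
noncomputable def bigT (A : Fin k → Matrix D D ℂ) : Matrix (Fin k → D) (Fin k → D) ℂ :=
  Matrix.of fun x y => ∏ j, A j (x j) (y j)

lemma bigT_mul (A B : Fin k → Matrix D D ℂ) : bigT A * bigT B = bigT (fun j => A j * B j) := by
  ext x y
  simp only [bigT, Matrix.mul_apply, Matrix.of_apply]
  rw [Finset.prod_univ_sum, Fintype.piFinset_univ]
  apply Finset.sum_congr rfl
  intro z _
  rw [Finset.prod_mul_distrib]

lemma bigT_conj (A : Fin k → Matrix D D ℂ) : (bigT A)ᴴ = bigT (fun j => (A j)ᴴ) := by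
  ext x y
  simp [bigT, Matrix.conjTranspose_apply]

lemma bigT_diag (s : Fin k → D → ℂ) :
    bigT (fun j => Matrix.diagonal (s j)) = Matrix.diagonal (fun x => ∏ j, s j (x j)) := by
  ext x y
  simp only [bigT, Matrix.of_apply, Matrix.diagonal_apply]
  by_cases h : x = y
  · subst h
    simp
  · rw [if_neg h]
    obtain ⟨j, hj⟩ : ∃ j, x j ≠ y j := by
      by_contra hc
      push Not at hc
      exact h (funext hc)
    exact Finset.prod_eq_zero (Finset.mem_univ j) (by simp [hj])

lemma bigT_one : bigT (fun _ : Fin k => (1 : Matrix D D ℂ)) = 1 := by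
  have := bigT_diag (fun (_ : Fin k) (_ : D) => (1 : ℂ))
  simpa using this

lemma bigT_psd {A : Fin k → Matrix D D ℂ} (hA : ∀ j, (A j).PosSemidef) : (bigT A).PosSemidef := by
  choose B hB using fun j => psd_factor (hA j)
  have : bigT A = (bigT B)ᴴ * bigT B := by
    rw [bigT_conj, bigT_mul]
    congr 1
    ext1 j
    exact hB j
  rw [this]
  exact Matrix.posSemidef_conjTranspose_mul_self _

lemma bigT_trace (A : Fin k → Matrix D D ℂ) : (bigT A).trace = ∏ j, (A j).trace := by
  simp only [bigT, Matrix.trace, Matrix.diag_apply, Matrix.of_apply]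
  rw [Finset.prod_univ_sum, Fintype.piFinset_univ]

lemma bigT_sum {J : Type*} [Fintype J] (A : Fin k → J → Matrix D D ℂ) :
    bigT (fun j => ∑ b, A j b) = ∑ B : Fin k → J, bigT (fun j => A j (B j)) := by
  ext x y
  simp only [bigT, Matrix.of_apply, Matrix.sum_apply]
  rw [Finset.prod_univ_sum, Fintype.piFinset_univ]

lemma bigT_smul (c : Fin k → ℂ) (A : Fin k → Matrix D D ℂ) :
    bigT (fun j => c j • A j) = (∏ j, c j) • bigT A := by
  ext x y
  simp [bigT, Finset.prod_mul_distrib]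

end BigT

set_option linter.unusedSectionVars false
section Entropy

variable {D : Type*} [Fintype D] [DecidableEq D]

lemma unit_col {K : Matrix D D ℂ} (hK : Kᴴ * K = 1) (a : D) : ∑ x, Complex.normSq (K x a) = 1 := by
  have := congrFun (congrFun hK a) a
  rw [Matrix.mul_apply, Matrix.one_apply_eq] at this
  simp only [Matrix.conjTranspose_apply] at this
  have h2 : ∀ x, star (K x a) * K x a = ((Complex.normSq (K x a) : ℝ) : ℂ) := fun x => by
    rw [Complex.normSq_eq_conj_mul_self]; rfl
  simp only [h2] at this
  exact_mod_cast this

lemma conj_diag_entry (K : Matrix D D ℂ) (s : D → ℝ) (x : D) :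
    ((K * Matrix.diagonal (fun x => ((s x : ℝ) : ℂ)) * Kᴴ) x x).re = ∑ a, s a * Complex.normSq (K x a) := by
  rw [Matrix.mul_apply, Complex.re_sum]
  apply Finset.sum_congr rfl
  intro a _
  rw [Matrix.mul_diagonal, Matrix.conjTranspose_apply]
  have : K x a * (s a : ℂ) * star (K x a) = ((s a * Complex.normSq (K x a) : ℝ) : ℂ) := by
    push_cast
    rw [Complex.normSq_eq_conj_mul_self]
    change _ * _ * (starRingEnd ℂ) (K x a) = _
    ring
  rw [this, Complex.ofReal_re]

lemma quad_conj (K M : Matrix D D ℂ) (v : D → ℂ) :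
    star v ⬝ᵥ ((K * M * Kᴴ).mulVec v) = star (Kᴴ.mulVec v) ⬝ᵥ (M.mulVec (Kᴴ.mulVec v)) := by
  rw [Matrix.star_mulVec, Matrix.conjTranspose_conjTranspose, ← Matrix.dotProduct_mulVec,
    Matrix.mulVec_mulVec, Matrix.mulVec_mulVec, mul_assoc]

lemma quad_diag (s : D → ℝ) (v : D → ℂ) :
    (star v ⬝ᵥ ((Matrix.diagonal (fun x => ((s x : ℝ) : ℂ))).mulVec v)).re =
      ∑ x, s x * Complex.normSq (v x) := by
  rw [dotProduct, Complex.re_sum]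
  apply Finset.sum_congr rfl
  intro x _
  rw [Matrix.mulVec_diagonal]
  have : star v x * ((s x : ℂ) * v x) = ((s x * Complex.normSq (v x) : ℝ) : ℂ) := by
    push_cast
    rw [Complex.normSq_eq_conj_mul_self]
    change (starRingEnd ℂ) (v x) * _ = _
    ring
  rw [this, Complex.ofReal_re]

lemma col_bound {K : Matrix D D ℂ} {s t : D → ℝ} (hs : ∀ x, 0 ≤ s x) (ht : ∀ x, 0 < t x) {c : ℝ}
    (hc : 0 ≤ c)
    (h : ((c : ℂ) • Matrix.diagonal (fun x => ((t x : ℝ) : ℂ)) -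
      K * Matrix.diagonal (fun x => ((s x : ℝ) : ℂ)) * Kᴴ).PosSemidef) (a : D) :
    s a * ∑ x, Complex.normSq (K x a) / t x ≤ c := by
  set Z : ℝ := ∑ x, Complex.normSq (K x a) / t x with hZ
  set v : D → ℂ := fun x => K x a / (t x : ℂ) with hv
  have h1 := h.re_dotProduct_nonneg v
  rw [Matrix.sub_mulVec, dotProduct_sub, map_sub, quad_conj, Matrix.smul_mulVec, dotProduct_smul] at h1
  have h2 := quad_diag t v
  have h3 := quad_diag s (Kᴴ.mulVec v)
  have hZ0 : 0 ≤ Z := Finset.sum_nonneg (fun x _ => div_nonneg (Complex.normSq_nonneg _) (ht x).le)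
  have h4 : ∑ x, t x * Complex.normSq (v x) = Z := by
    apply Finset.sum_congr rfl
    intro x _
    have := ht x
    simp only [hv, map_div₀, Complex.normSq_ofReal]
    field_simp
  have h5 : (Kᴴ.mulVec v) a = (Z : ℂ) := by
    rw [Matrix.mulVec, dotProduct, hZ]
    push_cast
    apply Finset.sum_congr rfl
    intro x _
    rw [Matrix.conjTranspose_apply, hv, Complex.normSq_eq_conj_mul_self]
    change (starRingEnd ℂ) (K x a) * _ = _
    ring
  have h6 : s a * Z ^ 2 ≤ ∑ b, s b * Complex.normSq ((Kᴴ.mulVec v) b) := by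
    have := Finset.single_le_sum (f := fun b => s b * Complex.normSq ((Kᴴ.mulVec v) b))
      (s := Finset.univ) (fun b _ => mul_nonneg (hs b) (Complex.normSq_nonneg _)) (Finset.mem_univ a)
    simp only [h5, Complex.normSq_ofReal] at this
    rw [sq]
    exact this
  have h7 : s a * Z ^ 2 ≤ c * Z := by
    simp only [RCLike.re_to_complex, smul_eq_mul, Complex.mul_re, Complex.ofReal_re, Complex.ofReal_im,
      zero_mul, sub_zero] at h1
    rw [h2, h3, h4] at h1
    linarith
  rcases hZ0.eq_or_lt with h0 | h0
  · rw [← h0, mul_zero]; exact hc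
  · have : (s a * Z) * Z ≤ c * Z := by nlinarith
    exact le_of_mul_le_mul_right this h0

lemma cross_entropy {σ V W : Matrix D D ℂ} (hV : Vᴴ * V = 1) (hV' : V * Vᴴ = 1) (hW : Wᴴ * W = 1)
    {s t : D → ℝ}
    (hs : ∀ x, 0 ≤ s x) (hs1 : ∑ x, s x = 1) (ht : ∀ x, 0 < t x) {c : ℝ} (hc : 0 < c)
    (hσ : σ = W * Matrix.diagonal (fun x => ((s x : ℝ) : ℂ)) * Wᴴ)
    (h : ((c : ℂ) • (V * Matrix.diagonal (fun x => ((t x : ℝ) : ℂ)) * Vᴴ) - σ).PosSemidef) :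
    ∑ x, ((Vᴴ * σ * V) x x).re * (-Real.logb 2 (t x)) ≤ -∑ x, s x * Real.logb 2 (s x) + Real.logb 2 c := by
  set K := Vᴴ * W with hKdef
  have hK : Kᴴ * K = 1 := by
    rw [hKdef, Matrix.conjTranspose_mul, Matrix.conjTranspose_conjTranspose]
    calc _ = Wᴴ * (V * Vᴴ) * W := by simp only [mul_assoc]
      _ = 1 := by rw [hV', mul_one, hW]
  have e1 : Vᴴ * σ * V = K * Matrix.diagonal (fun x => ((s x : ℝ) : ℂ)) * Kᴴ := by
    rw [hσ, hKdef, Matrix.conjTranspose_mul, Matrix.conjTranspose_conjTranspose]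
    simp only [mul_assoc]
  have h' : ((c : ℂ) • Matrix.diagonal (fun x => ((t x : ℝ) : ℂ)) -
      K * Matrix.diagonal (fun x => ((s x : ℝ) : ℂ)) * Kᴴ).PosSemidef := by
    have f := h.conjTranspose_mul_mul_same V
    rw [mul_sub, sub_mul, e1] at f
    convert f using 2
    rw [Matrix.mul_smul, Matrix.smul_mul]
    congr 1
    calc _ = (Vᴴ * V) * Matrix.diagonal (fun x => ((t x : ℝ) : ℂ)) * (Vᴴ * V) := by rw [hV, one_mul, mul_one]
      _ = _ := by simp only [mul_assoc]
  have key : ∀ a, s a * (∑ x, Complex.normSq (K x a) * (Real.log (s a) - Real.log (t x) - Real.log c)) ≤ 0 := by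
    intro a
    rcases (hs a).eq_or_lt with h0 | h0
    · rw [← h0, zero_mul]
    · apply mul_nonpos_of_nonneg_of_nonpos h0.le
      calc _ ≤ ∑ x, Complex.normSq (K x a) * (s a / (c * t x) - 1) := by
            apply Finset.sum_le_sum
            intro x _
            apply mul_le_mul_of_nonneg_left _ (Complex.normSq_nonneg _)
            have htx := ht x
            rw [sub_sub, ← Real.log_mul htx.ne' hc.ne', ← Real.log_div h0.ne' (by positivity), mul_comm (t x)]
            exact Real.log_le_sub_one_of_pos (by positivity)
        _ = (s a * ∑ x, Complex.normSq (K x a) / t x) / c - 1 := by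
            simp only [mul_sub, mul_one, Finset.sum_sub_distrib, unit_col hK]
            congr 1
            rw [Finset.mul_sum, Finset.sum_div]
            apply Finset.sum_congr rfl
            intro x _
            have htx := ht x
            field_simp
        _ ≤ 0 := by
            have := col_bound hs ht hc.le h' a
            have := (div_le_one hc).2 this
            linarith
  have key2 := Finset.sum_nonpos (fun a (_ : a ∈ Finset.univ) => key a)
  have e2 : ∑ a, s a * (∑ x, Complex.normSq (K x a) * (Real.log (s a) - Real.log (t x) - Real.log c)) =
      ∑ a, s a * Real.log (s a) - Real.log c - ∑ x, ((Vᴴ * σ * V) x x).re * Real.log (t x) := by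
    have f1 : ∀ a, s a * (∑ x, Complex.normSq (K x a) * (Real.log (s a) - Real.log (t x) - Real.log c)) =
        s a * Real.log (s a) - s a * Real.log c - ∑ x, s a * Complex.normSq (K x a) * Real.log (t x) := by
      intro a
      simp only [mul_sub, Finset.sum_sub_distrib, ← Finset.sum_mul, unit_col hK, one_mul]
      rw [Finset.mul_sum]
      simp only [mul_assoc]
      ring
    simp only [f1, Finset.sum_sub_distrib, ← Finset.sum_mul, hs1, one_mul]
    congr 1
    rw [Finset.sum_comm]
    apply Finset.sum_congr rfl
    intro x _
    rw [e1, conj_diag_entry, Finset.sum_mul]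
  rw [e2] at key2
  have hl : 0 < Real.log 2 := Real.log_pos (by norm_num)
  have g1 : ∑ x, ((Vᴴ * σ * V) x x).re * (-Real.logb 2 (t x)) =
      -(∑ x, ((Vᴴ * σ * V) x x).re * Real.log (t x)) / Real.log 2 := by
    rw [neg_div, Finset.sum_div, ← Finset.sum_neg_distrib]
    apply Finset.sum_congr rfl
    intro x _
    rw [Real.logb]
    ring
  have g2 : ∑ x, s x * Real.logb 2 (s x) = (∑ x, s x * Real.log (s x)) / Real.log 2 := by
    rw [Finset.sum_div]
    apply Finset.sum_congr rfl
    intro x _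
    rw [Real.logb]
    ring
  rw [g1, g2, Real.logb, ← neg_div, ← add_div]
  apply div_le_div_of_nonneg_right _ hl.le
  linarith

lemma reg_entropy {s : D → ℝ} (hs : ∀ x, 0 ≤ s x) {β : ℝ} (hβ : 0 < β) :
    -∑ x, s x * Real.logb 2 (s x) - Fintype.card D * (β / Real.log 2) ≤
      ∑ x, s x * (-Real.logb 2 (s x + β)) := by
  have hl : 0 < Real.log 2 := Real.log_pos (by norm_num)
  have h1 : ∀ x, -(s x * Real.logb 2 (s x)) - β / Real.log 2 ≤ s x * (-Real.logb 2 (s x + β)) := by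
    intro x
    rcases (hs x).eq_or_lt with h0 | h0
    · rw [← h0]
      simp
      positivity
    · have h2 : Real.log (s x + β) - Real.log (s x) ≤ β / s x := by
        rw [← Real.log_div (by positivity) h0.ne']
        have := Real.log_le_sub_one_of_pos (x := (s x + β) / s x) (by positivity)
        have e : (s x + β) / s x - 1 = β / s x := by field_simp; ring
        linarith
      have h3 : s x * (Real.log (s x + β) - Real.log (s x)) ≤ β := by
        have := mul_le_mul_of_nonneg_left h2 h0.le
        rwa [mul_div_cancel₀ _ h0.ne'] at this
      have h4 := div_le_div_of_nonneg_right h3 hl.le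
      simp only [Real.logb]
      have e : s x * (Real.log (s x + β) - Real.log (s x)) / Real.log 2 =
        s x * (Real.log (s x + β) / Real.log 2) - s x * (Real.log (s x) / Real.log 2) := by ring
      rw [e] at h4
      linarith
  have h2 := Finset.sum_le_sum (fun x (_ : x ∈ Finset.univ) => h1 x)
  rw [Finset.sum_sub_distrib, Finset.sum_const, Finset.sum_neg_distrib, nsmul_eq_mul, Finset.card_univ] at h2
  exact h2

lemma dens_eig {ρ : Matrix D D ℂ} (h : IsDensity ρ) :
    (∀ x, 0 ≤ h.1.1.eigenvalues x) ∧ ∑ x, h.1.1.eigenvalues x = 1 ∧ (∀ x, h.1.1.eigenvalues x ≤ 1) := by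
  have h0 := h.1.eigenvalues_nonneg
  have h1 : ∑ x, h.1.1.eigenvalues x = 1 := by
    have := h.1.1.trace_eq_sum_eigenvalues.symm.trans h.2
    have h3 : ((∑ x, h.1.1.eigenvalues x : ℝ) : ℂ) = 1 := by
      rw [Complex.ofReal_sum]
      exact this
    exact_mod_cast h3
  refine ⟨h0, h1, fun x => ?_⟩
  rw [← h1]
  exact Finset.single_le_sum (fun y _ => h0 y) (Finset.mem_univ x)

lemma vn_eq {ρ : Matrix D D ℂ} (h : ρ.IsHermitian) :
    vnEntropy ρ = -∑ x, h.eigenvalues x * Real.logb 2 (h.eigenvalues x) := by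
  simp [vnEntropy, h]

lemma vn_nonneg {ρ : Matrix D D ℂ} (h : IsDensity ρ) : 0 ≤ vnEntropy ρ := by
  rw [vn_eq h.1.1, ← Finset.sum_neg_distrib]
  obtain ⟨h0, _, h1⟩ := dens_eig h
  apply Finset.sum_nonneg
  intro x _
  have := mul_nonpos_of_nonneg_of_nonpos (h0 x) (Real.logb_nonpos (b := 2) (by norm_num) (h0 x) (h1 x))
  linarith

lemma vn_le {ρ : Matrix D D ℂ} (h : IsDensity ρ) : vnEntropy ρ ≤ Fintype.card D * (1 / Real.log 2) := by
  have hl : 0 < Real.log 2 := Real.log_pos (by norm_num)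
  obtain ⟨h0, _, h1⟩ := dens_eig h
  have := reg_entropy h0 (β := 1) one_pos
  rw [← vn_eq] at this
  have h2 : ∑ x, h.1.1.eigenvalues x * (-Real.logb 2 (h.1.1.eigenvalues x + 1)) ≤ 0 := by
    apply Finset.sum_nonpos
    intro x _
    have hh := Real.logb_nonneg (b := 2) (by norm_num) (show 1 ≤ h.1.1.eigenvalues x + 1 by linarith [h0 x])
    have := mul_nonneg (h0 x) hh
    linarith
  linarith

lemma dens_entry {ρ : Matrix D D ℂ} (h : IsDensity ρ) (x y : D) : ‖ρ x y‖ ≤ 1 := by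
  obtain ⟨B, hB⟩ := psd_factor h.1
  have htr : ∑ y, ∑ z, Complex.normSq (B z y) = 1 := by
    have := h.2
    rw [hB, Matrix.trace] at this
    have h2 : ∀ y, (Bᴴ * B).diag y = ((∑ z, Complex.normSq (B z y) : ℝ) : ℂ) := by
      intro y
      rw [Matrix.diag_apply, Matrix.mul_apply]
      push_cast
      apply Finset.sum_congr rfl
      intro z _
      rw [Matrix.conjTranspose_apply, Complex.normSq_eq_conj_mul_self]; rfl
    simp only [h2] at this
    exact_mod_cast this
  have hc : ∀ y, ∑ z, Complex.normSq (B z y) ≤ 1 := by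
    intro y
    rw [← htr]
    exact Finset.single_le_sum (f := fun y => ∑ z, Complex.normSq (B z y))
      (fun y _ => Finset.sum_nonneg (fun z _ => Complex.normSq_nonneg _)) (Finset.mem_univ y)
  have : ρ x y = ∑ z, star (B z x) * B z y := by
    rw [hB, Matrix.mul_apply]
    rfl
  rw [this]
  calc _ ≤ ∑ z, ‖star (B z x) * B z y‖ := norm_sum_le _ _
    _ ≤ ∑ z, (Complex.normSq (B z x) + Complex.normSq (B z y)) / 2 := by
        apply Finset.sum_le_sum
        intro z _
        rw [norm_mul, norm_star, Complex.normSq_eq_norm_sq, Complex.normSq_eq_norm_sq]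
        nlinarith [sq_nonneg (‖B z x‖ - ‖B z y‖)]
    _ ≤ 1 := by
        rw [← Finset.sum_div, Finset.sum_add_distrib]
        linarith [hc x, hc y]

lemma small_le {Δ : Matrix D D ℂ} (hΔ : Δ.IsHermitian) {θ : ℝ} (h : ∀ x y, ‖Δ x y‖ ≤ θ) :
    (((θ * Fintype.card D : ℝ) : ℂ) • (1 : Matrix D D ℂ) - Δ).PosSemidef := by
  have hH : (((θ * Fintype.card D : ℝ) : ℂ) • (1 : Matrix D D ℂ) - Δ).IsHermitian := by
    apply Matrix.IsHermitian.sub _ hΔ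
    rw [Matrix.IsHermitian, Matrix.conjTranspose_smul, Matrix.conjTranspose_one]
    congr 1
    exact Complex.conj_ofReal _
  rw [hH.posSemidef_iff_eigenvalues_nonneg]
  intro i
  rw [hH.eigenvalues_eq]
  set v : D → ℂ := ⇑(hH.eigenvectorBasis i) with hv
  change 0 ≤ RCLike.re (star v ⬝ᵥ _)
  rw [Matrix.sub_mulVec, dotProduct_sub, map_sub]
  have h1 : RCLike.re (star v ⬝ᵥ (((θ * Fintype.card D : ℝ) : ℂ) • (1 : Matrix D D ℂ)).mulVec v) =
      θ * Fintype.card D * ∑ x, ‖v x‖ ^ 2 := by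
    have := quad_diag (fun _ : D => θ * Fintype.card D) v
    rw [Finset.mul_sum]
    simp only [Complex.normSq_eq_norm_sq] at this
    rw [← this]
    have e : ((θ * Fintype.card D : ℝ) : ℂ) • (1 : Matrix D D ℂ) =
      Matrix.diagonal (fun _ => ((θ * Fintype.card D : ℝ) : ℂ)) := by
      rw [← Matrix.diagonal_one, ← Matrix.diagonal_smul]
      congr 1
      ext x
      simp
    rw [e]
    rfl
  have h2 : RCLike.re (star v ⬝ᵥ Δ.mulVec v) ≤ θ * Fintype.card D * ∑ x, ‖v x‖ ^ 2 := by
    calc _ ≤ ‖star v ⬝ᵥ Δ.mulVec v‖ := RCLike.re_le_norm _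
      _ ≤ ∑ x, ∑ y, ‖v x‖ * (θ * ‖v y‖) := by
        rw [dotProduct]
        apply (norm_sum_le _ _).trans
        apply Finset.sum_le_sum
        intro x _
        rw [Matrix.mulVec, dotProduct, Finset.mul_sum]
        apply (norm_sum_le _ _).trans
        apply Finset.sum_le_sum
        intro y _
        rw [norm_mul, norm_mul, Pi.star_apply, norm_star]
        gcongr
        exact h x y
      _ ≤ ∑ x, ∑ y, θ * ((‖v x‖ ^ 2 + ‖v y‖ ^ 2) / 2) := by
        apply Finset.sum_le_sum
        intro x _
        apply Finset.sum_le_sum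
        intro y _
        have hθ : 0 ≤ θ := (norm_nonneg _).trans (h x y)
        have := mul_le_mul_of_nonneg_left (sq_nonneg (‖v x‖ - ‖v y‖)) hθ
        nlinarith
      _ = _ := by
        simp only [← Finset.mul_sum, ← Finset.sum_div, Finset.sum_add_distrib, Finset.sum_const,
          Finset.card_univ, nsmul_eq_mul]
        ring
  rw [h1]
  linarith

lemma exists_net [Nonempty D] (η : ℝ) (hη : 0 < η) :
    ∃ 𝒩 : Finset (Matrix D D ℂ), (∀ τ ∈ 𝒩, IsDensity τ ∧
      (τ - ((η / (Fintype.card D * (1 + η)) : ℝ) : ℂ) • (1 : Matrix D D ℂ)).PosSemidef) ∧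
      ∀ σ : Matrix D D ℂ, IsDensity σ → ∃ τ ∈ 𝒩, (((1 + η : ℝ) : ℂ) • τ - σ).PosSemidef := by
  classical
  have hcard : (0 : ℝ) < Fintype.card D := by exact_mod_cast Fintype.card_pos
  set θ : ℝ := η / Fintype.card D with hθ
  have hθ0 : 0 < θ := by positivity
  set K : Set (D → D → ℂ) := {ρ | IsDensity (Matrix.of ρ)} with hKdef
  have hTB : TotallyBounded K := by
    apply TotallyBounded.subset (s₂ := Metric.closedBall 0 1)
    · intro ρ hρ
      rw [mem_closedBall_zero_iff]
      rw [pi_norm_le_iff_of_nonneg zero_le_one]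
      intro x
      rw [pi_norm_le_iff_of_nonneg zero_le_one]
      intro y
      exact dens_entry hρ x y
    · exact (isCompact_closedBall _ _).totallyBounded
  obtain ⟨t, htK, htf, hcov⟩ := Metric.finite_approx_of_totallyBounded hTB (θ / Fintype.card D) (by positivity)
  refine ⟨htf.toFinset.image (fun ρ : D → D → ℂ => (((1 + η)⁻¹ : ℝ) : ℂ) • ((Matrix.of ρ) + (θ : ℂ) • 1)), ?_, ?_⟩
  · intro τ hτ
    obtain ⟨ρ, hρ, rfl⟩ := Finset.mem_image.1 hτ
    have hρ' : IsDensity (Matrix.of ρ) := htK (htf.mem_toFinset.1 hρ)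
    refine ⟨⟨?_, ?_⟩, ?_⟩
    · apply psd_smul _ (by positivity)
      exact hρ'.1.add (psd_smul Matrix.PosSemidef.one hθ0.le)
    · rw [Matrix.trace_smul, Matrix.trace_add, hρ'.2, Matrix.trace_smul, Matrix.trace_one]
      simp only [smul_eq_mul, hθ]
      have : ((1 + η)⁻¹ * (1 + η / Fintype.card D * Fintype.card D) : ℝ) = 1 := by
        field_simp
      exact_mod_cast this
    · have : (((1 + η)⁻¹ : ℝ) : ℂ) • ((Matrix.of ρ) + (θ : ℂ) • 1) -
          ((η / (Fintype.card D * (1 + η)) : ℝ) : ℂ) • (1 : Matrix D D ℂ) =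
          (((1 + η)⁻¹ : ℝ) : ℂ) • (Matrix.of ρ) := by
        rw [smul_add, smul_smul, ← Complex.ofReal_mul]
        have : (1 + η)⁻¹ * θ = (η / (Fintype.card D * (1 + η))) := by rw [hθ]; field_simp
        rw [this]
        simp
      rw [this]
      exact psd_smul hρ'.1 (by positivity)
  · intro σ hσ
    have := hcov (show (σ : D → D → ℂ) ∈ K from hσ)
    obtain ⟨ρ, hρ, hb⟩ : ∃ ρ ∈ t, (show D → D → ℂ from σ) ∈ Metric.ball ρ (θ / Fintype.card D) := by
      simpa using Set.mem_iUnion₂.1 this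
    refine ⟨_, Finset.mem_image.2 ⟨ρ, htf.mem_toFinset.2 hρ, rfl⟩, ?_⟩
    have hρ' : IsDensity (Matrix.of ρ) := htK hρ
    have hd : ∀ x y, ‖(σ - Matrix.of ρ : Matrix D D ℂ) x y‖ ≤ θ / Fintype.card D := by
      intro x y
      have h1 := (Metric.mem_ball.1 hb).le
      have h2 := (dist_pi_le_iff (by positivity)).1 h1 x
      have h3 := (dist_pi_le_iff (by positivity)).1 h2 y
      rw [dist_eq_norm] at h3
      exact h3
    have := small_le (hσ.1.1.sub hρ'.1.1) hd
    have e : θ / Fintype.card D * Fintype.card D = θ := by field_simp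
    rw [e] at this
    convert this using 1
    rw [smul_smul, ← Complex.ofReal_mul, mul_inv_cancel₀ (by positivity)]
    simp only [Complex.ofReal_one, one_smul]
    abel

end Entropy

set_option linter.unusedSectionVars false
section Core

variable {J D : Type*} [Fintype J] [DecidableEq J] [Fintype D] [DecidableEq D]

lemma dens_sum {ι : Type*} [Fintype ι] {p : ι → ℝ} (hp : ∀ i, 0 ≤ p i) (hp1 : ∑ i, p i = 1)
    {ω : ι → Matrix D D ℂ} (hω : ∀ i, IsDensity (ω i)) : IsDensity (∑ i, ((p i : ℝ) : ℂ) • ω i) := by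
  refine ⟨Matrix.posSemidef_sum _ (fun i _ => psd_smul (hω i).1 (hp i)), ?_⟩
  rw [Matrix.trace_sum]
  simp only [Matrix.trace_smul, (hω _).2, smul_eq_mul, mul_one]
  exact_mod_cast hp1

lemma dens_conj {ω U : Matrix D D ℂ} (hω : IsDensity ω) (hU' : U * Uᴴ = 1) : IsDensity (Uᴴ * ω * U) := by
  refine ⟨hω.1.conjTranspose_mul_mul_same U, ?_⟩
  rw [Matrix.trace_mul_comm, ← mul_assoc, hU', one_mul, hω.2]

lemma psd_diag_re {ω : Matrix D D ℂ} (hω : ω.PosSemidef) (x : D) :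
    0 ≤ (ω x x).re ∧ ω x x = (((ω x x).re : ℝ) : ℂ) := by
  have h := Complex.le_def.1 (hω.diag_nonneg (i := x))
  refine ⟨h.1, ?_⟩
  apply Complex.ext
  · simp
  · simpa using h.2.symm

lemma dens_diag_sum {ω : Matrix D D ℂ} (hω : IsDensity ω) : ∑ x, (ω x x).re = 1 := by
  have := congrArg Complex.re hω.2
  rwa [Matrix.trace, Complex.re_sum] at this

/-- the correlated state -/
noncomputable def corrState (Γ : J → ℝ) (Q : J → J → ℝ) {k : ℕ} (ω : Fin k → J → Matrix D D ℂ) :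
    Matrix (Fin k → D) (Fin k → D) ℂ :=
  ∑ B : Fin k → J, ((markovWeight Γ Q B : ℝ) : ℂ) • bigT (fun j => ω j (B j))

/-- the mean state -/
noncomputable def meanState (Γ : J → ℝ) (ω : J → Matrix D D ℂ) : Matrix D D ℂ :=
  ∑ b, ((Γ b : ℝ) : ℂ) • ω b

lemma corr_psd {Γ : J → ℝ} {Q : J → J → ℝ} (hΓ0 : ∀ b, 0 ≤ Γ b) (hQ0 : ∀ b b', 0 ≤ Q b b') {k : ℕ}
    {ω : Fin k → J → Matrix D D ℂ} (hω : ∀ j b, IsDensity (ω j b)) : (corrState Γ Q ω).PosSemidef :=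
  Matrix.posSemidef_sum _ (fun B _ => psd_smul (bigT_psd (fun j => (hω j (B j)).1)) (mw_nonneg hΓ0 hQ0 B))

lemma corr_le {Γ : J → ℝ} {Q : J → J → ℝ} (hΓ0 : ∀ b, 0 ≤ Γ b) (hQ0 : ∀ b b', 0 ≤ Q b b')
    (hΓ1 : ∑ b, Γ b = 1)
    (hrow : ∀ b, ∑ b', Q b b' = 1) (hinv : ∀ b', ∑ b, Γ b * Q b b' = Γ b') (c : ℝ) (hc : 1 ≤ c)
    (hQc : ∀ a b, 0 < Γ a → Q a b ≤ c * Γ b) {k : ℕ}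
    {ω : Fin k → J → Matrix D D ℂ} (hω : ∀ j b, IsDensity (ω j b)) :
    (((c ^ k : ℝ) : ℂ) • bigT (fun j => meanState Γ (ω j)) - corrState Γ Q ω).PosSemidef := by
  have e : ((c ^ k : ℝ) : ℂ) • bigT (fun j => meanState Γ (ω j)) - corrState Γ Q ω =
      ∑ B : Fin k → J, ((c ^ k * ∏ j, Γ (B j) - markovWeight Γ Q B : ℝ) : ℂ) • bigT (fun j => ω j (B j)) := by
    simp only [meanState, corrState]
    rw [bigT_sum]
    simp only [bigT_smul]
    rw [Finset.smul_sum, ← Finset.sum_sub_distrib]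
    apply Finset.sum_congr rfl
    intro B _
    rw [smul_smul, ← sub_smul]
    push_cast
    rfl
  rw [e]
  apply Matrix.posSemidef_sum
  intro B _
  apply psd_smul (bigT_psd (fun j => (hω j (B j)).1))
  have := mw_le_prod Γ Q hΓ0 hQ0 hΓ1 hrow hinv c hc hQc k B
  linarith

lemma corr_diag {Γ : J → ℝ} {Q : J → J → ℝ} {k : ℕ}
    {ω : Fin k → J → Matrix D D ℂ} (hω : ∀ j b, IsDensity (ω j b)) (U : Fin k → Matrix D D ℂ) (x : Fin k → D) :
    (((bigT U)ᴴ * corrState Γ Q ω * bigT U) x x).re =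
      ∑ B : Fin k → J, markovWeight Γ Q B * ∏ j, (((U j)ᴴ * ω j (B j) * U j) (x j) (x j)).re := by
  rw [corrState, Finset.mul_sum, Finset.sum_mul, Matrix.sum_apply, Complex.re_sum]
  apply Finset.sum_congr rfl
  intro B _
  rw [Matrix.mul_smul, Matrix.smul_mul, bigT_conj, bigT_mul, bigT_mul, Matrix.smul_apply]
  have : bigT (fun j => (U j)ᴴ * ω j (B j) * U j) x x =
      ((∏ j, (((U j)ᴴ * ω j (B j) * U j) (x j) (x j)).re : ℝ) : ℂ) := by
    simp only [bigT, Matrix.of_apply]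
    rw [Complex.ofReal_prod]
    apply Finset.prod_congr rfl
    intro j _
    exact (psd_diag_re ((hω j (B j)).1.conjTranspose_mul_mul_same (U j)) (x j)).2
  rw [this, smul_eq_mul, ← Complex.ofReal_mul, Complex.ofReal_re]

lemma mean_diag {Γ : J → ℝ} {ω : J → Matrix D D ℂ} (U : Matrix D D ℂ) (x : D) :
    ((Uᴴ * meanState Γ ω * U) x x).re = ∑ b, Γ b * ((Uᴴ * ω b * U) x x).re := by
  rw [meanState, Finset.mul_sum, Finset.sum_mul, Matrix.sum_apply, Complex.re_sum]
  apply Finset.sum_congr rfl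
  intro b _
  rw [Matrix.mul_smul, Matrix.smul_mul, Matrix.smul_apply, smul_eq_mul, Complex.re_ofReal_mul]

lemma tail_bound {Γ : J → ℝ} {Q : J → J → ℝ} (hΓ0 : ∀ b, 0 ≤ Γ b) (hQ0 : ∀ b b', 0 ≤ Q b b')
    (hΓ1 : ∑ b, Γ b = 1)
    (hrow : ∀ b, ∑ b', Q b b' = 1) (hinv : ∀ b', ∑ b, Γ b * Q b b' = Γ b')
    (hconv : ∀ b b', Filter.Tendsto (fun m => (Matrix.of Q ^ m) b b') Filter.atTop (nhds (Γ b')))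
    (M α η : ℝ) (hM : 0 < M) (hα : 0 < α) (hη : 0 < η) :
    ∃ k0 : ℕ, ∀ k ≥ k0, ∀ (ω : Fin k → J → Matrix D D ℂ), (∀ j b, IsDensity (ω j b)) →
      ∀ (U : Fin k → Matrix D D ℂ), (∀ j, U j * (U j)ᴴ = 1) → ∀ F : Fin k → D → ℝ,
      (∀ j y, |F j y| ≤ M) →
      ∀ S : Finset (Fin k → D), (∀ x ∉ S, k * α ≤ |∑ j, F j (x j) -
          ∑ j, ∑ x, (((U j)ᴴ * meanState Γ (ω j) * U j) x x).re * F j x|) →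
        ∑ x ∈ Sᶜ, (((bigT U)ᴴ * corrState Γ Q ω * bigT U) x x).re ≤ η := by
  obtain ⟨k0, hk0⟩ := lln (D := D) (Γ := Γ) (Q := Q) hΓ0 hQ0 hΓ1 hrow hinv hconv M α η hM hα hη
  refine ⟨k0, fun k hk ω hω U hU F hF S hS => ?_⟩
  have := hk0 k hk (fun j b y => (((U j)ᴴ * ω j b * U j) y y).re) F
    (fun j => ∑ x, (((U j)ᴴ * meanState Γ (ω j) * U j) x x).re * F j x)
    (fun j b y => (psd_diag_re (dens_conj (hω j b) (hU j)).1 y).1)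
    (fun j b => dens_diag_sum (dens_conj (hω j b) (hU j))) hF
    (fun j => by
      simp only [mean_diag, Finset.sum_mul, Finset.mul_sum]
      rw [Finset.sum_comm]
      simp only [mul_assoc])
    S (fun x hx => by rw [Finset.sum_sub_distrib]; exact hS x hx)
  simp only [corr_diag hω]
  exact this

end Core

set_option linter.unusedSectionVars false
section Word

variable {J D : Type*} [Fintype J] [DecidableEq J] [Fintype D] [DecidableEq D]

lemma abs_logb_le {r u y : ℝ} (hr : 0 < r) (h1 : r ≤ y) (h2 : y ≤ u) :
    |(-Real.logb 2 y)| ≤ |Real.logb 2 r| + |Real.logb 2 u| := by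
  have a1 := Real.logb_le_logb_of_le (b := 2) (by norm_num) hr h1
  have a2 := Real.logb_le_logb_of_le (b := 2) (by norm_num) (hr.trans_le h1) h2
  have a3 := neg_abs_le (Real.logb 2 r)
  have a4 := le_abs_self (Real.logb 2 u)
  have a5 := abs_nonneg (Real.logb 2 r)
  have a6 := abs_nonneg (Real.logb 2 u)
  rw [abs_neg, abs_le]
  constructor <;> linarith

lemma sum_logb_prod {k : ℕ} (f : Fin k → ℝ) (hf : ∀ j, 0 < f j) :
    ∑ j, (-Real.logb 2 (f j)) = -Real.logb 2 (∏ j, f j) := by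
  rw [Finset.sum_neg_distrib, Real.logb_prod]
  intro j _
  exact (hf j).ne'

lemma diag_of_conj {U ρ : Matrix D D ℂ} (hU : Uᴴ * U = 1) {s : D → ℝ}
    (hρ : ρ = U * Matrix.diagonal (fun x => ((s x : ℝ) : ℂ)) * Uᴴ) (x : D) : ((Uᴴ * ρ * U) x x).re = s x := by
  have : Uᴴ * ρ * U = Matrix.diagonal (fun x => ((s x : ℝ) : ℂ)) := by
    rw [hρ]
    calc _ = (Uᴴ * U) * Matrix.diagonal (fun x => ((s x : ℝ) : ℂ)) * (Uᴴ * U) := by simp only [mul_assoc]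
      _ = _ := by rw [hU, one_mul, mul_one]
  rw [this, Matrix.diagonal_apply_eq, Complex.ofReal_re]

lemma eig_lower {τ V : Matrix D D ℂ} (hV : Vᴴ * V = 1) {t : D → ℝ}
    (hτ : τ = V * Matrix.diagonal (fun x => ((t x : ℝ) : ℂ)) * Vᴴ) {r : ℝ}
    (h : (τ - ((r : ℝ) : ℂ) • (1 : Matrix D D ℂ)).PosSemidef) (x : D) : r ≤ t x := by
  have h1 := (psd_diag_re (h.conjTranspose_mul_mul_same V) x).1
  have e : Vᴴ * (τ - ((r : ℝ) : ℂ) • (1 : Matrix D D ℂ)) * V = Vᴴ * τ * V - ((r : ℝ) : ℂ) • 1 := by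
    rw [mul_sub, sub_mul, Matrix.mul_smul, Matrix.smul_mul, mul_one, hV]
  rw [e, Matrix.sub_apply, Complex.sub_re, diag_of_conj hV hτ, Matrix.smul_apply, Matrix.one_apply_eq] at h1
  simp at h1
  exact h1

lemma bigT_conj_diag {k : ℕ} (U : Fin k → Matrix D D ℂ) (s : Fin k → D → ℝ) :
    bigT (fun j => U j * Matrix.diagonal (fun x => ((s j x : ℝ) : ℂ)) * (U j)ᴴ) =
      bigT U * Matrix.diagonal (fun x => ((∏ j, s j (x j) : ℝ) : ℂ)) * (bigT U)ᴴ := by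
  rw [bigT_conj]
  have := bigT_diag (fun j x => ((s j x : ℝ) : ℂ))
  simp only [Complex.ofReal_prod]
  rw [← this, bigT_mul, bigT_mul]

lemma bigT_unit {k : ℕ} (U : Fin k → Matrix D D ℂ) (hU : ∀ j, (U j)ᴴ * U j = 1) : (bigT U)ᴴ * bigT U = 1 := by
  rw [bigT_conj, bigT_mul]; simp only [hU, bigT_one]

lemma bigT_unit' {k : ℕ} (U : Fin k → Matrix D D ℂ) (hU : ∀ j, U j * (U j)ᴴ = 1) : bigT U * (bigT U)ᴴ = 1 := by
  rw [bigT_conj, bigT_mul]; simp only [hU, bigT_one]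

lemma word_bound {Γ : J → ℝ} {Q : J → J → ℝ} (hΓ0 : ∀ b, 0 ≤ Γ b) (hQ0 : ∀ b b', 0 ≤ Q b b')
    (hΓ1 : ∑ b, Γ b = 1)
    (hrow : ∀ b, ∑ b', Q b b' = 1) (hinv : ∀ b', ∑ b, Γ b * Q b b' = Γ b')
    (hconv : ∀ b b', Filter.Tendsto (fun m => (Matrix.of Q ^ m) b b') Filter.atTop (nhds (Γ b')))
    (c : ℝ) (hc : 1 ≤ c) (hQc : ∀ a b, 0 < Γ a → Q a b ≤ c * Γ b)
    (α β η r η' : ℝ) (hα : 0 < α) (hβ : 0 < β) (hη : 0 < η) (hr : 0 < r) (hη' : 0 < η') :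
    ∃ k0 : ℕ, ∀ k ≥ k0, ∀ (ω : Fin k → J → Matrix D D ℂ), (∀ j b, IsDensity (ω j b)) →
      ∀ σ τ : Matrix D D ℂ, IsDensity σ → IsDensity τ →
      (k : ℂ) • σ = ∑ j, meanState Γ (ω j) →
      (τ - ((r : ℝ) : ℂ) • (1 : Matrix D D ℂ)).PosSemidef →
      (((1 + η' : ℝ) : ℂ) • τ - σ).PosSemidef →
      ∀ h : ℝ, k * vnEntropy σ - ∑ j, vnEntropy (meanState Γ (ω j)) ≤ k * h →
      ∀ T : Matrix (Fin k → D) (Fin k → D) ℂ, T.PosSemidef → (1 - T).PosSemidef →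
      (Matrix.trace (corrState Γ Q ω * T)).re ≤
        4 * (c ^ k * (2 : ℝ) ^ (k * (h + (Real.logb 2 (1 + η') + Fintype.card D * (β / Real.log 2) + 2 * α)))) *
          (Matrix.trace (bigT (fun _ : Fin k => τ) * T)).re + 6 * η := by
  set M : ℝ := (|Real.logb 2 r| + |Real.logb 2 1|) + (|Real.logb 2 β| + |Real.logb 2 (1 + β)|) + 1 with hMdef
  have hM : 0 < M := by positivity
  obtain ⟨k0, hk0⟩ := tail_bound (D := D) hΓ0 hQ0 hΓ1 hrow hinv hconv M α η hM hα hη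
  refine ⟨k0, fun k hk ω hω σ τ hσ hτ hσsum hτr hτσ h hh T hT hT1 => ?_⟩
  have hmean : ∀ j, IsDensity (meanState Γ (ω j)) := fun j => dens_sum hΓ0 hΓ1 (hω j)
  choose U hU hU' hUs using fun j => spec_form (hmean j).1.1
  obtain ⟨V, hV, hV', hVt⟩ := spec_form hτ.1.1
  obtain ⟨W, hW, hW', hWs⟩ := spec_form hσ.1.1
  set s : Fin k → D → ℝ := fun j => (hmean j).1.1.eigenvalues with hs
  set t : D → ℝ := hτ.1.1.eigenvalues with ht
  have hs0 : ∀ j x, 0 ≤ s j x := fun j => (dens_eig (hmean j)).1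
  have hs1 : ∀ j x, s j x ≤ 1 := fun j => (dens_eig (hmean j)).2.2
  have ht1 : ∀ x, t x ≤ 1 := (dens_eig hτ).2.2
  have htr : ∀ x, r ≤ t x := eig_lower hV hVt hτr
  have ht0 : ∀ x, 0 < t x := fun x => hr.trans_le (htr x)
  set μ : ℝ := ∑ j, ∑ x, s j x * (-Real.logb 2 (s j x + β)) with hμ
  set C : ℝ := ∑ j : Fin k, ∑ x, ((Vᴴ * meanState Γ (ω j) * V) x x).re * (-Real.logb 2 (t x)) with hC
  have hμle : ∑ j, vnEntropy (meanState Γ (ω j)) - k * (Fintype.card D * (β / Real.log 2)) ≤ μ := by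
    have := Finset.sum_le_sum (fun j (_ : j ∈ Finset.univ) => reg_entropy (hs0 j) hβ)
    rw [Finset.sum_sub_distrib] at this
    simp only [Finset.sum_const, Finset.card_univ, Fintype.card_fin, nsmul_eq_mul] at this
    simp only [vn_eq (hmean _).1.1]
    exact this
  have hCle : C ≤ k * (vnEntropy σ + Real.logb 2 (1 + η')) := by
    have e : C = k * ∑ x, ((Vᴴ * σ * V) x x).re * (-Real.logb 2 (t x)) := by
      rw [hC, Finset.sum_comm, Finset.mul_sum]
      apply Finset.sum_congr rfl
      intro x _
      rw [← Finset.sum_mul, ← mul_assoc]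
      congr 1
      have : Vᴴ * ((k : ℂ) • σ) * V = ∑ j, Vᴴ * meanState Γ (ω j) * V := by
        rw [hσsum, Finset.mul_sum, Finset.sum_mul]
      rw [Matrix.mul_smul, Matrix.smul_mul] at this
      have := congrArg Complex.re (congrFun (congrFun this x) x)
      rw [Matrix.sum_apply, Complex.re_sum, Matrix.smul_apply, smul_eq_mul] at this
      rw [← this]
      simp
    rw [e]
    apply mul_le_mul_of_nonneg_left _ (Nat.cast_nonneg k)
    rw [vn_eq hσ.1.1]
    refine cross_entropy hV hV' hW (dens_eig hσ).1 (dens_eig hσ).2.1 ht0 (by linarith) hWs ?_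
    rw [← hVt]
    exact hτσ
  classical
  set S1 : Finset (Fin k → D) := Finset.univ.filter
    (fun x => ∏ j, s j (x j) ≤ (2 : ℝ) ^ (-μ + k * α)) with hS1
  set S2 : Finset (Fin k → D) := Finset.univ.filter
    (fun x => (2 : ℝ) ^ (-(C + k * α)) ≤ ∏ j, t (x j)) with hS2
  have h1 : ∑ x ∈ S1ᶜ, (((bigT U)ᴴ * corrState Γ Q ω * bigT U) x x).re ≤ η := by
    refine hk0 k hk ω hω U hU' (fun j x => -Real.logb 2 (s j x + β)) ?_ S1 ?_
    · intro j y
      have := abs_logb_le (y := s j y + β) (u := 1 + β) hβ (by linarith [hs0 j y]) (by linarith [hs1 j y])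
      have h2 := abs_nonneg (Real.logb 2 r)
      have h3 := abs_nonneg (Real.logb 2 1)
      rw [hMdef]
      linarith
    · intro x hx
      simp only [hS1, Finset.mem_filter, Finset.mem_univ, true_and, not_le] at hx
      rw [sum_logb_prod _ (fun j => by linarith [hs0 j (x j)])]
      have e : ∑ j, ∑ x, (((U j)ᴴ * meanState Γ (ω j) * U j) x x).re * (-Real.logb 2 (s j x + β)) = μ := by
        simp only [diag_of_conj (hU _) (hUs _)]
        rfl
      rw [e]
      have hp : (2 : ℝ) ^ (-μ + k * α) < ∏ j, (s j (x j) + β) :=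
        hx.trans_le (Finset.prod_le_prod (fun j _ => hs0 j _) (fun j _ => by linarith))
      have := Real.logb_lt_logb (b := 2) (by norm_num) (by positivity) hp
      rw [Real.logb_rpow (by norm_num) (by norm_num)] at this
      rw [le_abs]
      right
      linarith
  have h2 : ∑ x ∈ S2ᶜ, (((bigT (fun _ : Fin k => V))ᴴ * corrState Γ Q ω * bigT (fun _ : Fin k => V)) x x).re ≤ η := by
    refine hk0 k hk ω hω (fun _ => V) (fun _ => hV') (fun j x => -Real.logb 2 (t x)) ?_ S2 ?_
    · intro j y
      have := abs_logb_le (y := t y) (u := 1) hr (htr y) (ht1 y)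
      have h2 := abs_nonneg (Real.logb 2 β)
      have h3 := abs_nonneg (Real.logb 2 (1 + β))
      rw [hMdef]
      linarith
    · intro x hx
      simp only [hS2, Finset.mem_filter, Finset.mem_univ, true_and, not_le] at hx
      rw [sum_logb_prod _ (fun j => ht0 (x j))]
      have := Real.logb_lt_logb (b := 2) (by norm_num) (Finset.prod_pos (fun j _ => ht0 (x j))) hx
      rw [Real.logb_rpow (by norm_num) (by norm_num)] at this
      rw [le_abs]
      left
      change _ ≤ _ - C
      linarith
  have hck : 0 < c ^ k := by positivity
  have key := one_shot (corr_psd hΓ0 hQ0 hω) hT hT1 (bigT_unit U hU) (bigT_unit' U hU')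
    (bigT_unit (fun _ => V) (fun _ => hV)) (bigT_unit' (fun _ => V) (fun _ => hV')) S1 S2 η h1 h2
    (fun x => c ^ k * ∏ j, s j (x j)) (fun x => ∏ j, t (x j))
    (fun x => Finset.prod_nonneg (fun j _ => (ht0 _).le))
    (c ^ k * (2 : ℝ) ^ (-μ + k * α)) ((2 : ℝ) ^ (C + k * α)) (by positivity) (by positivity)
    (by
      have := corr_le hΓ0 hQ0 hΓ1 hrow hinv c hc hQc hω
      convert this using 2
      have e := bigT_conj_diag U s
      have e2 : bigT (fun j => meanState Γ (ω j)) =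
          bigT (fun j => U j * Matrix.diagonal (fun x => ((s j x : ℝ) : ℂ)) * (U j)ᴴ) := by
        congr 1
        ext1 j
        exact hUs j
      rw [e2, e, diagconj_smul]
      simp only [Complex.ofReal_mul])
    (by
      intro x hx
      simp only [hS1, Finset.mem_filter, Finset.mem_univ, true_and] at hx
      exact mul_le_mul_of_nonneg_left hx hck.le)
    (by
      intro x hx
      simp only [hS2, Finset.mem_filter, Finset.mem_univ, true_and] at hx
      have := mul_le_mul_of_nonneg_left hx (show 0 ≤ (2 : ℝ) ^ (C + k * α) by positivity)
      rw [← Real.rpow_add (by norm_num)] at this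
      simpa using this)
  have e3 : bigT (fun _ : Fin k => V) * Matrix.diagonal (fun x => ((∏ j, t (x j) : ℝ) : ℂ)) *
      (bigT (fun _ : Fin k => V))ᴴ = bigT (fun _ : Fin k => τ) := by
    rw [← bigT_conj_diag (fun _ : Fin k => V) (fun _ => t), ← hVt]
  rw [e3] at key
  refine key.trans ?_
  apply add_le_add_left
  apply mul_le_mul_of_nonneg_right
  · apply mul_le_mul_of_nonneg_left _ (by norm_num)
    rw [mul_assoc, ← Real.rpow_add (by norm_num)]
    apply mul_le_mul_of_nonneg_left _ hck.le
    apply Real.rpow_le_rpow_of_exponent_le (by norm_num)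
    linarith
  · exact tr_nonneg (bigT_psd (fun _ => hτ.1)) hT

end Word

set_option linter.unusedSectionVars false
section CoreBound

variable {J D : Type*} [Fintype J] [DecidableEq J] [Fintype D] [DecidableEq D]

lemma one_sub_le {X ι : Type*} [Fintype X] [DecidableEq X] [Fintype ι] {T : ι → Matrix X X ℂ}
    (hT : ∀ w, (T w).PosSemidef) (hT1 : (1 - ∑ w, T w).PosSemidef) (w : ι) : (1 - T w).PosSemidef := by
  classical
  have : 1 - T w = (1 - ∑ w, T w) + ∑ v ∈ Finset.univ.erase w, T v := by
    rw [← Finset.add_sum_erase Finset.univ T (Finset.mem_univ w)]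
    abel
  rw [this]
  exact hT1.add (Matrix.posSemidef_sum _ (fun v _ => hT v))

lemma core_bound [Nonempty D] {Γ : J → ℝ} {Q : J → J → ℝ} (hΓ0 : ∀ b, 0 ≤ Γ b) (hQ0 : ∀ b b', 0 ≤ Q b b')
    (hΓ1 : ∑ b, Γ b = 1)
    (hrow : ∀ b, ∑ b', Q b b' = 1) (hinv : ∀ b', ∑ b, Γ b * Q b b' = Γ b')
    (hconv : ∀ b b', Filter.Tendsto (fun m => (Matrix.of Q ^ m) b b') Filter.atTop (nhds (Γ b')))
    (c : ℝ) (hc : 1 ≤ c) (hQc : ∀ a b, 0 < Γ a → Q a b ≤ c * Γ b)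
    (δ ε : ℝ) (hδ : 0 < δ) (hε : 0 < ε) :
    ∃ C0 : ℝ, 0 < C0 ∧ ∃ k0 : ℕ, ∀ k ≥ k0, 0 < k → ∀ (h : ℝ) (N : ℕ) (ω : Fin N → Fin k → J → Matrix D D ℂ),
      (∀ w j b, IsDensity (ω w j b)) →
      (∀ w, k * vnEntropy (((1 / k : ℝ) : ℂ) • ∑ j, meanState Γ (ω w j)) -
        ∑ j, vnEntropy (meanState Γ (ω w j)) ≤ k * h) →
      ∀ T : Fin N → Matrix (Fin k → D) (Fin k → D) ℂ, (∀ w, (T w).PosSemidef) → (1 - ∑ w, T w).PosSemidef →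
      (∀ w, δ ≤ (Matrix.trace (corrState Γ Q (ω w) * T w)).re) →
      (N : ℝ) ≤ C0 * c ^ k * (2 : ℝ) ^ (k * (h + ε)) := by
  have hl : 0 < Real.log 2 := Real.log_pos (by norm_num)
  set η' : ℝ := ε * Real.log 2 / 3 with hη'
  have hη'0 : 0 < η' := by positivity
  set β : ℝ := ε * Real.log 2 / (3 * (Fintype.card D + 1)) with hβ
  have hβ0 : 0 < β := by positivity
  have hE : Real.logb 2 (1 + η') + Fintype.card D * (β / Real.log 2) + 2 * (ε / 6) ≤ ε := by
    have h1 : Real.logb 2 (1 + η') ≤ ε / 3 := by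
      rw [Real.logb, div_le_iff₀ hl]
      have := Real.log_le_sub_one_of_pos (show 0 < 1 + η' by linarith)
      rw [hη'] at this ⊢
      linarith
    have h2 : Fintype.card D * (β / Real.log 2) ≤ ε / 3 := by
      rw [hβ]
      have : (Fintype.card D : ℝ) * (ε * Real.log 2 / (3 * (Fintype.card D + 1)) / Real.log 2) =
        ε / 3 * (Fintype.card D / (Fintype.card D + 1)) := by field_simp
      rw [this]
      have h3 : (Fintype.card D : ℝ) / (Fintype.card D + 1) ≤ 1 := by
        rw [div_le_one (by positivity)]; linarith
      have := mul_le_mul_of_nonneg_left h3 (show 0 ≤ ε / 3 by positivity)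
      linarith
    linarith
  obtain ⟨𝒩, hN1, hN2⟩ := exists_net (D := D) η' hη'0
  have hcard : (0 : ℝ) < Fintype.card D := by exact_mod_cast Fintype.card_pos
  obtain ⟨k0, hk0⟩ := word_bound (D := D) hΓ0 hQ0 hΓ1 hrow hinv hconv c hc hQc (ε / 6) β (δ / 12)
    (η' / (Fintype.card D * (1 + η'))) η' (by positivity) hβ0 (by positivity) (by positivity) hη'0
  refine ⟨8 * (𝒩.card + 1) / δ, by positivity, k0, fun k hk hkpos h N ω hω hh T hT hT1 hcode => ?_⟩
  have hkR : (0 : ℝ) < k := by exact_mod_cast hkpos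
  have hmean : ∀ w j, IsDensity (meanState Γ (ω w j)) := fun w j => dens_sum hΓ0 hΓ1 (hω w j)
  set σ : Fin N → Matrix D D ℂ := fun w => ((1 / k : ℝ) : ℂ) • ∑ j, meanState Γ (ω w j) with hσdef
  have hσ : ∀ w, IsDensity (σ w) := by
    intro w
    have := dens_sum (p := fun _ : Fin k => (1 / k : ℝ)) (fun _ => by positivity)
      (by simp; field_simp) (hmean w)
    rw [← Finset.smul_sum] at this
    exact this
  have hσsum : ∀ w, (k : ℂ) • σ w = ∑ j, meanState Γ (ω w j) := by
    intro w
    simp only [hσdef]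
    rw [smul_smul]
    have : (k : ℂ) * ((1 / k : ℝ) : ℂ) = 1 := by
      have : (k : ℂ) ≠ 0 := by exact_mod_cast hkpos.ne'
      push_cast
      field_simp
    rw [this, one_smul]
  choose τ hτ hτσ using fun w => hN2 (σ w) (hσ w)
  set X : ℝ := c ^ k * (2 : ℝ) ^ (k * (h + ε)) with hX
  have hX0 : 0 < X := by positivity
  have hw : ∀ w, δ / 2 ≤ 4 * X * (Matrix.trace (bigT (fun _ : Fin k => τ w) * T w)).re := by
    intro w
    have := hk0 k hk (ω w) (hω w) (σ w) (τ w) (hσ w) (hN1 _ (hτ w)).1 (hσsum w) (hN1 _ (hτ w)).2 (hτσ w)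
      h (hh w) (T w) (hT w) (one_sub_le hT hT1 w)
    have hmon : 4 * (c ^ k * (2 : ℝ) ^ (k * (h + (Real.logb 2 (1 + η') + Fintype.card D * (β / Real.log 2) + 2 * (ε / 6))))) *
          (Matrix.trace (bigT (fun _ : Fin k => τ w) * T w)).re ≤
          4 * X * (Matrix.trace (bigT (fun _ : Fin k => τ w) * T w)).re := by
      apply mul_le_mul_of_nonneg_right _ (tr_nonneg (bigT_psd (fun _ => (hN1 _ (hτ w)).1.1)) (hT w))
      apply mul_le_mul_of_nonneg_left _ (by norm_num)
      rw [hX]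
      apply mul_le_mul_of_nonneg_left _ (by positivity)
      apply Real.rpow_le_rpow_of_exponent_le (by norm_num)
      apply mul_le_mul_of_nonneg_left _ hkR.le
      linarith
    have := hcode w
    linarith
  have hsum : ∑ w, (Matrix.trace (bigT (fun _ : Fin k => τ w) * T w)).re ≤ 𝒩.card := by
    calc _ ≤ ∑ w, ∑ ν ∈ 𝒩, (Matrix.trace (bigT (fun _ : Fin k => ν) * T w)).re := by
          apply Finset.sum_le_sum
          intro w _
          exact Finset.single_le_sum (f := fun ν => (Matrix.trace (bigT (fun _ : Fin k => ν) * T w)).re)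
            (fun ν hν => tr_nonneg (bigT_psd (fun _ => (hN1 _ hν).1.1)) (hT w)) (hτ w)
      _ = ∑ ν ∈ 𝒩, ∑ w, (Matrix.trace (bigT (fun _ : Fin k => ν) * T w)).re := Finset.sum_comm
      _ ≤ ∑ ν ∈ 𝒩, 1 := by
          apply Finset.sum_le_sum
          intro ν hν
          rw [← Complex.re_sum, ← Matrix.trace_sum, ← Finset.mul_sum]
          refine (tr_mono (bigT_psd (fun _ => (hN1 _ hν).1.1)) hT1).trans ?_
          rw [mul_one, bigT_trace, (hN1 _ hν).1.2]
          simp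
      _ = 𝒩.card := by simp
  have h3 := Finset.sum_le_sum (fun w (_ : w ∈ Finset.univ) => hw w)
  rw [← Finset.mul_sum] at h3
  simp only [Finset.sum_const, Finset.card_univ, Fintype.card_fin, nsmul_eq_mul] at h3
  have h4 : (N : ℝ) * (δ / 2) ≤ 4 * X * (𝒩.card + 1) :=
    h3.trans (mul_le_mul_of_nonneg_left (by linarith) (by positivity))
  have h5 : 8 * (𝒩.card + 1) / δ * c ^ k * (2 : ℝ) ^ (k * (h + ε)) = 4 * X * (𝒩.card + 1) / (δ / 2) := by
    rw [hX]
    field_simp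
    ring
  rw [h5, le_div_iff₀ (by positivity)]
  exact h4

end CoreBound

set_option linter.unusedSectionVars false
section Block

variable {I : Type} [Fintype I] [DecidableEq I]

lemma mw_factor (γ : I → ℝ) (q : I → I → ℝ) {l : ℕ} (B : Fin (l+1) → I) :
    markovWeight γ q B = γ (B 0) * markovWeight (fun _ => 1) q B := by
  unfold markovWeight
  rw [Fin.prod_univ_succ, Fin.prod_univ_succ]
  simp

/-- transition matrix of the block chain -/
noncomputable def blockQ (q : I → I → ℝ) (l : ℕ) (B B' : Fin (l+1) → I) : ℝ :=
  markovWeight (fun b => q (B (Fin.last l)) b) q B'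

lemma blockQ_row (q : I → I → ℝ) (hrow : ∀ i, ∑ i', q i i' = 1) (l : ℕ) (B : Fin (l+1) → I) :
    ∑ B', blockQ q l B B' = 1 := mw_sum _ q (hrow _) hrow _

lemma blockQ_inv (γ : I → ℝ) (q : I → I → ℝ) (hinv : ∀ i', ∑ i, γ i * q i i' = γ i') (l : ℕ)
    (B' : Fin (l+1) → I) : ∑ B : Fin (l+1) → I, markovWeight γ q B * blockQ q l B B' = markovWeight γ q B' := by
  rw [mw_factor γ q B']
  simp only [blockQ]
  simp only [fun B : Fin (l+1) → I => mw_factor (fun b => q (B (Fin.last l)) b) q B']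
  simp only [← mul_assoc]
  rw [← Finset.sum_mul]
  congr 1
  have := mw_last γ q l (fun u => q u (B' 0))
  rw [this, inv_pow_sum γ q hinv]
  exact hinv _

lemma blockQ_le (γ : I → ℝ) (q : I → I → ℝ) (hγ0 : ∀ i, 0 ≤ γ i) (hq0 : ∀ i j, 0 ≤ q i j)
    (hγ1 : ∑ i, γ i = 1) (hrow : ∀ i, ∑ i', q i i' = 1)
    (hinv : ∀ i', ∑ i, γ i * q i i' = γ i') (c : ℝ)
    (hqc : ∀ a b, 0 < γ a → q a b ≤ c * γ b) (l : ℕ) (B B' : Fin (l+1) → I) (hB : 0 < markovWeight γ q B) :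
    blockQ q l B B' ≤ c * markovWeight γ q B' := by
  have h1 := mw_le_point γ q hγ0 hq0 hγ1 hrow hinv _ (Fin.last l) B
  rw [blockQ, mw_factor, mw_factor γ q B', ← mul_assoc]
  apply mul_le_mul_of_nonneg_right _ (mw_nonneg (fun _ => zero_le_one) hq0 _)
  exact hqc _ _ (hB.trans_le h1)

lemma exists_c (γ : I → ℝ) (q : I → I → ℝ) (hγ0 : ∀ i, 0 ≤ γ i) (hq0 : ∀ i j, 0 ≤ q i j)
    (hinv : ∀ i', ∑ i, γ i * q i i' = γ i') : ∃ c : ℝ, 1 ≤ c ∧ ∀ a b, 0 < γ a → q a b ≤ c * γ b := by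
  have hs : 0 ≤ ∑ a, (γ a)⁻¹ := Finset.sum_nonneg (fun a _ => inv_nonneg.2 (hγ0 a))
  refine ⟨1 + ∑ a, (γ a)⁻¹, by linarith, fun a b ha => ?_⟩
  have h1 : γ a * q a b ≤ γ b := by
    rw [← hinv b]
    exact Finset.single_le_sum (f := fun i => γ i * q i b) (fun i _ => mul_nonneg (hγ0 i) (hq0 i b)) (Finset.mem_univ a)
  have h2 : (γ a)⁻¹ ≤ ∑ a, (γ a)⁻¹ :=
    Finset.single_le_sum (f := fun a => (γ a)⁻¹) (fun a _ => inv_nonneg.2 (hγ0 a)) (Finset.mem_univ a)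
  calc q a b = (γ a)⁻¹ * (γ a * q a b) := by field_simp
    _ ≤ (γ a)⁻¹ * γ b := mul_le_mul_of_nonneg_left h1 (inv_nonneg.2 ha.le)
    _ ≤ _ := mul_le_mul_of_nonneg_right (by linarith) (hγ0 b)

lemma blockQ_pow (q : I → I → ℝ) (l m : ℕ) (B B' : Fin (l+1) → I) :
    (Matrix.of (blockQ q l) ^ (m+1)) B B' =
      (Matrix.of q ^ (m * (l+1) + 1)) (B (Fin.last l)) (B' 0) * markovWeight (fun _ => 1) q B' := by
  induction m generalizing B with
  | zero =>
    simp only [zero_add, pow_one, zero_mul, Matrix.of_apply]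
    exact mw_factor _ _ _
  | succ m ih =>
    rw [pow_succ', Matrix.mul_apply]
    simp only [ih, Matrix.of_apply, ← mul_assoc]
    rw [← Finset.sum_mul]
    congr 1
    have := mw_last (fun b => q (B (Fin.last l)) b) q l (fun u => (Matrix.of q ^ (m * (l+1) + 1)) u (B' 0))
    simp only [blockQ]
    rw [this]
    have e : (m + 1) * (l+1) + 1 = 1 + (l + (m * (l+1) + 1)) := by ring
    have e2 : Matrix.of q ^ ((m + 1) * (l+1) + 1) = Matrix.of q * (Matrix.of q ^ l * Matrix.of q ^ (m * (l+1) + 1)) := by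
      rw [e, pow_add, pow_one, pow_add _ l]
    rw [e2, Matrix.mul_apply]
    apply Finset.sum_congr rfl
    intro u _
    rw [Matrix.mul_apply]
    rfl

lemma blockQ_conv (γ : I → ℝ) (q : I → I → ℝ)
    (herg : ∀ i j, Filter.Tendsto (fun n => (Matrix.of q ^ n) i j) Filter.atTop (nhds (γ j))) (l : ℕ)
    (B B' : Fin (l+1) → I) :
    Filter.Tendsto (fun m => (Matrix.of (blockQ q l) ^ m) B B') Filter.atTop (nhds (markovWeight γ q B')) := by
  rw [← Filter.tendsto_add_atTop_iff_nat 1]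
  simp only [blockQ_pow]
  rw [mw_factor γ q B']
  apply Filter.Tendsto.mul_const
  apply (herg (B (Fin.last l)) (B' 0)).comp
  apply Filter.tendsto_atTop_mono (f := fun m => m) _ Filter.tendsto_id
  intro m
  nlinarith [Nat.zero_le (m * l)]

lemma mw_block (γ : I → ℝ) (q : I → I → ℝ) (k l : ℕ) (i : Fin (k * (l+1)) → I) :
    markovWeight γ q i = markovWeight (fun B : Fin (l+1) → I => markovWeight γ q B) (blockQ q l)
      (fun (j : Fin k) (x : Fin (l+1)) => i (finProdFinEquiv (j, x))) := by
  conv_lhs => rw [markovWeight]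
  rw [← finProdFinEquiv.prod_comp, Fintype.prod_prod_type]
  conv_rhs => rw [markovWeight]
  apply Finset.prod_congr rfl
  intro j _
  by_cases hj : (j : ℕ) = 0
  · rw [if_pos hj, markovWeight]
    apply Finset.prod_congr rfl
    intro x _
    have hv : ((finProdFinEquiv (j, x) : Fin (k * (l+1))) : ℕ) = x := by
      rw [finProdFinEquiv_apply_val, hj]; simp
    by_cases hx : (x : ℕ) = 0
    · rw [if_pos hx, if_pos (by rw [hv, hx])]
    · rw [if_neg hx, if_neg (by rw [hv]; exact hx)]
      congr 2
      ext
      simp only [finProdFinEquiv_apply_val, hj]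
      simp
  · rw [if_neg hj, blockQ, markovWeight]
    apply Finset.prod_congr rfl
    intro x _
    have hj1 : (j : ℕ) = ((j : ℕ) - 1) + 1 := by omega
    have hv : ((finProdFinEquiv (j, x) : Fin (k * (l+1))) : ℕ) = x + (l+1) * ((j : ℕ) - 1) + (l + 1) := by
      rw [finProdFinEquiv_apply_val]
      conv_lhs => rw [show ((j, x).1 : ℕ) = ((j : ℕ) - 1) + 1 from hj1]
      ring
    rw [if_neg (by rw [hv]; omega)]
    by_cases hx : (x : ℕ) = 0
    · rw [if_pos hx]
      congr 2
      ext
      simp only [hv, finProdFinEquiv_apply_val, Fin.val_last, hx]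
      omega
    · rw [if_neg hx]
      congr 2
      ext
      simp only [hv]
      conv_rhs => rw [finProdFinEquiv_apply_val]
      have hv2 := hv
      rw [finProdFinEquiv_apply_val] at hv2
      simp only at hv2 ⊢
      omega

/-- splitting into blocks -/
def blockEquiv (k L : ℕ) (X : Type*) : (Fin k → Fin L → X) ≃ (Fin (k * L) → X) where
  toFun y := fun z => y (finProdFinEquiv.symm z).1 (finProdFinEquiv.symm z).2
  invFun x := fun j l => x (finProdFinEquiv (j, l))
  left_inv y := by
    funext j l
    change y (finProdFinEquiv.symm (finProdFinEquiv (j, l))).1 (finProdFinEquiv.symm (finProdFinEquiv (j, l))).2 = _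
    rw [Equiv.symm_apply_apply]
  right_inv x := by
    funext z
    change x (finProdFinEquiv (finProdFinEquiv.symm z)) = _
    rw [Equiv.apply_symm_apply]

lemma blockEquiv_apply (k L : ℕ) (X : Type*) (y : Fin k → Fin L → X) (j : Fin k) (x : Fin L) :
    blockEquiv k L X y (finProdFinEquiv (j, x)) = y j x := by
  change y (finProdFinEquiv.symm (finProdFinEquiv (j, x))).1 (finProdFinEquiv.symm (finProdFinEquiv (j, x))).2 = _
  rw [Equiv.symm_apply_apply]

lemma channel_block {dH dK S : ℕ} (γ : I → ℝ) (q : I → I → ℝ) (A : I → Fin S → Matrix (Fin dK) (Fin dH) ℂ)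
    (k l : ℕ) (ρ : Fin (k * (l+1)) → Matrix (Fin dH) (Fin dH) ℂ) :
    (channelOut γ q A ρ).submatrix (blockEquiv k (l+1) (Fin dK)) (blockEquiv k (l+1) (Fin dK)) =
      corrState (fun B : Fin (l+1) → I => markovWeight γ q B) (blockQ q l)
        (fun j B => matTensor (fun x => krausChannel (A (B x)) (ρ (finProdFinEquiv (j, x))))) := by
  ext x y
  rw [Matrix.submatrix_apply, channelOut, corrState, Matrix.sum_apply, Matrix.sum_apply,
    ← (blockEquiv k (l+1) I).sum_comp]
  apply Finset.sum_congr rfl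
  intro B _
  rw [Matrix.smul_apply, Matrix.smul_apply, mw_block]
  simp only [blockEquiv_apply]
  congr 1
  simp only [matTensor, bigT, Matrix.of_apply]
  rw [← finProdFinEquiv.prod_comp, Fintype.prod_prod_type]
  simp only [blockEquiv_apply]

lemma mean_channel {dH dK S : ℕ} (γ : I → ℝ) (q : I → I → ℝ) (A : I → Fin S → Matrix (Fin dK) (Fin dH) ℂ)
    (l : ℕ) (ρ : Fin (l+1) → Matrix (Fin dH) (Fin dH) ℂ) :
    meanState (fun B : Fin (l+1) → I => markovWeight γ q B)
      (fun B => matTensor (fun x => krausChannel (A (B x)) (ρ x))) = channelOut γ q A ρ := rfl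

lemma kraus_dens {dH dK S : ℕ} {A : Fin S → Matrix (Fin dK) (Fin dH) ℂ} (hA : ∑ s, (A s)ᴴ * A s = 1)
    {ρ : Matrix (Fin dH) (Fin dH) ℂ} (hρ : IsDensity ρ) : IsDensity (krausChannel A ρ) := by
  refine ⟨Matrix.posSemidef_sum _ (fun s _ => hρ.1.mul_mul_conjTranspose_same (A s)), ?_⟩
  rw [krausChannel, Matrix.trace_sum]
  have : ∀ s, (A s * ρ * (A s)ᴴ).trace = ((A s)ᴴ * A s * ρ).trace := by
    intro s
    rw [Matrix.trace_mul_comm, Matrix.mul_assoc]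
  simp only [this]
  rw [← Matrix.trace_sum, ← Finset.sum_mul, hA, one_mul, hρ.2]

lemma tensor_dens {m d : ℕ} {ρ : Fin m → Matrix (Fin d) (Fin d) ℂ} (hρ : ∀ j, IsDensity (ρ j)) :
    IsDensity (matTensor ρ) := by
  refine ⟨bigT_psd (fun j => (hρ j).1), ?_⟩
  have := bigT_trace ρ
  simp only [(hρ _).2, Finset.prod_const_one] at this
  exact this

lemma channel_dens {dH dK S : ℕ} {γ : I → ℝ} {q : I → I → ℝ} (hγ0 : ∀ i, 0 ≤ γ i) (hq0 : ∀ i j, 0 ≤ q i j)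
    (hγ1 : ∑ i, γ i = 1) (hrow : ∀ i, ∑ i', q i i' = 1) {A : I → Fin S → Matrix (Fin dK) (Fin dH) ℂ}
    (hA : ∀ i, ∑ s, (A i s)ᴴ * A i s = 1) {n : ℕ}
    {ρ : Fin n → Matrix (Fin dH) (Fin dH) ℂ} (hρ : ∀ j, IsDensity (ρ j)) : IsDensity (channelOut γ q A ρ) :=
  dens_sum (fun i => mw_nonneg hγ0 hq0 i) (mw_sum γ q hγ1 hrow n)
    (fun i => tensor_dens (fun j => kraus_dens (hA (i j)) (hρ j)))

lemma holevo_bdd {dH dK S : ℕ} {γ : I → ℝ} {q : I → I → ℝ} (hγ0 : ∀ i, 0 ≤ γ i) (hq0 : ∀ i j, 0 ≤ q i j)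
    (hγ1 : ∑ i, γ i = 1) (hrow : ∀ i, ∑ i', q i i' = 1) {A : I → Fin S → Matrix (Fin dK) (Fin dH) ℂ}
    (hA : ∀ i, ∑ s, (A i s)ᴴ * A i s = 1) (n : ℕ) : BddAbove (prodHolevoSet γ q A n) := by
  refine ⟨Fintype.card (Fin n → Fin dK) * (1 / Real.log 2), ?_⟩
  rintro x ⟨J, p, ρ, hp, hp1, hρ, rfl⟩
  have hd := fun j => channel_dens hγ0 hq0 hγ1 hrow hA (hρ j)
  have h1 := vn_le (dens_sum hp hp1 hd)
  have h2 : 0 ≤ ∑ j, p j * vnEntropy (channelOut γ q A (ρ j)) :=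
    Finset.sum_nonneg (fun j _ => mul_nonneg (hp j) (vn_nonneg (hd j)))
  linarith

lemma holevo_nonneg {dH dK S : ℕ} {γ : I → ℝ} {q : I → I → ℝ} (hγ0 : ∀ i, 0 ≤ γ i) (hq0 : ∀ i j, 0 ≤ q i j)
    (hγ1 : ∑ i, γ i = 1) (hrow : ∀ i, ∑ i', q i i' = 1) {A : I → Fin S → Matrix (Fin dK) (Fin dH) ℂ}
    (hA : ∀ i, ∑ s, (A i s)ᴴ * A i s = 1) (n : ℕ) : 0 ≤ sSup (prodHolevoSet γ q A n) := by
  rcases Set.eq_empty_or_nonempty (prodHolevoSet γ q A n) with h | ⟨x, J, p, ρ, hp, hp1, hρ, rfl⟩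
  · rw [h, Real.sSup_empty]
  · have hJ : 0 < J := by
      rcases Nat.eq_zero_or_pos J with h | h
      · subst h
        simp at hp1
      · exact h
    apply le_csSup (holevo_bdd hγ0 hq0 hγ1 hrow hA n)
    refine ⟨1, fun _ => 1, fun _ => ρ ⟨0, hJ⟩, fun _ => zero_le_one, by simp, fun _ => hρ _, by simp⟩

end Block

set_option linter.unusedSectionVars false
section Pad

variable {I : Type} [Fintype I] [DecidableEq I]

lemma partial_trace {dH dK S : ℕ} {γ : I → ℝ} {q : I → I → ℝ}
    (hγ1 : ∑ i, γ i = 1) (hrow : ∀ i, ∑ i', q i i' = 1) {A : I → Fin S → Matrix (Fin dK) (Fin dH) ℂ}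
    (hA : ∀ i, ∑ s, (A i s)ᴴ * A i s = 1) {n : ℕ}
    (ρ : Fin n → Matrix (Fin dH) (Fin dH) ℂ) {ρ0 : Matrix (Fin dH) (Fin dH) ℂ} (hρ0 : IsDensity ρ0)
    (x y : Fin n → Fin dK) :
    ∑ a, channelOut γ q A (Fin.snoc ρ ρ0 : Fin (n+1) → Matrix (Fin dH) (Fin dH) ℂ)
      (Fin.snoc x a : Fin (n+1) → Fin dK) (Fin.snoc y a : Fin (n+1) → Fin dK) = channelOut γ q A ρ x y := by
  simp only [channelOut, Matrix.sum_apply, Matrix.smul_apply, matTensor, Matrix.of_apply]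
  rw [Finset.sum_comm, sum_snoc']
  apply Finset.sum_congr rfl
  intro i _
  simp only [Fin.prod_univ_castSucc, Fin.snoc_castSucc, Fin.snoc_last, smul_eq_mul]
  have h1 : ∀ u, ∑ a, krausChannel (A u) ρ0 a a = 1 := fun u => (kraus_dens (hA u) hρ0).2
  simp only [← mul_assoc, ← Finset.mul_sum, h1, mul_one, ← Finset.sum_mul]
  congr 1
  rw [← Complex.ofReal_sum]
  congr 1
  simp only [mw_succ_snoc]
  rw [← Finset.mul_sum]
  have : (∑ a, if h : n = 0 then γ a else q (i ⟨n - 1, by omega⟩) a) = 1 := by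
    by_cases h : n = 0
    · simp [h, hγ1]
    · simp [h, hrow]
  rw [this, mul_one]

/-- padding of a decoder by the identity on one more site -/
noncomputable def padM {d n : ℕ} (T : Matrix (Fin n → Fin d) (Fin n → Fin d) ℂ) :
    Matrix (Fin (n+1) → Fin d) (Fin (n+1) → Fin d) ℂ :=
  Matrix.of fun x y => T (Fin.init x) (Fin.init y) * (1 : Matrix (Fin d) (Fin d) ℂ) (x (Fin.last n)) (y (Fin.last n))

lemma padM_psd {d n : ℕ} {T : Matrix (Fin n → Fin d) (Fin n → Fin d) ℂ} (hT : T.PosSemidef) :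
    (padM T).PosSemidef := by
  have h1 := hT.submatrix (fun x : Fin (n+1) → Fin d => (Fin.init x : Fin n → Fin d))
  have h2 := (Matrix.PosSemidef.one (n := Fin d) (R := ℂ)).submatrix (fun x : Fin (n+1) → Fin d => x (Fin.last n))
  exact h1.hadamard h2

lemma padM_one {d n : ℕ} : padM (1 : Matrix (Fin n → Fin d) (Fin n → Fin d) ℂ) = 1 := by
  ext x y
  simp only [padM, Matrix.of_apply, Matrix.one_apply]
  have : x = y ↔ (Fin.init x : Fin n → Fin d) = Fin.init y ∧ x (Fin.last n) = y (Fin.last n) := by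
    constructor
    · rintro rfl; exact ⟨rfl, rfl⟩
    · rintro ⟨h1, h2⟩
      rw [← Fin.snoc_init_self x, ← Fin.snoc_init_self y, h1, h2]
  by_cases h1 : (Fin.init x : Fin n → Fin d) = Fin.init y <;> by_cases h2 : x (Fin.last n) = y (Fin.last n) <;>
    simp [h1, h2, this]

lemma padM_sub {d n N : ℕ} (T : Fin N → Matrix (Fin n → Fin d) (Fin n → Fin d) ℂ) :
    1 - ∑ w, padM (T w) = padM (1 - ∑ w, T w) := by
  rw [← padM_one]
  ext x y
  simp only [padM, Matrix.of_apply, Matrix.sub_apply, Matrix.sum_apply, sub_mul, Finset.sum_mul]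

lemma padM_trace {dH dK S : ℕ} {γ : I → ℝ} {q : I → I → ℝ}
    (hγ1 : ∑ i, γ i = 1) (hrow : ∀ i, ∑ i', q i i' = 1) {A : I → Fin S → Matrix (Fin dK) (Fin dH) ℂ}
    (hA : ∀ i, ∑ s, (A i s)ᴴ * A i s = 1) {n : ℕ}
    (ρ : Fin n → Matrix (Fin dH) (Fin dH) ℂ) {ρ0 : Matrix (Fin dH) (Fin dH) ℂ} (hρ0 : IsDensity ρ0)
    (T : Matrix (Fin n → Fin dK) (Fin n → Fin dK) ℂ) :
    Matrix.trace (channelOut γ q A (Fin.snoc ρ ρ0 : Fin (n+1) → Matrix (Fin dH) (Fin dH) ℂ) * padM T) =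
      Matrix.trace (channelOut γ q A ρ * T) := by
  simp only [Matrix.trace, Matrix.diag_apply, Matrix.mul_apply]
  rw [sum_snoc']
  apply Finset.sum_congr rfl
  intro x _
  simp only [sum_snoc' (I := Fin dK), padM, Matrix.of_apply, Fin.init_snoc, Fin.snoc_last, Matrix.one_apply]
  rw [Finset.sum_comm]
  apply Finset.sum_congr rfl
  intro y _
  rw [← partial_trace hγ1 hrow hA ρ hρ0, Finset.sum_mul]
  apply Finset.sum_congr rfl
  intro a _
  simp

/-- the property of being a code -/
def IsCode {dH dK S : ℕ} (γ : I → ℝ) (q : I → I → ℝ) (A : I → Fin S → Matrix (Fin dK) (Fin dH) ℂ)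
    (δ : ℝ) (n N : ℕ) : Prop :=
  ∃ (f : Fin N → Fin n → Matrix (Fin dH) (Fin dH) ℂ) (Dec : Fin N → Matrix (Fin n → Fin dK) (Fin n → Fin dK) ℂ),
        (∀ w k, IsDensity (f w k)) ∧
        (∀ w, (Dec w).PosSemidef) ∧
        ((1 - ∑ w, Dec w : Matrix (Fin n → Fin dK) (Fin n → Fin dK) ℂ)).PosSemidef ∧
        (∀ w, δ ≤ (Matrix.trace (channelOut γ q A (f w) * Dec w)).re)

lemma pad_code {dH dK S : ℕ} {γ : I → ℝ} {q : I → I → ℝ}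
    (hγ1 : ∑ i, γ i = 1) (hrow : ∀ i, ∑ i', q i i' = 1) {A : I → Fin S → Matrix (Fin dK) (Fin dH) ℂ}
    (hA : ∀ i, ∑ s, (A i s)ᴴ * A i s = 1) {ρ0 : Matrix (Fin dH) (Fin dH) ℂ} (hρ0 : IsDensity ρ0)
    {δ : ℝ} {n N : ℕ} (h : IsCode γ q A δ n N) (m : ℕ) : IsCode γ q A δ (n + m) N := by
  induction m with
  | zero => exact h
  | succ m ih =>
    obtain ⟨f, Dec, h1, h2, h3, h4⟩ := ih
    refine ⟨fun w => Fin.snoc (f w) ρ0, fun w => padM (Dec w), ?_, fun w => padM_psd (h2 w), ?_, ?_⟩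
    · intro w k
      refine Fin.lastCases ?_ (fun k => ?_) k
      · simpa using hρ0
      · simpa using h1 w k
    · have := padM_psd h3
      rw [← padM_sub] at this
      exact this
    · intro w
      have := padM_trace hγ1 hrow hA (f w) hρ0 (Dec w)
      rw [this]
      exact h4 w

lemma trace_sub_equiv {X Y : Type*} [Fintype X] [Fintype Y] (e : X ≃ Y) (M : Matrix Y Y ℂ) :
    (M.submatrix e e).trace = M.trace := by
  simp only [Matrix.trace, Matrix.diag_apply, Matrix.submatrix_apply]
  exact e.sum_comp (fun y => M y y)

lemma block_bound {dH dK S : ℕ} [NeZero dK] {γ : I → ℝ} {q : I → I → ℝ} (hγ0 : ∀ i, 0 ≤ γ i)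
    (hq0 : ∀ i j, 0 ≤ q i j) (hγ1 : ∑ i, γ i = 1) (hrow : ∀ i, ∑ i', q i i' = 1)
    (hinv : ∀ i', ∑ i, γ i * q i i' = γ i')
    (herg : ∀ i j, Filter.Tendsto (fun n => (Matrix.of q ^ n) i j) Filter.atTop (nhds (γ j)))
    {A : I → Fin S → Matrix (Fin dK) (Fin dH) ℂ}
    (hA : ∀ i, ∑ s, (A i s)ᴴ * A i s = 1) (c : ℝ) (hc : 1 ≤ c)
    (hqc : ∀ a b, 0 < γ a → q a b ≤ c * γ b) (l : ℕ) (δ ε : ℝ) (hδ : 0 < δ) (hε : 0 < ε) :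
    ∃ C0 : ℝ, 0 < C0 ∧ ∃ k0 : ℕ, ∀ k ≥ k0, 0 < k → ∀ N : ℕ, IsCode γ q A δ (k * (l+1)) N →
      (N : ℝ) ≤ C0 * c ^ k * (2 : ℝ) ^ (k * (sSup (prodHolevoSet γ q A (l+1)) + ε)) := by
  obtain ⟨C0, hC0, k0, hk0⟩ := core_bound (J := Fin (l+1) → I) (D := Fin (l+1) → Fin dK)
    (Γ := fun B => markovWeight γ q B) (Q := blockQ q l) (fun B => mw_nonneg hγ0 hq0 B)
    (fun B B' => mw_nonneg (fun b => hq0 _ b) hq0 B') (mw_sum γ q hγ1 hrow _) (blockQ_row q hrow l)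
    (blockQ_inv γ q hinv l) (blockQ_conv γ q herg l) c hc
    (fun B B' hB => blockQ_le γ q hγ0 hq0 hγ1 hrow hinv c hqc l B B' hB) δ ε hδ hε
  refine ⟨C0, hC0, k0, fun k hk hkpos N hcode => ?_⟩
  obtain ⟨f, Dec, h1, h2, h3, h4⟩ := hcode
  have hkR : (0 : ℝ) < k := by exact_mod_cast hkpos
  set e := blockEquiv k (l+1) (Fin dK) with he
  refine hk0 k hk hkpos (sSup (prodHolevoSet γ q A (l+1))) N
    (fun w j B => matTensor (fun x => krausChannel (A (B x)) (f w (finProdFinEquiv (j, x)))))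
    (fun w j B => tensor_dens (fun x => kraus_dens (hA _) (h1 _ _))) ?_
    (fun w => (Dec w).submatrix e e) (fun w => (h2 w).submatrix e) ?_ ?_
  · intro w
    simp only [mean_channel]
    have hmem : vnEntropy (∑ j : Fin k, ((1 / k : ℝ) : ℂ) • channelOut γ q A (fun x => f w (finProdFinEquiv (j, x)))) -
        ∑ j : Fin k, (1 / k : ℝ) * vnEntropy (channelOut γ q A (fun x => f w (finProdFinEquiv (j, x)))) ∈
        prodHolevoSet γ q A (l+1) :=
      ⟨k, fun _ => 1 / k, fun j x => f w (finProdFinEquiv (j, x)), fun _ => by positivity,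
        by simp; field_simp, fun j x => h1 _ _, rfl⟩
    have := le_csSup (holevo_bdd hγ0 hq0 hγ1 hrow hA (l+1)) hmem
    rw [← Finset.smul_sum, ← Finset.mul_sum] at this
    have h5 := mul_le_mul_of_nonneg_left this hkR.le
    rw [mul_sub, ← mul_assoc, mul_one_div_cancel hkR.ne', one_mul] at h5
    exact h5
  · have := h3.submatrix e
    convert this using 1
    ext x y
    simp only [Matrix.sub_apply, Matrix.sum_apply, Matrix.submatrix_apply, Matrix.one_apply, e.injective.eq_iff]
  · intro w
    rw [← channel_block, Matrix.submatrix_mul_equiv, trace_sub_equiv]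
    exact h4 w

end Pad

/-- Strong converse for the product-state capacity of a quantum channel with ergodic
Markovian memory: for `λ ∈ (0,1)` and `ε > 0` there is `n₀` such that every
`(n,λ)` product-state code with `N` codewords and `n ≥ n₀` satisfies
`log₂ N ≤ n (χ* + ε)`. -/
theorem strong_converse_markov_memory
    {I : Type} [Fintype I] [DecidableEq I] {dH dK S : ℕ}
    (γ : I → ℝ) (q : I → I → ℝ)
    (hq0 : ∀ i i', 0 ≤ q i i') (hq1 : ∀ i i', q i i' ≤ 1)
    (hrow : ∀ i, ∑ i', q i i' = 1)
    (hγ0 : ∀ i, 0 ≤ γ i) (hγ1 : ∑ i, γ i = 1)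
    (hinv : ∀ i', ∑ i, γ i * q i i' = γ i')
    (herg : ∀ i j, Filter.Tendsto (fun n => (Matrix.of q ^ n) i j)
      Filter.atTop (nhds (γ j)))
    (A : I → Fin S → Matrix (Fin dK) (Fin dH) ℂ)
    (hA : ∀ i, ∑ s, (A i s)ᴴ * A i s = 1)
    (χstar : ℝ)
    (hχ : Filter.Tendsto (fun n : ℕ => sSup (prodHolevoSet γ q A n) / n)
      Filter.atTop (nhds χstar))
    (lam : ℝ) (hlam : lam ∈ Set.Ioo (0 : ℝ) 1) :
    ∀ ε > 0, ∃ n₀ : ℕ, ∀ n ≥ n₀, ∀ N : ℕ,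
      ∀ (f : Fin N → Fin n → Matrix (Fin dH) (Fin dH) ℂ)
        (Dec : Fin N → Matrix (Fin n → Fin dK) (Fin n → Fin dK) ℂ),
        (∀ w k, IsDensity (f w k)) →
        (∀ w, (Dec w).PosSemidef) →
        ((1 - ∑ w, Dec w : Matrix (Fin n → Fin dK) (Fin n → Fin dK) ℂ)).PosSemidef →
        (∀ w, 1 - lam ≤ (Matrix.trace (channelOut γ q A (f w) * Dec w)).re) →
        Real.logb 2 N ≤ n * (χstar + ε) := by
  intro ε hε
  have hδ : 0 < 1 - lam := by linarith [hlam.2]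
  have hχ0 : 0 ≤ χstar := ge_of_tendsto' hχ
    (fun n => div_nonneg (holevo_nonneg hγ0 hq0 hγ1 hrow hA n) (Nat.cast_nonneg n))
  by_cases hdK : dK = 0
  · refine ⟨1, fun n hn N f Dec hf hDec hDec1 hcode => ?_⟩
    rcases Nat.eq_zero_or_pos N with h0 | h0
    · subst h0
      simp only [Nat.cast_zero, Real.logb_zero]
      positivity
    · exfalso
      have hI : Nonempty I := by
        by_contra hI
        rw [not_nonempty_iff] at hI
        simp at hγ1
      obtain ⟨i⟩ := hI
      have h1 := (kraus_dens (hA i) (hf ⟨0, h0⟩ ⟨0, hn⟩)).2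
      subst hdK
      simp [Matrix.trace] at h1
  have hne : NeZero dK := ⟨hdK⟩
  obtain ⟨c, hc, hqc⟩ := exists_c γ q hγ0 hq0 hinv
  have hb : 0 ≤ Real.logb 2 c := Real.logb_nonneg (by norm_num) hc
  obtain ⟨l, hl1, hl2⟩ : ∃ l : ℕ, sSup (prodHolevoSet γ q A (l+1)) / ((l+1 : ℕ) : ℝ) ≤ χstar + ε / 4 ∧
      (Real.logb 2 c + 1) / ((l+1 : ℕ) : ℝ) ≤ ε / 4 := by
    have e1 : ∀ᶠ n : ℕ in Filter.atTop, sSup (prodHolevoSet γ q A n) / n ≤ χstar + ε / 4 :=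
      hχ.eventually_le_const (by linarith)
    have e2 : ∀ᶠ n : ℕ in Filter.atTop, (Real.logb 2 c + 1) / (n : ℝ) ≤ ε / 4 :=
      (tendsto_const_div_atTop_nhds_zero_nat _).eventually_le_const (by linarith)
    obtain ⟨n, hn1, hn2, hn3⟩ := (e1.and (e2.and (Filter.eventually_ge_atTop 1))).exists
    obtain ⟨l, rfl⟩ : ∃ l, n = l + 1 := ⟨n - 1, by omega⟩
    exact ⟨l, hn1, hn2⟩
  set L : ℕ := l + 1 with hL
  have hLpos : (0 : ℝ) < (L : ℝ) := by rw [hL]; positivity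
  rw [div_le_iff₀ hLpos] at hl1 hl2
  obtain ⟨C0, hC0, k0, hk0⟩ := block_bound (dK := dK) hγ0 hq0 hγ1 hrow hinv herg hA c hc hqc l (1 - lam) 1 hδ one_pos
  set K : ℝ := |Real.logb 2 C0| + L * (χstar + ε / 2) with hK
  obtain ⟨n1, hn1⟩ := exists_nat_ge (K / (ε / 2))
  refine ⟨max (max 1 n1) (k0 * L), fun n hn N f Dec hf hDec hDec1 hcode => ?_⟩
  have hn1' : 1 ≤ n := (le_max_left _ _).trans ((le_max_left _ _).trans hn)
  have hn2' : n1 ≤ n := (le_max_right _ _).trans ((le_max_left _ _).trans hn)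
  have hn3' : k0 * L ≤ n := (le_max_right _ _).trans hn
  rcases Nat.eq_zero_or_pos N with h0 | h0
  · subst h0
    simp only [Nat.cast_zero, Real.logb_zero]
    positivity
  have hρ0 := hf ⟨0, h0⟩ ⟨0, hn1'⟩
  set k : ℕ := n / L + 1 with hk
  have hLN : 0 < L := by omega
  have hkL : n ≤ k * L := by
    have := Nat.div_add_mod n L
    have h2 := Nat.mod_lt n hLN
    rw [hk]
    nlinarith
  have hkL2 : k * L ≤ n + L := by
    have := Nat.div_mul_le_self n L
    rw [hk, add_mul, one_mul]
    omega
  have hkk0 : k0 ≤ k := by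
    have : k0 ≤ n / L := (Nat.le_div_iff_mul_le hLN).2 hn3'
    omega
  have hC : IsCode γ q A (1 - lam) n N := ⟨f, Dec, hf, hDec, hDec1, hcode⟩
  have hC2 := pad_code hγ1 hrow hA hρ0 hC (k * L - n)
  rw [Nat.add_sub_cancel' hkL] at hC2
  have hmain := hk0 k hkk0 (by rw [hk]; exact Nat.succ_pos _) N hC2
  have hN0 : (0 : ℝ) < N := by exact_mod_cast h0
  have hc0 : 0 < c := by linarith
  have hlog := Real.logb_le_logb_of_le (b := 2) (by norm_num) hN0 hmain
  rw [Real.logb_mul (by positivity) (by positivity), Real.logb_mul (by positivity) (by positivity),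
    Real.logb_pow, Real.logb_rpow (by norm_num) (by norm_num)] at hlog
  have hk0R : (0 : ℝ) ≤ k := Nat.cast_nonneg k
  have h6 : (k : ℝ) * Real.logb 2 c + k * (sSup (prodHolevoSet γ q A L) + 1) ≤ (k * L) * (χstar + ε / 2) := by
    have := mul_le_mul_of_nonneg_left (add_le_add hl1 hl2) hk0R
    nlinarith
  have h7 : ((k : ℝ) * L) * (χstar + ε / 2) ≤ (n + L) * (χstar + ε / 2) := by
    apply mul_le_mul_of_nonneg_right _ (by positivity)
    exact_mod_cast hkL2
  have h8 : K ≤ n * (ε / 2) := by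
    rw [← div_le_iff₀ (by positivity)]
    exact hn1.trans (by exact_mod_cast hn2')
  have h9 := le_abs_self (Real.logb 2 C0)
  rw [hK] at h8
  linarith
end

section
/- Trace bound for the frequency-typical projector: Let ρ be a density matrix on ℂ^d with spectral decomposition ρ = ∑_{p=1}^d λ_p |e_p⟩⟨e_p| (orthonormal eigenbasis). For δ > 0 and n ∈ ℕ define the typical projector Π^n_{ρ,δ} on (ℂ^d)^{⊗n} as the sum, over all sequences (p_1,…,p_n) ∈ {1,…,d}^n satisfying |#{k : p_k = p} − n λ_p| ≤ n δ for every p, of the rank-one projections ⊗_{k=1}^n |e_{p_k}⟩⟨e_{p_k}|. Then for every ε > 0 there exists δ₀ > 0 such that for every 0 < δ ≤ δ₀ there exists n₀ with: for all n ≥ n₀, Tr Π^n_{ρ,δ} ≤ 2^{n(S(ρ)+ε)}. -/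
open scoped BigOperators ComplexOrder Matrix

/-- The rank-one projection `|v⟩⟨v|` onto a (unit) vector `v ∈ ℂ^d`. -/
noncomputable def outerProj {d : ℕ} (v : Fin d → ℂ) : Matrix (Fin d) (Fin d) ℂ :=
  Matrix.vecMulVec v (star v)

/-- The frequency `δ`-typical projector `Π^n_{ρ,δ}` associated to an eigenbasis `e` and
eigenvalue list `lam`: the sum over all sequences `(p₁,…,pₙ)` with
`|#{k : p_k = p} − n·lam p| ≤ n·δ` for all `p` of the projections `⊗ₖ |e_{p_k}⟩⟨e_{p_k}|`. -/
noncomputable def typicalProj {d : ℕ} (e : Fin d → Fin d → ℂ) (lam : Fin d → ℝ)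
    (δ : ℝ) (n : ℕ) : Matrix (Fin n → Fin d) (Fin n → Fin d) ℂ :=
  ∑ p : Fin n → Fin d,
    if ∀ q : Fin d,
        |(((Finset.univ.filter fun k => p k = q).card : ℝ)) - n * lam q| ≤ n * δ then
      matTensor fun k => outerProj (e (p k))
    else 0

/-- The Shannon entropy (base 2) of the eigenvalue list of a density matrix. -/
noncomputable def shannonEntropy {d : ℕ} (lam : Fin d → ℝ) : ℝ :=
  -∑ p, lam p * Real.logb 2 (lam p)

lemma trace_matTensor' {m d : ℕ} (A : Fin m → Matrix (Fin d) (Fin d) ℂ) :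
    Matrix.trace (matTensor A) = ∏ k, Matrix.trace (A k) := by
  simp only [Matrix.trace, Matrix.diag, matTensor, Matrix.of_apply]
  rw [Finset.prod_univ_sum, Fintype.piFinset_univ]

/-- Counting bound: sequences with letter counts at most `c q` number at most `2^(∑ c q * L q)`
as soon as `∑ 2^(-L q) = 1` and `L ≥ 0`. -/
lemma count_bound {d n : ℕ} (T : Finset (Fin n → Fin d)) (L c : Fin d → ℝ)
    (hL : ∀ q, 0 ≤ L q) (hsum : ∑ q, (2 : ℝ) ^ (-L q) = 1)
    (hT : ∀ p ∈ T, ∀ q, ((Finset.univ.filter fun k => p k = q).card : ℝ) ≤ c q) :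
    (T.card : ℝ) ≤ (2 : ℝ) ^ (∑ q, c q * L q) := by
  have h1 : ∑ p : Fin n → Fin d, ∏ k, (2 : ℝ) ^ (-L (p k)) = 1 := by
    have := Finset.prod_univ_sum (fun _ : Fin n => (Finset.univ : Finset (Fin d)))
      (fun _ q => (2 : ℝ) ^ (-L q))
    rw [Fintype.piFinset_univ] at this
    rw [← this]
    simp [hsum]
  have h2 : ∀ p ∈ T, (2 : ℝ) ^ (-∑ q, c q * L q) ≤ ∏ k, (2 : ℝ) ^ (-L (p k)) := by
    intro p hp
    rw [← Real.rpow_sum_of_pos (by norm_num)]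
    apply Real.rpow_le_rpow_of_exponent_le (by norm_num)
    rw [Finset.sum_neg_distrib, neg_le_neg_iff]
    have : ∑ k, L (p k) = ∑ q, ((Finset.univ.filter fun k => p k = q).card : ℝ) * L q := by
      rw [← Finset.sum_fiberwise (s := Finset.univ) (g := p)]
      refine Finset.sum_congr rfl fun q _ => ?_
      rw [Finset.sum_congr rfl (g := fun _ => L q)]
      · simp
      · intro k hk
        rw [(Finset.mem_filter.mp hk).2]
    rw [this]
    exact Finset.sum_le_sum fun q _ => mul_le_mul_of_nonneg_right (hT p hp q) (hL q)
  have h3 : (T.card : ℝ) * (2 : ℝ) ^ (-∑ q, c q * L q) ≤ 1 := by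
    rw [← h1, ← nsmul_eq_mul]
    refine (Finset.card_nsmul_le_sum T _ _ h2).trans ?_
    exact Finset.sum_le_sum_of_subset_of_nonneg (Finset.subset_univ _)
      fun _ _ _ => Finset.prod_nonneg fun _ _ => by positivity
  rw [Real.rpow_neg (by norm_num), ← div_eq_mul_inv, div_le_one (by positivity)] at h3
  exact h3

theorem typicalProj_trace_bound {d : ℕ} (ρ : Matrix (Fin d) (Fin d) ℂ)
    (e : Fin d → Fin d → ℂ) (lam : Fin d → ℝ)
    (hρ : ρ.PosSemidef) (htr : ρ.trace = 1)
    (horth : ∀ p q, (star (e p)) ⬝ᵥ e q = if p = q then 1 else 0)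
    (hspec : ρ = ∑ p, (lam p : ℂ) • outerProj (e p)) :
    ∀ ε > 0, ∃ δ₀ > 0, ∀ δ, 0 < δ → δ ≤ δ₀ → ∃ n₀ : ℕ, ∀ n ≥ n₀,
      (Matrix.trace (typicalProj e lam δ n)).re ≤
        (2 : ℝ) ^ ((n : ℝ) * (shannonEntropy lam + ε)) := by
  have hto : ∀ q, Matrix.trace (outerProj (e q)) = 1 := by
    intro q
    rw [outerProj, Matrix.trace_vecMulVec, dotProduct_comm, horth]; simp
  have hsum : ∑ q, lam q = 1 := by
    have : ((∑ q, lam q : ℝ) : ℂ) = 1 := by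
      rw [← htr, hspec, Matrix.trace_sum]
      simp [Matrix.trace_smul, hto]
    exact_mod_cast this
  have hnn : ∀ q, 0 ≤ lam q := by
    intro q
    have h := hρ.dotProduct_mulVec_nonneg (e q)
    have h2 : star (e q) ⬝ᵥ (ρ *ᵥ e q) = (lam q : ℂ) := by
      rw [hspec, Matrix.sum_mulVec, dotProduct_sum]
      rw [Finset.sum_eq_single q]
      · simp [Matrix.smul_mulVec, outerProj, Matrix.vecMulVec_mulVec, horth]
      · intro b _ hb
        simp [Matrix.smul_mulVec, outerProj, Matrix.vecMulVec_mulVec, horth, hb]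
      · simp
    rw [h2] at h
    exact_mod_cast h
  have htrace : ∀ δ n, (Matrix.trace (typicalProj e lam δ n)).re =
      ((Finset.univ.filter fun p : Fin n → Fin d => ∀ q : Fin d,
        |(((Finset.univ.filter fun k => p k = q).card : ℝ)) - n * lam q| ≤ n * δ).card : ℝ) := by
    intro δ n
    rw [typicalProj, Matrix.trace_sum, Finset.card_filter]
    simp only [apply_ite Matrix.trace, trace_matTensor', hto, Matrix.trace_zero,
      Finset.prod_const_one]
    rw [Complex.re_sum]
    push_cast
    refine Finset.sum_congr rfl fun p _ => ?_
    split_ifs <;> simp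
  intro ε hε
  -- smoothing parameter
  obtain ⟨η, hη, hηε⟩ : ∃ η : ℝ, 0 < η ∧ 1 + d * η ≤ (2 : ℝ) ^ (ε / 2) := by
    have h1 : (1 : ℝ) < 2 ^ (ε / 2) := Real.one_lt_rpow (by norm_num) (by positivity)
    refine ⟨((2 : ℝ) ^ (ε / 2) - 1) / (d + 1), by apply div_pos <;> [linarith; positivity], ?_⟩
    have : (d : ℝ) * (((2 : ℝ) ^ (ε / 2) - 1) / (d + 1)) ≤ (2 : ℝ) ^ (ε / 2) - 1 := by
      rw [← mul_div_assoc, div_le_iff₀ (by positivity)]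
      nlinarith
    linarith
  have hZ : (0 : ℝ) < 1 + d * η := by positivity
  have hle1 : ∀ q, lam q ≤ 1 := fun q => by
    rw [← hsum]; exact Finset.single_le_sum (fun i _ => hnn i) (Finset.mem_univ q)
  have hlogZ : Real.logb 2 (1 + d * η) ≤ ε / 2 := by
    rw [Real.logb_le_iff_le_rpow (by norm_num) hZ]; exact hηε
  have hpos : ∀ q, 0 < lam q + η := fun q => by have := hnn q; linarith
  obtain ⟨L, hLdef⟩ : ∃ L : Fin d → ℝ, ∀ q, L q = -Real.logb 2 ((lam q + η) / (1 + d * η)) :=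
    ⟨_, fun _ => rfl⟩
  have hL : ∀ q, 0 ≤ L q := by
    intro q
    rw [hLdef, neg_nonneg]
    apply Real.logb_nonpos (by norm_num) (div_pos (hpos q) hZ).le
    rw [div_le_one hZ]
    have hd : (1 : ℝ) ≤ d := by exact_mod_cast q.pos
    nlinarith [hle1 q]
  have hLs : ∑ q, (2 : ℝ) ^ (-L q) = 1 := by
    have : ∀ q, (2 : ℝ) ^ (-L q) = (lam q + η) / (1 + d * η) := fun q => by
      rw [hLdef, neg_neg, Real.rpow_logb (by norm_num) (by norm_num) (div_pos (hpos q) hZ)]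
    simp only [this]
    rw [← Finset.sum_div, Finset.sum_add_distrib, hsum]
    simp [hZ.ne']
  have hent : ∑ q, lam q * L q ≤ shannonEntropy lam + ε / 2 := by
    have : ∀ q, lam q * L q ≤ -(lam q * Real.logb 2 (lam q)) + lam q * (ε / 2) := by
      intro q
      rcases (hnn q).eq_or_lt with h | h
      · simp [← h]
      · rw [hLdef, Real.logb_div (hpos q).ne' hZ.ne']
        have : Real.logb 2 (lam q) ≤ Real.logb 2 (lam q + η) :=
          Real.logb_le_logb_of_le (by norm_num) h (by linarith)
        nlinarith
    refine (Finset.sum_le_sum fun q _ => this q).trans ?_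
    rw [Finset.sum_add_distrib, ← Finset.sum_mul, hsum, Finset.sum_neg_distrib, shannonEntropy,
      one_mul]
  have hLn : 0 ≤ ∑ q, L q := Finset.sum_nonneg fun q _ => hL q
  refine ⟨ε / 2 / (∑ q, L q + 1), by positivity, fun δ hδ hδ0 => ⟨0, fun n _ => ?_⟩⟩
  rw [htrace]
  refine (count_bound _ L (fun q => n * (lam q + δ)) hL hLs ?_).trans ?_
  · intro p hp q
    have := (abs_le.mp ((Finset.mem_filter.mp hp).2 q)).2
    linarith
  · apply Real.rpow_le_rpow_of_exponent_le (by norm_num)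
    have hδL : δ * ∑ q, L q ≤ ε / 2 := by
      rw [le_div_iff₀ (by positivity)] at hδ0
      nlinarith
    have : ∑ q, (n : ℝ) * (lam q + δ) * L q = n * (∑ q, lam q * L q + δ * ∑ q, L q) := by
      rw [Finset.mul_sum, ← Finset.sum_add_distrib, Finset.mul_sum]
      exact Finset.sum_congr rfl fun q _ => by ring
    rw [this]
    exact mul_le_mul_of_nonneg_left (by linarith) (Nat.cast_nonneg n)
end

section
/- Operator sandwich bound for the typical projector: Let ρ be a density matrix on ℂ^d with spectral decomposition ρ = ∑_{p=1}^d λ_p |e_p⟩⟨e_p| (orthonormal eigenbasis) and suppose λ_p > 0 for every p. Let ε > 0 and δ > 0 satisfy δ · ∑_{p=1}^d |log₂ λ_p| ≤ ε. With Π^n_{ρ,δ} the frequency δ-typical projector on (ℂ^d)^{⊗n}, one has the Loewner-order inequalities 2^{−n(S(ρ)+ε)} Π^n_{ρ,δ} ≤ Π^n_{ρ,δ} ρ^{⊗n} Π^n_{ρ,δ} ≤ 2^{−n(S(ρ)−ε)} Π^n_{ρ,δ} for every n ∈ ℕ. -/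
open scoped BigOperators ComplexOrder Matrix

/-- The tensor product basis projection. -/
noncomputable def seqProj {d n : ℕ} (e : Fin d → Fin d → ℂ) (p : Fin n → Fin d) :
    Matrix (Fin n → Fin d) (Fin n → Fin d) ℂ :=
  matTensor fun k => outerProj (e (p k))

lemma matTensor_mul {m d : ℕ} (A B : Fin m → Matrix (Fin d) (Fin d) ℂ) :
    matTensor A * matTensor B = matTensor (fun k => A k * B k) := by
  ext x y
  simp only [matTensor, Matrix.mul_apply, Matrix.of_apply, Finset.prod_univ_sum,
    Fintype.piFinset_univ, Finset.prod_mul_distrib]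

lemma outerProj_mul {d : ℕ} (e : Fin d → Fin d → ℂ)
    (horth : ∀ p q, (star (e p)) ⬝ᵥ e q = if p = q then 1 else 0) (p q : Fin d) :
    outerProj (e p) * outerProj (e q) = if p = q then outerProj (e p) else 0 := by
  rw [outerProj, outerProj, Matrix.vecMulVec_mul_vecMulVec, horth]
  by_cases h : p = q
  · subst h; simp
  · simp [h]

lemma seqProj_mul {d n : ℕ} (e : Fin d → Fin d → ℂ)
    (horth : ∀ p q, (star (e p)) ⬝ᵥ e q = if p = q then 1 else 0) (p q : Fin n → Fin d) :
    seqProj e p * seqProj e q = if p = q then seqProj e p else 0 := by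
  rw [seqProj, seqProj, matTensor_mul]
  simp only [outerProj_mul e horth]
  by_cases h : p = q
  · subst h; simp
  · rw [if_neg h]
    obtain ⟨k, hk⟩ := Function.ne_iff.mp h
    ext x y
    simp only [matTensor, Matrix.of_apply, Matrix.zero_apply]
    exact Finset.prod_eq_zero (Finset.mem_univ k) (by simp [hk])

lemma seqProj_posSemidef {d n : ℕ} (e : Fin d → Fin d → ℂ) (p : Fin n → Fin d) :
    (seqProj e p).PosSemidef := by
  have : seqProj e p = Matrix.vecMulVec (fun x => ∏ k, e (p k) (x k))
      (star (fun x => ∏ k, e (p k) (x k))) := by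
    ext x y
    simp [seqProj, matTensor, outerProj, Matrix.vecMulVec_apply, Finset.prod_mul_distrib]
  rw [this]
  exact Matrix.posSemidef_vecMulVec_self_star _

lemma sum_seqProj_mul {d n : ℕ} (e : Fin d → Fin d → ℂ)
    (horth : ∀ p q, (star (e p)) ⬝ᵥ e q = if p = q then 1 else 0)
    (a b : (Fin n → Fin d) → ℂ) :
    (∑ p, a p • seqProj e p) * (∑ p, b p • seqProj e p) = ∑ p, (a p * b p) • seqProj e p := by
  simp [Finset.sum_mul, Finset.mul_sum, seqProj_mul e horth, smul_smul, mul_comm]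

lemma matTensor_spec {d n : ℕ} (e : Fin d → Fin d → ℂ) (lam : Fin d → ℝ) :
    matTensor (fun _ : Fin n => ∑ p, (lam p : ℂ) • outerProj (e p)) =
      ∑ p : Fin n → Fin d, ((∏ k, lam (p k) : ℝ) : ℂ) • seqProj e p := by
  ext x y
  simp only [matTensor, seqProj, Matrix.of_apply, Matrix.sum_apply, Matrix.smul_apply,
    Finset.prod_univ_sum, Fintype.piFinset_univ, smul_eq_mul, Finset.prod_mul_distrib,
    Complex.ofReal_prod]

lemma typical_bounds {d n : ℕ} (lam : Fin d → ℝ) (hpos : ∀ p, 0 < lam p) (ε δ : ℝ)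
    (hδε : δ * ∑ p, |Real.logb 2 (lam p)| ≤ ε) (p : Fin n → Fin d)
    (hp : ∀ q : Fin d,
        |(((Finset.univ.filter fun k => p k = q).card : ℝ)) - n * lam q| ≤ n * δ) :
    (2 : ℝ) ^ (-((n : ℝ) * (shannonEntropy lam + ε))) ≤ ∏ k, lam (p k) ∧
    ∏ k, lam (p k) ≤ (2 : ℝ) ^ (-((n : ℝ) * (shannonEntropy lam - ε))) := by
  have hP : 0 < ∏ k, lam (p k) := Finset.prod_pos fun k _ => hpos _
  have h1 : Real.logb 2 (∏ k, lam (p k)) =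
      ∑ q, ((Finset.univ.filter fun k => p k = q).card : ℝ) * Real.logb 2 (lam q) := by
    rw [Real.logb_prod _ _ (fun k _ => (hpos _).ne'),
      ← Finset.sum_fiberwise Finset.univ p]
    refine Finset.sum_congr rfl fun q _ => ?_
    rw [← nsmul_eq_mul, ← Finset.sum_const]
    refine Finset.sum_congr rfl fun k hk => ?_
    rw [(Finset.mem_filter.mp hk).2]
  have h2 : Real.logb 2 (∏ k, lam (p k)) + n * shannonEntropy lam =
      ∑ q, (((Finset.univ.filter fun k => p k = q).card : ℝ) - n * lam q) *
        Real.logb 2 (lam q) := by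
    rw [h1, shannonEntropy]
    simp only [sub_mul, Finset.sum_sub_distrib, mul_neg, Finset.mul_sum, mul_assoc]
    ring
  have h3 : |Real.logb 2 (∏ k, lam (p k)) + n * shannonEntropy lam| ≤ n * ε := by
    rw [h2]
    calc _ ≤ ∑ q, |(((Finset.univ.filter fun k => p k = q).card : ℝ) - n * lam q) *
        Real.logb 2 (lam q)| := Finset.abs_sum_le_sum_abs _ _
      _ ≤ ∑ q, (n * δ) * |Real.logb 2 (lam q)| := by
        refine Finset.sum_le_sum fun q _ => ?_
        rw [abs_mul]
        exact mul_le_mul_of_nonneg_right (hp q) (abs_nonneg _)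
      _ = n * (δ * ∑ q, |Real.logb 2 (lam q)|) := by rw [← Finset.mul_sum, mul_assoc]
      _ ≤ n * ε := mul_le_mul_of_nonneg_left hδε (Nat.cast_nonneg _)
  obtain ⟨h4, h5⟩ := abs_le.mp h3
  constructor
  · rw [← Real.le_logb_iff_rpow_le (by norm_num) hP]; linarith
  · rw [← Real.logb_le_iff_le_rpow (by norm_num) hP]; linarith

/-- Operator sandwich bound for the typical projector: if `ρ = ∑ₚ lam p |eₚ⟩⟨eₚ|` is a
density matrix with orthonormal eigenbasis `e`, strictly positive eigenvalues, and
`δ · ∑ₚ |log₂ lam p| ≤ ε`, then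
`2^{−n(S(ρ)+ε)} Π ≤ Π ρ^{⊗n} Π ≤ 2^{−n(S(ρ)−ε)} Π` in the Loewner order for all `n`. -/
theorem typicalProj_sandwich {d : ℕ} (ρ : Matrix (Fin d) (Fin d) ℂ)
    (e : Fin d → Fin d → ℂ) (lam : Fin d → ℝ)
    (hρ : ρ.PosSemidef) (htr : ρ.trace = 1)
    (horth : ∀ p q, (star (e p)) ⬝ᵥ e q = if p = q then 1 else 0)
    (hspec : ρ = ∑ p, (lam p : ℂ) • outerProj (e p))
    (hpos : ∀ p, 0 < lam p)
    (ε δ : ℝ) (hε : 0 < ε) (hδ : 0 < δ)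
    (hδε : δ * ∑ p, |Real.logb 2 (lam p)| ≤ ε) (n : ℕ) :
    (typicalProj e lam δ n * matTensor (fun _ => ρ) * typicalProj e lam δ n -
        (((2 : ℝ) ^ (-((n : ℝ) * (shannonEntropy lam + ε))) : ℝ) : ℂ) •
          typicalProj e lam δ n).PosSemidef ∧
    ((((2 : ℝ) ^ (-((n : ℝ) * (shannonEntropy lam - ε))) : ℝ) : ℂ) • typicalProj e lam δ n -
        typicalProj e lam δ n * matTensor (fun _ => ρ) * typicalProj e lam δ n).PosSemidef := by
  classical
  set T : (Fin n → Fin d) → Prop := fun p => ∀ q : Fin d,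
    |(((Finset.univ.filter fun k => p k = q).card : ℝ)) - n * lam q| ≤ n * δ with hT
  have hProj : typicalProj e lam δ n = ∑ p, (if T p then (1 : ℂ) else 0) • seqProj e p := by
    rw [typicalProj]
    refine Finset.sum_congr rfl fun p _ => ?_
    by_cases h : T p
    · rw [if_pos h, if_pos h, one_smul, seqProj]
    · rw [if_neg h, if_neg h, zero_smul]
  rw [hspec, matTensor_spec, hProj, sum_seqProj_mul e horth, sum_seqProj_mul e horth,
    Finset.smul_sum, Finset.smul_sum, ← Finset.sum_sub_distrib, ← Finset.sum_sub_distrib]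
  constructor
  · refine Matrix.posSemidef_sum _ fun p _ => ?_
    by_cases h : T p
    · have hb := (typical_bounds lam hpos ε δ hδε p h).1
      simp only [if_pos h, one_mul, mul_one, one_smul, ← sub_smul, ← Complex.ofReal_sub]
      exact (seqProj_posSemidef e p).smul (by exact_mod_cast sub_nonneg.mpr hb)
    · simpa [h] using Matrix.PosSemidef.zero
  · refine Matrix.posSemidef_sum _ fun p _ => ?_
    by_cases h : T p
    · have hb := (typical_bounds lam hpos ε δ hδε p h).2
      simp only [if_pos h, one_mul, mul_one, one_smul, ← sub_smul, ← Complex.ofReal_sub]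
      exact (seqProj_posSemidef e p).smul (by exact_mod_cast sub_nonneg.mpr hb)
    · simpa [h] using Matrix.PosSemidef.zero
end

section
/- Telescoping marginal identity for the Markov-correlated measurement distribution: Fix an orthonormal basis (e_p)_{p=1}^d of ℂ^d, let π_p := |e_p⟩⟨e_p|, set λ_k(i,i';p) := Tr(π_p σ_k(i,i')), and define P : {1,…,d}^m → ℝ by P((p_1,…,p_m)) := ∑_{i_1,…,i_{m+1}∈I} γ_{i_1} ∏_{k=1}^m λ_k(i_k,i_{k+1};p_k). Then, assuming conditions (i) and (ii), P is a probability distribution on {1,…,d}^m, and for each k ∈ {1,…,m} its k-th marginal is given by P(p_k = p) = ∑_{i∈I} γ_i Tr(π_p σ_k(i)). -/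
open scoped BigOperators ComplexOrder Matrix

/-- The Markov-correlated state
`σ^{(m)} = ∑_{i₁,…,i_{m+1}} γ_{i₁} σ₁(i₁,i₂) ⊗ ⋯ ⊗ σ_m(i_m,i_{m+1})`. -/
noncomputable def sigmaChain {I : Type*} [Fintype I] {d m : ℕ} (γ : I → ℝ)
    (σ : Fin m → I → I → Matrix (Fin d) (Fin d) ℂ) :
    Matrix (Fin m → Fin d) (Fin m → Fin d) ℂ :=
  ∑ i : Fin (m + 1) → I,
    ((γ (i 0) : ℂ)) • matTensor (fun k => σ k (i k.castSucc) (i k.succ))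

/-- The measurement distribution
`P((p₁,…,p_m)) = ∑_{i₁,…,i_{m+1}} γ_{i₁} ∏ₖ λₖ(iₖ,i_{k+1}; pₖ)` with
`λₖ(i,i';p) = Tr(πₖ(p) σₖ(i,i'))`. -/
noncomputable def measP {I : Type*} [Fintype I] {d m : ℕ} (γ : I → ℝ)
    (σ : Fin m → I → I → Matrix (Fin d) (Fin d) ℂ)
    (π : Fin m → Fin d → Matrix (Fin d) (Fin d) ℂ) (p : Fin m → Fin d) : ℝ :=
  ∑ i : Fin (m + 1) → I,
    γ (i 0) * ∏ k, (Matrix.trace (π k (p k) * σ k (i k.castSucc) (i k.succ))).re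

/-- Sum of a weighted product over all chains. -/
noncomputable def chainS {I : Type*} [Fintype I] {m : ℕ} (f : I → ℝ)
    (T : Fin m → I → I → ℝ) : ℝ :=
  ∑ i : Fin (m + 1) → I, f (i 0) * ∏ k, T k (i k.castSucc) (i k.succ)

theorem chainS_step {I : Type*} [Fintype I] {m : ℕ} (f : I → ℝ)
    (T : Fin (m + 1) → I → I → ℝ) :
    chainS f T = chainS (fun b => ∑ a, f a * T 0 a b) (fun k => T k.succ) := by
  unfold chainS
  rw [← (Fin.consEquiv (fun _ : Fin (m + 2) => I)).sum_comp, Fintype.sum_prod_type,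
    Finset.sum_comm]
  refine Finset.sum_congr rfl fun j _ => ?_
  rw [Finset.sum_mul]
  refine Finset.sum_congr rfl fun a _ => ?_
  rw [Fin.prod_univ_succ]
  simp [Fin.consEquiv, ← Fin.succ_castSucc, mul_assoc]

theorem chainS_rows {I : Type*} [Fintype I] {m : ℕ} (f : I → ℝ)
    (T : Fin m → I → I → ℝ) (hT : ∀ k a, ∑ b, T k a b = 1) :
    chainS f T = ∑ a, f a := by
  induction m generalizing f with
  | zero =>
    unfold chainS
    rw [← (Equiv.funUnique (Fin 1) I).symm.sum_comp]
    simp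
  | succ m ih =>
    rw [chainS_step, ih _ _ (fun k a => hT k.succ a), Finset.sum_comm]
    simp [← Finset.mul_sum, hT]

theorem chainS_marg {I : Type*} [Fintype I] {m : ℕ} (γ : I → ℝ)
    (T : Fin m → I → I → ℝ) (k : Fin m)
    (hT : ∀ l, l ≠ k → ∀ a, ∑ b, T l a b = 1)
    (hc : ∀ l, l ≠ k → ∀ b, ∑ a, γ a * T l a b = γ b) :
    chainS γ T = ∑ a, γ a * ∑ b, T k a b := by
  induction m with
  | zero => exact k.elim0
  | succ m ih =>
    rw [chainS_step]
    cases k using Fin.cases with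
    | zero =>
      rw [chainS_rows _ _ (fun l a => hT l.succ (Fin.succ_ne_zero l) a), Finset.sum_comm]
      simp [Finset.mul_sum]
    | succ k =>
      simp only [hc 0 (Fin.succ_ne_zero k).symm]
      exact ih _ k (fun l hl => hT l.succ (by simpa using hl))
        (fun l hl => hc l.succ (by simpa using hl))

theorem sum_measP {I : Type*} [Fintype I] {d m : ℕ} (γ : I → ℝ)
    (σ : Fin m → I → I → Matrix (Fin d) (Fin d) ℂ)
    (π : Fin m → Fin d → Matrix (Fin d) (Fin d) ℂ) (t : Fin m → Finset (Fin d)) :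
    ∑ p ∈ Fintype.piFinset t, measP γ σ π p =
      chainS γ (fun k a b => ∑ r ∈ t k, (Matrix.trace (π k r * σ k a b)).re) := by
  unfold measP chainS
  rw [Finset.sum_comm]
  refine Finset.sum_congr rfl fun i _ => ?_
  rw [← Finset.mul_sum, Finset.prod_univ_sum]

theorem sum_outerProj {d : ℕ} (e : Fin d → Fin d → ℂ)
    (horth : ∀ p q, (star (e p)) ⬝ᵥ e q = if p = q then 1 else 0) :
    ∑ r, outerProj (e r) = 1 := by
  have h : (Matrix.of e)ᵀᴴ * (Matrix.of e)ᵀ = 1 := by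
    ext p q
    have := horth p q
    simpa [Matrix.mul_apply, dotProduct, Matrix.one_apply] using this
  have h2 := mul_eq_one_comm.mp h
  rw [← h2]
  ext x y
  simp [outerProj, Matrix.sum_apply, Matrix.mul_apply, Matrix.vecMulVec_apply]

theorem outerProj_trace_nonneg {d : ℕ} (v : Fin d → ℂ) (A : Matrix (Fin d) (Fin d) ℂ)
    (hA : A.PosSemidef) : 0 ≤ (Matrix.trace (outerProj v * A)).re := by
  have h := hA.dotProduct_mulVec_nonneg v
  have h2 : Matrix.trace (outerProj v * A) = star v ⬝ᵥ (A *ᵥ v) := by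
    rw [outerProj, Matrix.vecMulVec_mul, Matrix.trace_vecMulVec, dotProduct_comm,
      Matrix.dotProduct_mulVec]
  rw [h2]
  exact (Complex.le_def.mp h).1

/-- Telescoping marginal identity for the Markov-correlated measurement distribution:
under conditions (i) and (ii), `P` is a probability distribution on `{1,…,d}^m` and its
`k`-th marginal is `P(p_k = q) = ∑ᵢ γᵢ Tr(π_q σ_k(i))`. -/
theorem measP_prob_and_marginal {I : Type*} [Fintype I] {d m : ℕ}
    (γ : I → ℝ) (hγ0 : ∀ i, 0 ≤ γ i) (hγ1 : ∑ i, γ i = 1)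
    (σ : Fin m → I → I → Matrix (Fin d) (Fin d) ℂ)
    (hpsd : ∀ k i i', (σ k i i').PosSemidef)
    (hi : ∀ k i', ∑ i, (γ i : ℂ) * Matrix.trace (σ k i i') = (γ i' : ℂ))
    (hii : ∀ k i, Matrix.trace (∑ i', σ k i i') = 1)
    (e : Fin d → Fin d → ℂ)
    (horth : ∀ p q, (star (e p)) ⬝ᵥ e q = if p = q then 1 else 0) :
    (∀ p, 0 ≤ measP γ σ (fun _ q => outerProj (e q)) p) ∧
    (∑ p : Fin m → Fin d, measP γ σ (fun _ q => outerProj (e q)) p = 1) ∧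
    (∀ (k : Fin m) (q : Fin d),
      ∑ p ∈ Finset.univ.filter fun p : Fin m → Fin d => p k = q,
          measP γ σ (fun _ r => outerProj (e r)) p =
        ∑ i, γ i * (Matrix.trace (outerProj (e q) * ∑ i', σ k i i')).re) := by
  have hsum : ∀ k a b, ∑ r, (Matrix.trace (outerProj (e r) * σ k a b)).re
      = (Matrix.trace (σ k a b)).re := by
    intro k a b
    rw [← Complex.re_sum, ← Matrix.trace_sum, ← Finset.sum_mul, sum_outerProj e horth, one_mul]
  have hrow : ∀ k a, ∑ b, (Matrix.trace (σ k a b)).re = 1 := by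
    intro k a
    rw [← Complex.re_sum, ← Matrix.trace_sum, hii, Complex.one_re]
  have hcol : ∀ k b, ∑ a, γ a * (Matrix.trace (σ k a b)).re = γ b := by
    intro k b
    have := congrArg Complex.re (hi k b)
    simpa using this
  refine ⟨?_, ?_, ?_⟩
  · intro p
    exact Finset.sum_nonneg fun i _ => mul_nonneg (hγ0 _)
      (Finset.prod_nonneg fun k _ => outerProj_trace_nonneg _ _ (hpsd _ _ _))
  · have h := sum_measP γ σ (fun _ q => outerProj (e q)) (fun _ => Finset.univ)
    rw [Fintype.piFinset_univ] at h
    rw [h, chainS_rows, hγ1]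
    intro k a
    simp only [hsum, hrow]
  · intro k q
    have hset : (Finset.univ.filter fun p : Fin m → Fin d => p k = q) =
        Fintype.piFinset (fun l => if l = k then {q} else Finset.univ) := by
      ext p
      simp only [Finset.mem_filter, Finset.mem_univ, true_and, Fintype.mem_piFinset]
      constructor
      · intro hp l
        by_cases hl : l = k
        · subst hl; simp [hp]
        · simp [hl]
      · intro hp
        simpa using hp k
    rw [hset, sum_measP, chainS_marg _ _ k]
    · refine Finset.sum_congr rfl fun a _ => ?_
      simp [Finset.mul_sum, Matrix.trace_sum]
    · intro l hl a
      simp only [if_neg hl, hsum, hrow]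
    · intro l hl b
      simp only [if_neg hl, hsum, hcol]
end

section
/- Continuity of the von Neumann entropy (Fannes-type inequality): Let ρ and σ be density matrices on ℂ^d with ‖ρ − σ‖₁ ≤ θ and θ ≤ 1/2. Then |S(ρ) − S(σ)| ≤ −θ log₂(θ/d). -/
open scoped BigOperators ComplexOrder Matrix

/-- The trace norm of a Hermitian matrix: the sum of the absolute values of its
eigenvalues (junk value `0` on non-Hermitian matrices). -/
noncomputable def traceNorm {D : Type*} [Fintype D] [DecidableEq D] (A : Matrix D D ℂ) : ℝ :=
  if h : A.IsHermitian then ∑ p, |h.eigenvalues p| else 0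

/-- Quadratic form in the eigenbasis. -/
lemma fannes_quad {d : ℕ} {A : Matrix (Fin d) (Fin d) ℂ} (hA : A.IsHermitian) (x : Fin d → ℂ) :
    star x ⬝ᵥ (A *ᵥ x) =
      ((∑ i, hA.eigenvalues i *
        Complex.normSq (((hA.eigenvectorUnitary : Matrix (Fin d) (Fin d) ℂ)ᴴ *ᵥ x) i) : ℝ) : ℂ) := by
  set U := (hA.eigenvectorUnitary : Matrix (Fin d) (Fin d) ℂ) with hU
  have h1 : A = U * Matrix.diagonal (fun i => (hA.eigenvalues i : ℂ)) * Uᴴ := by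
    have := hA.spectral_theorem
    rw [Unitary.conjStarAlgAut_apply] at this
    exact this
  have h2 : star x ⬝ᵥ (A *ᵥ x) =
      star (Uᴴ *ᵥ x) ⬝ᵥ (Matrix.diagonal (fun i => (hA.eigenvalues i : ℂ)) *ᵥ (Uᴴ *ᵥ x)) := by
    conv_lhs => rw [h1]
    rw [Matrix.star_mulVec, Matrix.conjTranspose_conjTranspose, ← Matrix.mulVec_mulVec,
      ← Matrix.mulVec_mulVec, Matrix.dotProduct_mulVec]
  rw [h2]
  simp only [dotProduct, Matrix.mulVec_diagonal, Pi.star_apply]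
  push_cast
  refine Finset.sum_congr rfl fun i _ => ?_
  rw [Complex.normSq_eq_conj_mul_self]
  simp only [RCLike.star_def]
  ring

lemma fannes_norm {d : ℕ} {A : Matrix (Fin d) (Fin d) ℂ} (hA : A.IsHermitian) (x : Fin d → ℂ) :
    ∑ i, Complex.normSq (((hA.eigenvectorUnitary : Matrix (Fin d) (Fin d) ℂ)ᴴ *ᵥ x) i) =
      ∑ i, Complex.normSq (x i) := by
  set U := (hA.eigenvectorUnitary : Matrix (Fin d) (Fin d) ℂ) with hU
  have h1 : U * Uᴴ = 1 := Unitary.coe_mul_star_self hA.eigenvectorUnitary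
  have key : ∀ y : Fin d → ℂ, ((∑ i, Complex.normSq (y i) : ℝ) : ℂ) = star y ⬝ᵥ y := by
    intro y
    simp only [dotProduct, Pi.star_apply]
    push_cast
    refine Finset.sum_congr rfl fun i _ => ?_
    rw [Complex.normSq_eq_conj_mul_self]
    simp only [RCLike.star_def]
  apply Complex.ofReal_injective
  rw [key, key, Matrix.star_mulVec, Matrix.conjTranspose_conjTranspose, Matrix.dotProduct_mulVec,
    Matrix.vecMul_vecMul, h1, Matrix.vecMul_one]

/-- Weyl monotonicity of ordered eigenvalues. -/
lemma fannes_weyl {d : ℕ} {A B : Matrix (Fin d) (Fin d) ℂ} (hA : A.IsHermitian)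
    (hB : B.IsHermitian) (hAB : (B - A).PosSemidef) (k : Fin d) :
    hA.eigenvalues k ≤ hB.eigenvalues k := by
  let e : Fin d ≃ Fin (Fintype.card (Fin d)) := (Fintype.equivOfCardEq (Fintype.card_fin _)).symm
  have hAe : ∀ i j, e i ≤ e j → hA.eigenvalues j ≤ hA.eigenvalues i := fun i j h =>
    hA.eigenvalues₀_antitone h
  have hBe : ∀ i j, e i ≤ e j → hB.eigenvalues j ≤ hB.eigenvalues i := fun i j h =>
    hB.eigenvalues₀_antitone h
  set U := (hA.eigenvectorUnitary : Matrix (Fin d) (Fin d) ℂ) with hU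
  set W := (hB.eigenvectorUnitary : Matrix (Fin d) (Fin d) ℂ) with hW
  let M : Matrix (Fin d) (Fin d) ℂ := Matrix.of fun i =>
    if e k < e i then Uᴴ i else if e i < e k then Wᴴ i else 0
  have hMk : ∀ x, (M *ᵥ x) k = 0 := by
    intro x
    simp [M, Matrix.mulVec]
  have hns : ¬ Function.Injective (Matrix.mulVecLin M) := by
    intro h
    have hs := LinearMap.injective_iff_surjective.mp h
    obtain ⟨x, hx⟩ := hs (Pi.single k 1)
    have := congrFun hx k
    rw [Matrix.mulVecLin_apply, hMk] at this
    simp at this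
  have : ∃ x : Fin d → ℂ, x ≠ 0 ∧ M *ᵥ x = 0 := by
    by_contra hcon
    push Not at hcon
    apply hns
    rw [injective_iff_map_eq_zero]
    intro x hx
    by_contra hx0
    exact hcon x hx0 hx
  obtain ⟨x, hx0, hx⟩ := this
  have hUx : ∀ i, e k < e i → (Uᴴ *ᵥ x) i = 0 := by
    intro i hi
    have := congrFun hx i
    simpa [M, Matrix.mulVec, hi] using this
  have hWx : ∀ i, e i < e k → (Wᴴ *ᵥ x) i = 0 := by
    intro i hi
    have := congrFun hx i
    simpa [M, Matrix.mulVec, hi, hi.le, not_lt.mpr hi.le] using this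
  have hN : 0 < ∑ i, Complex.normSq (x i) := by
    obtain ⟨i, hi⟩ := Function.ne_iff.mp hx0
    exact Finset.sum_pos' (fun i _ => Complex.normSq_nonneg _)
      ⟨i, Finset.mem_univ _, Complex.normSq_pos.mpr hi⟩
  have hpos := hAB.dotProduct_mulVec_nonneg x
  rw [Matrix.sub_mulVec, dotProduct_sub, fannes_quad hA, fannes_quad hB, ← Complex.ofReal_sub,
    Complex.zero_le_real, sub_nonneg] at hpos
  have h1 : hA.eigenvalues k * ∑ i, Complex.normSq (x i) ≤
      ∑ i, hA.eigenvalues i * Complex.normSq ((Uᴴ *ᵥ x) i) := by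
    rw [← fannes_norm hA, Finset.mul_sum]
    refine Finset.sum_le_sum fun i _ => ?_
    rcases lt_or_ge (e k) (e i) with h | h
    · rw [hUx i h]; simp
    · exact mul_le_mul_of_nonneg_right (hAe i k h) (Complex.normSq_nonneg _)
  have h2 : ∑ i, hB.eigenvalues i * Complex.normSq ((Wᴴ *ᵥ x) i) ≤
      hB.eigenvalues k * ∑ i, Complex.normSq (x i) := by
    rw [← fannes_norm hB, Finset.mul_sum]
    refine Finset.sum_le_sum fun i _ => ?_
    rcases lt_or_ge (e i) (e k) with h | h
    · rw [hWx i h]; simp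
    · exact mul_le_mul_of_nonneg_right (hBe k i h) (Complex.normSq_nonneg _)
  exact le_of_mul_le_mul_right (h1.trans (hpos.trans h2)) hN

lemma fannes_trace {d : ℕ} {A : Matrix (Fin d) (Fin d) ℂ} (hA : A.IsHermitian) {t : ℝ}
    (h : A.trace = (t : ℂ)) : ∑ i, hA.eigenvalues i = t := by
  have := hA.trace_eq_sum_eigenvalues
  rw [h] at this
  apply Complex.ofReal_injective
  rw [this]
  push_cast
  rfl

/-- Mirsky type inequality for density matrices. -/
lemma fannes_mirsky {d : ℕ} {A B : Matrix (Fin d) (Fin d) ℂ} (hA : A.IsHermitian)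
    (hB : B.IsHermitian) (hAt : A.trace = 1) (hBt : B.trace = 1) :
    ∑ i, |hA.eigenvalues i - hB.eigenvalues i| ≤ traceNorm (A - B) := by
  have hM : (A - B).IsHermitian := hA.sub hB
  rw [traceNorm, dif_pos hM]
  set U := (hM.eigenvectorUnitary : Matrix (Fin d) (Fin d) ℂ) with hU
  have h1 : A - B = U * Matrix.diagonal (fun i => (hM.eigenvalues i : ℂ)) * Uᴴ := by
    have := hM.spectral_theorem
    rw [Unitary.conjStarAlgAut_apply] at this
    exact this
  have hUU : Uᴴ * U = 1 := Unitary.coe_star_mul_self hM.eigenvectorUnitary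
  set P := U * Matrix.diagonal (fun i => ((max (hM.eigenvalues i) 0 : ℝ) : ℂ)) * Uᴴ with hP
  have hPpos : P.PosSemidef := by
    apply Matrix.PosSemidef.mul_mul_conjTranspose_same
    rw [Matrix.posSemidef_diagonal_iff]
    intro i
    exact Complex.zero_le_real.mpr (le_max_right _ _)
  have hNpos : (P - (A - B)).PosSemidef := by
    rw [h1, hP, ← sub_mul, ← mul_sub, Matrix.diagonal_sub]
    apply Matrix.PosSemidef.mul_mul_conjTranspose_same
    rw [Matrix.posSemidef_diagonal_iff]
    intro i
    rw [← Complex.ofReal_sub]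
    exact Complex.zero_le_real.mpr (sub_nonneg.mpr (le_max_left _ _))
  have hPt : P.trace = ((∑ i, max (hM.eigenvalues i) 0 : ℝ) : ℂ) := by
    rw [hP, Matrix.trace_mul_comm, ← mul_assoc, hUU, one_mul, Matrix.trace_diagonal]
    push_cast
    rfl
  have hV : (B + P).IsHermitian := hB.add hPpos.1
  have hVt := fannes_trace hV (t := 1 + ∑ i, max (hM.eigenvalues i) 0) (by
    rw [Matrix.trace_add, hBt, hPt]; push_cast; rfl)
  have hMt := fannes_trace hM (t := 0) (by rw [Matrix.trace_sub, hAt, hBt]; simp)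
  have hAs := fannes_trace hA (t := 1) (by simpa using hAt)
  have hBs := fannes_trace hB (t := 1) (by simpa using hBt)
  have hAV : ∀ i, hA.eigenvalues i ≤ hV.eigenvalues i := fun i =>
    fannes_weyl hA hV (by convert hNpos using 1; abel) i
  have hBV : ∀ i, hB.eigenvalues i ≤ hV.eigenvalues i := fun i =>
    fannes_weyl hB hV (by convert hPpos using 1; abel) i
  calc ∑ i, |hA.eigenvalues i - hB.eigenvalues i|
      ≤ ∑ i, (2 * hV.eigenvalues i - hA.eigenvalues i - hB.eigenvalues i) := by
        refine Finset.sum_le_sum fun i _ => ?_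
        rw [abs_le]
        constructor <;> linarith [hAV i, hBV i]
    _ = ∑ i, (2 * max (hM.eigenvalues i) 0 - hM.eigenvalues i) := by
        simp only [Finset.sum_sub_distrib, ← Finset.mul_sum]
        rw [hVt, hAs, hBs, hMt]; ring
    _ = ∑ i, |hM.eigenvalues i| := by
        refine Finset.sum_congr rfl fun i _ => ?_
        rcases le_total (hM.eigenvalues i) 0 with h | h
        · rw [max_eq_right h, abs_of_nonpos h]; ring
        · rw [max_eq_left h, abs_of_nonneg h]; ring

lemma fannes_scalar_aux {s e : ℝ} (hs : 0 ≤ s) (he : 0 ≤ e) (hse : s + e ≤ 1) (he4 : e ≤ 1 / 4) :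
    |Real.negMulLog (s + e) - Real.negMulLog s| ≤ Real.negMulLog e := by
  rcases he.eq_or_lt with rfl | he
  · simp
  rcases hs.eq_or_lt with rfl | hs
  · simp [abs_of_nonneg (Real.negMulLog_nonneg he.le (by linarith))]
  have l1 : Real.log s ≤ Real.log (s + e) := Real.log_le_log hs (by linarith)
  have l2 : Real.log e ≤ Real.log (s + e) := Real.log_le_log he (by linarith)
  have l3 : Real.log (s + e) ≤ 0 := Real.log_nonpos (by linarith) hse
  have l4 : Real.log (s + e) - Real.log s ≤ e / s := by
    rw [← Real.log_div (by linarith) hs.ne']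
    refine (Real.log_le_sub_one_of_pos (by positivity)).trans (le_of_eq ?_)
    field_simp
    ring
  have l5 : s * (Real.log (s + e) - Real.log s) ≤ e := by
    have := mul_le_mul_of_nonneg_left l4 hs.le
    rwa [mul_div_cancel₀ _ hs.ne'] at this
  have l6 : Real.log e ≤ -1 := by
    have h4 : Real.log (1 / 4) = -(2 * Real.log 2) := by
      rw [one_div, Real.log_inv, show (4 : ℝ) = 2 ^ 2 by norm_num, Real.log_pow]; norm_num
    have := Real.log_le_log he he4
    have := Real.log_two_gt_d9
    linarith
  simp only [Real.negMulLog]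
  rw [abs_le]
  constructor
  · nlinarith
  · nlinarith

lemma fannes_scalar {r s : ℝ} (hr : 0 ≤ r) (hr1 : r ≤ 1) (hs : 0 ≤ s) (hs1 : s ≤ 1)
    (h : |r - s| ≤ 1 / 4) :
    |Real.negMulLog r - Real.negMulLog s| ≤ Real.negMulLog |r - s| := by
  rcases le_total s r with hle | hle
  · rw [abs_of_nonneg (sub_nonneg.mpr hle)] at h ⊢
    have := fannes_scalar_aux hs (sub_nonneg.mpr hle) (by linarith) h
    simpa using this
  · rw [abs_sub_comm r s] at h ⊢
    rw [abs_sub_comm (Real.negMulLog r)]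
    rw [abs_of_nonneg (sub_nonneg.mpr hle)] at h ⊢
    have := fannes_scalar_aux hr (sub_nonneg.mpr hle) (by linarith) h
    simpa using this

lemma fannes_mono {x y : ℝ} (hx : 0 ≤ x) (hxy : x ≤ y) (hy : y ≤ 1 / 4) :
    Real.negMulLog x ≤ Real.negMulLog y := by
  have := abs_le.mp (fannes_scalar_aux hx (sub_nonneg.mpr hxy) (by linarith) (by linarith))
  rcases hx.eq_or_lt with rfl | hx
  · simpa using Real.negMulLog_nonneg hxy (by linarith)
  have hy0 : 0 < y := by linarith
  have l6 : Real.log y ≤ -1 := by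
    have h4 : Real.log (1 / 4) = -(2 * Real.log 2) := by
      rw [one_div, Real.log_inv, show (4 : ℝ) = 2 ^ 2 by norm_num, Real.log_pow]; norm_num
    have := Real.log_le_log hy0 hy
    have := Real.log_two_gt_d9
    linarith
  have l4 : Real.log y - Real.log x ≤ (y - x) / x := by
    rw [← Real.log_div (by linarith) hx.ne']
    refine (Real.log_le_sub_one_of_pos (by positivity)).trans (le_of_eq ?_)
    field_simp
  have l5 : x * (Real.log y - Real.log x) ≤ y - x := by
    have := mul_le_mul_of_nonneg_left l4 hx.le
    rwa [mul_div_cancel₀ _ hx.ne'] at this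
  simp only [Real.negMulLog]
  nlinarith

/-- Classical Fannes inequality, natural logarithm. -/
lemma fannes_classical {d : ℕ} (r s : Fin d → ℝ) (hr : ∀ i, 0 ≤ r i) (hs : ∀ i, 0 ≤ s i)
    (hr1 : ∑ i, r i = 1) (hs1 : ∑ i, s i = 1) {θ : ℝ} (h : ∑ i, |r i - s i| ≤ θ)
    (hθ : θ ≤ 1 / 2) :
    |∑ i, Real.negMulLog (r i) - ∑ i, Real.negMulLog (s i)| ≤ -θ * Real.log (θ / d) := by
  have hΔ0 : 0 ≤ ∑ i, |r i - s i| := Finset.sum_nonneg fun i _ => abs_nonneg _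
  have hθ0 : 0 ≤ θ := hΔ0.trans h
  rcases Nat.lt_or_ge d 2 with hd | hd
  · interval_cases d
    · simp at hr1
    · simp at hr1 hs1
      simp only [Finset.univ_unique, Fin.default_eq_zero, Fin.isValue, Finset.sum_singleton, hr1,
        hs1, Nat.cast_one, div_one, sub_self, abs_zero]
      exact Real.negMulLog_nonneg hθ0 (by linarith)
  have hle1 : ∀ t : Fin d → ℝ, (∀ i, 0 ≤ t i) → ∑ i, t i = 1 → ∀ i, t i ≤ 1 := by
    intro t ht ht1 i
    rw [← ht1]
    exact Finset.single_le_sum (fun j _ => ht j) (Finset.mem_univ i)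
  have hε : ∀ i, |r i - s i| ≤ 1 / 4 := by
    intro i
    have e1 : (r i - s i) + ∑ j ∈ Finset.univ.erase i, (r j - s j) = 0 := by
      rw [Finset.add_sum_erase _ (fun j => r j - s j) (Finset.mem_univ i), Finset.sum_sub_distrib, hr1, hs1, sub_self]
    have e2 := Finset.add_sum_erase Finset.univ (fun j => |r j - s j|) (Finset.mem_univ i)
    have e3 := Finset.abs_sum_le_sum_abs (fun j => r j - s j) (Finset.univ.erase i)
    rw [show ∑ j ∈ Finset.univ.erase i, (r j - s j) = -(r i - s i) by linarith, abs_neg] at e3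
    linarith
  have hd0 : (0 : ℝ) < d := by
    have : 0 < d := by omega
    exact_mod_cast this
  have hd2 : (2 : ℝ) ≤ d := by exact_mod_cast hd
  have hJ : ∑ i : Fin d, (1 / (d : ℝ)) • Real.negMulLog |r i - s i| ≤
      Real.negMulLog (∑ i : Fin d, (1 / (d : ℝ)) • |r i - s i|) :=
    Real.concaveOn_negMulLog.le_map_sum (fun i _ => by positivity)
      (by simp [hd0.ne']) (fun i _ => Set.mem_Ici.mpr (abs_nonneg _))
  simp only [smul_eq_mul, ← Finset.mul_sum] at hJ
  have hmono : Real.negMulLog (1 / d * ∑ i, |r i - s i|) ≤ Real.negMulLog (θ / d) := by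
    rw [one_div_mul_eq_div]
    apply fannes_mono (by positivity)
    · gcongr
    · rw [div_le_iff₀ hd0]; linarith
  calc |∑ i, Real.negMulLog (r i) - ∑ i, Real.negMulLog (s i)|
      ≤ ∑ i, |Real.negMulLog (r i) - Real.negMulLog (s i)| := by
        rw [← Finset.sum_sub_distrib]; exact Finset.abs_sum_le_sum_abs _ _
    _ ≤ ∑ i, Real.negMulLog |r i - s i| := Finset.sum_le_sum fun i _ =>
        fannes_scalar (hr i) (hle1 r hr hr1 i) (hs i) (hle1 s hs hs1 i) (hε i)
    _ = d * (1 / d * ∑ i, Real.negMulLog |r i - s i|) := by field_simp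
    _ ≤ d * Real.negMulLog (θ / d) := by
        exact mul_le_mul_of_nonneg_left (hJ.trans hmono) hd0.le
    _ = -θ * Real.log (θ / d) := by
        simp only [Real.negMulLog]; field_simp

lemma fannes_entropy {d : ℕ} {A : Matrix (Fin d) (Fin d) ℂ} (hA : A.IsHermitian) :
    vnEntropy A = (∑ i, Real.negMulLog (hA.eigenvalues i)) / Real.log 2 := by
  rw [vnEntropy, dif_pos hA, Finset.sum_div, ← Finset.sum_neg_distrib]
  refine Finset.sum_congr rfl fun i _ => ?_
  simp only [Real.negMulLog, Real.logb]
  ring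

/-- Fannes-type continuity of the von Neumann entropy: if `ρ, σ` are density matrices on `ℂ^d`
with `‖ρ − σ‖₁ ≤ θ ≤ 1/2`, then `|S(ρ) − S(σ)| ≤ −θ log₂(θ/d)`. -/
theorem fannes_continuity {d : ℕ} (ρ σ : Matrix (Fin d) (Fin d) ℂ) (θ : ℝ)
    (hρ : ρ.PosSemidef) (hρtr : ρ.trace = 1)
    (hσ : σ.PosSemidef) (hσtr : σ.trace = 1)
    (hθ : traceNorm (ρ - σ) ≤ θ) (hθ2 : θ ≤ 1 / 2) :
    |vnEntropy ρ - vnEntropy σ| ≤ -θ * Real.logb 2 (θ / d) := by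
  have hlog : 0 < Real.log 2 := Real.log_pos (by norm_num)
  have hm := (fannes_mirsky hρ.1 hσ.1 hρtr hσtr).trans hθ
  have hc := fannes_classical hρ.1.eigenvalues hσ.1.eigenvalues hρ.eigenvalues_nonneg
    hσ.eigenvalues_nonneg (fannes_trace hρ.1 (by simpa using hρtr))
    (fannes_trace hσ.1 (by simpa using hσtr)) hm hθ2
  rw [fannes_entropy hρ.1, fannes_entropy hσ.1, ← sub_div, abs_div, abs_of_pos hlog, Real.logb,
    ← mul_div_assoc]
  exact div_le_div_of_nonneg_right hc hlog.le
end
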